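/- Let Γ be a countable, finitely presented group which is either amenable or residually finite. Let C and C' be based free ℤΓ-cochain complexes which are chain homotopy equivalent as complexes of ℤΓ-modules, and assume that both C and C' are ℓ²-acyclic with spectral gap, i.e. all Laplacians Δ_j of the ℓ²-completion of C and Δ'_j of the ℓ²-completion of C' are invertible. Then the L² torsions of C and C' are equal: ∏_j Det_τ(Δ_j)^{(-1)^j · j} = ∏_j Det_τ(Δ'_j)^{(-1)^j · j}. (This is the combinatorial form, in the L²-acyclic case, of the homotopy invariance of L² torsion for normal Γ-coverings with Γ residually finite or amenable.) -/

import Mathlib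

set_option maxHeartbeats 1000000
set_option synthInstance.maxHeartbeats 1000000

/-- Completeness of finite `L^p` products of complete spaces. -/
instance PiLp.instCompleteSpace {ι : Type} (p : ENNReal) (E : ι → Type)
    [∀ i, UniformSpace (E i)] [∀ i, CompleteSpace (E i)] : CompleteSpace (PiLp p E) :=
  PiLp.completeSpace p E

noncomputable section

open scoped ENNReal

/-- `ℓ²(Γ)`, the Hilbert space of square-summable complex functions on `Γ`. -/
abbrev l2 (Γ : Type) : Type := lp (fun _ : Γ => ℂ) 2

variable {Γ : Type} [Group Γ]

theorem translate_memℓp (γ : Γ) (f : l2 Γ) :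
    Memℓp (fun x : Γ => f (x * γ)) (2 : ℝ≥0∞) := by
  have h2 : (0:ℝ) < (2 : ℝ≥0∞).toReal := by norm_num
  apply memℓp_gen
  have hs : Summable fun i : Γ => ‖f i‖ ^ (2 : ℝ≥0∞).toReal := (lp.memℓp f).summable h2
  exact ((Equiv.mulRight γ).summable_iff (f := fun i : Γ => ‖f i‖ ^ (2 : ℝ≥0∞).toReal)).2 hs

/-- The right-translation unitary `(ρ_γ ξ)(x) = ξ(xγ)` on `ℓ²(Γ)`. -/
def rhoEquiv (γ : Γ) : l2 Γ ≃ₗᵢ[ℂ] l2 Γ where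
  toFun f := ⟨fun x => f (x * γ), translate_memℓp γ f⟩
  invFun f := ⟨fun x => f (x * γ⁻¹), translate_memℓp γ⁻¹ f⟩
  left_inv f := by ext x; simp
  right_inv f := by ext x; simp
  map_add' f g := by ext x; simp [lp.coeFn_add]; rfl
  map_smul' c f := by ext x; simp [lp.coeFn_smul]
  norm_map' f := by
    have h2 : (0:ℝ) < (2 : ℝ≥0∞).toReal := by norm_num
    have h1 := lp.norm_rpow_eq_tsum h2
      (⟨fun x => f (x * γ), translate_memℓp γ f⟩ : l2 Γ)
    have h3 := lp.norm_rpow_eq_tsum h2 f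
    have h4 : ∑' x : Γ, ‖f (x * γ)‖ ^ (2 : ℝ≥0∞).toReal
        = ∑' x : Γ, ‖f x‖ ^ (2 : ℝ≥0∞).toReal :=
      (Equiv.mulRight γ).tsum_eq fun x => ‖f x‖ ^ (2 : ℝ≥0∞).toReal
    have h5 := h1.trans (h4.trans h3.symm)
    have h6 : (2 : ℝ≥0∞).toReal = (2:ℝ) := by norm_num
    rw [h6] at h5
    have h7 : ∀ a : ℝ, 0 ≤ a → Real.sqrt (a ^ (2:ℝ)) = a := by
      intro a ha
      rw [show ((2:ℝ)) = ((2:ℕ):ℝ) by norm_num, Real.rpow_natCast]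
      exact Real.sqrt_sq ha
    calc ‖(⟨fun x => f (x * γ), translate_memℓp γ f⟩ : l2 Γ)‖
        = Real.sqrt (‖(⟨fun x => f (x * γ), translate_memℓp γ f⟩ : l2 Γ)‖ ^ (2:ℝ)) :=
          (h7 _ (norm_nonneg _)).symm
      _ = Real.sqrt (‖f‖ ^ (2:ℝ)) := by rw [h5]
      _ = ‖f‖ := h7 _ (norm_nonneg _)

/-- The right-translation unitary as a bounded operator on `ℓ²(Γ)`. -/
def rho (γ : Γ) : l2 Γ →L[ℂ] l2 Γ :=
  ((rhoEquiv γ).toContinuousLinearEquiv : l2 Γ ≃L[ℂ] l2 Γ).toContinuousLinearMap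

/-- For `a = Σ_γ a(γ)γ ∈ ℤΓ`, the operator `R_a := Σ_γ a(γ) ρ_γ` on `ℓ²(Γ)`. -/
def Rop (a : MonoidAlgebra ℤ Γ) : l2 Γ →L[ℂ] l2 Γ :=
  a.coeff.sum fun γ k => (k : ℂ) • rho γ

/-- `ℓ²(Γ)ⁿ`, indexed by a finite type `ι`. -/
abbrev Hn (Γ : Type) [Group Γ] (ι : Type) [Fintype ι] : Type :=
  PiLp 2 fun _ : ι => l2 Γ

def projL (Γ : Type) [Group Γ] {ι : Type} [Fintype ι] (j : ι) : Hn Γ ι →L[ℂ] l2 Γ :=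
  (ContinuousLinearMap.proj j).comp
    (PiLp.continuousLinearEquiv 2 ℂ (fun _ : ι => l2 Γ)).toContinuousLinearMap

def inclL (Γ : Type) [Group Γ] {ι : Type} [Fintype ι] [DecidableEq ι] (i : ι) :
    l2 Γ →L[ℂ] Hn Γ ι :=
  ((PiLp.continuousLinearEquiv 2 ℂ (fun _ : ι => l2 Γ)).symm.toContinuousLinearMap).comp
    { toLinearMap := LinearMap.single ℂ (fun _ : ι => l2 Γ) i
      cont := by
        show Continuous fun x : l2 Γ => (LinearMap.single ℂ (fun _ : ι => l2 Γ) i) x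
        refine continuous_pi fun j => ?_
        show Continuous fun x : l2 Γ => (LinearMap.single ℂ (fun _ : ι => l2 Γ) i) x j
        by_cases h : j = i
        · subst h
          have hfun : (fun x : l2 Γ => (LinearMap.single ℂ (fun _ : ι => l2 Γ) j) x j)
              = fun x => x := by funext x; simp
          rw [hfun]; exact continuous_id
        · have hfun : (fun x : l2 Γ => (LinearMap.single ℂ (fun _ : ι => l2 Γ) i) x j)
              = fun _ => 0 := by funext x; simp [Pi.single_eq_of_ne h]
          rw [hfun]; exact continuous_const }

/-- For a matrix `A = (a_{ij})` over `ℤΓ`, the bounded operator `R_A` on `ℓ²(Γ)ⁿ`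
whose `(i,j)` entry is `R_{a_{ij}}`. -/
def RA {ι κ : Type} [Fintype ι] [Fintype κ] (A : Matrix ι κ (MonoidAlgebra ℤ Γ)) :
    Hn Γ κ →L[ℂ] Hn Γ ι :=
  letI := Classical.decEq ι
  ∑ i, ∑ j, (inclL Γ i).comp ((Rop (A i j)).comp (projL Γ j))

/-- The vector `δ_e ⊗ e_i ∈ ℓ²(Γ)ⁿ`. -/
def deltaE (Γ : Type) [Group Γ] {ι : Type} [Fintype ι] (i : ι) : Hn Γ ι :=
  letI := Classical.decEq ι
  letI := Classical.decEq Γ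
  (PiLp.continuousLinearEquiv 2 ℂ (fun _ : ι => l2 Γ)).symm
    (Pi.single i (lp.single 2 (1 : Γ) 1))

/-- The von Neumann trace `τ(T) := Σ_i ⟨T(δ_e ⊗ e_i), δ_e ⊗ e_i⟩`. -/
def vnTrace {ι : Type} [Fintype ι] (T : Hn Γ ι →L[ℂ] Hn Γ ι) : ℂ :=
  ∑ i, inner (𝕜 := ℂ) (T (deltaE Γ i)) (deltaE Γ i)

instance Hn.instContinuousFunctionalCalculus {ι : Type} [Fintype ι] :
    ContinuousFunctionalCalculus ℝ (Hn Γ ι →L[ℂ] Hn Γ ι) IsSelfAdjoint :=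
  IsSelfAdjoint.instContinuousFunctionalCalculus (A := Hn Γ ι →L[ℂ] Hn Γ ι)

/-- The Fuglede–Kadison determinant
`Det_τ(T) := exp(½ Re τ(log (T*T)))`, where `log(T*T)` is given by the continuous
functional calculus. -/
def FKdet {ι : Type} [Fintype ι] (T : Hn Γ ι →L[ℂ] Hn Γ ι) : ℝ :=
  Real.exp ((1 / 2) * (vnTrace (cfc Real.log (star T * T))).re)

/-- `Γ` is amenable: there is a left-invariant mean on the space of bounded real-valued
functions on `Γ`, i.e. a positive linear functional `m` with `m(1) = 1` and
`m(f(γ⁻¹ ·)) = m(f)` for all `γ` and bounded `f`.  (We give `Γ` the discrete topology, so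
that bounded continuous functions are exactly the bounded functions.) -/
def IsAmenable (Γ : Type) [Group Γ] : Prop :=
  letI : TopologicalSpace Γ := ⊥
  haveI : DiscreteTopology Γ := ⟨rfl⟩
  ∃ m : BoundedContinuousFunction Γ ℝ →ₗ[ℝ] ℝ,
    (∀ f : BoundedContinuousFunction Γ ℝ, (∀ x, 0 ≤ f x) → 0 ≤ m f) ∧
    m 1 = 1 ∧
    ∀ (γ : Γ) (f : BoundedContinuousFunction Γ ℝ),
      m (f.compContinuous ⟨fun x => γ⁻¹ * x, continuous_of_discreteTopology⟩) = m f

/-- `Γ` is finitely presented. -/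
def IsFinitelyPresented (Γ : Type) [Group Γ] : Prop :=
  ∃ (n : ℕ) (rels : Set (FreeGroup (Fin n))),
    rels.Finite ∧ Nonempty (PresentedGroup rels ≃* Γ)

/-- `Γ` is residually finite: every nontrivial element is detected by a homomorphism to a
finite group. -/
def IsResiduallyFinite (Γ : Type) [Group Γ] : Prop :=
  ∀ γ : Γ, γ ≠ 1 → ∃ (G : Type) (_ : Group G) (_ : Finite G) (φ : Γ →* G), φ γ ≠ 1

/-- A based free `ℤΓ`-cochain complex `0 → C⁰ → ⋯ → C^N → 0`. -/
structure BasedFreeComplex (Γ : Type) [Group Γ] where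
  N : ℕ
  basis : ℕ → Type
  fintype : ∀ j, Fintype (basis j)
  bounded : ∀ j, N < j → IsEmpty (basis j)
  d : (j : ℕ) → Matrix (basis (j + 1)) (basis j) (MonoidAlgebra ℤ Γ)
  dd : ∀ j, d (j + 1) * d j = 0

attribute [instance] BasedFreeComplex.fintype

/-- The `j`-th Laplacian `Δ_j := R_{D_j}* R_{D_j} + R_{D_{j-1}} R_{D_{j-1}}*` of the
`ℓ²`-completion of a based free complex. -/
def BasedFreeComplex.lap (C : BasedFreeComplex Γ) :
    (j : ℕ) → (Hn Γ (C.basis j) →L[ℂ] Hn Γ (C.basis j))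
  | 0 => (ContinuousLinearMap.adjoint (RA (C.d 0))).comp (RA (C.d 0))
  | (j + 1) =>
      (ContinuousLinearMap.adjoint (RA (C.d (j + 1)))).comp (RA (C.d (j + 1)))
        + (RA (C.d j)).comp (ContinuousLinearMap.adjoint (RA (C.d j)))

/-- `C` is `ℓ²`-acyclic with spectral gap: all Laplacians are invertible. -/
def BasedFreeComplex.AcyclicWithGap (C : BasedFreeComplex Γ) : Prop :=
  ∀ j, IsUnit (C.lap j)

/-- The `L²` torsion `∏_j Det_τ(Δ_j)^{(-1)^j j}`. -/
def BasedFreeComplex.torsion (C : BasedFreeComplex Γ) : ℝ :=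
  ∏ j ∈ Finset.range (C.N + 1), FKdet (C.lap j) ^ ((-1 : ℤ) ^ j * (j : ℤ))

/-- A cochain map between based free complexes, given in each degree by a matrix over `ℤΓ`. -/
structure CochainMap (C C' : BasedFreeComplex Γ) where
  f : (j : ℕ) → Matrix (C'.basis j) (C.basis j) (MonoidAlgebra ℤ Γ)
  comm : ∀ j, f (j + 1) * C.d j = C'.d j * f j

/-- The identity cochain map. -/
def CochainMap.id (C : BasedFreeComplex Γ) : CochainMap C C where
  f := fun j => letI := Classical.decEq (C.basis j); 1
  comm := fun j => by
    letI := Classical.decEq (C.basis j)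
    letI := Classical.decEq (C.basis (j + 1))
    simp

/-- Composition of cochain maps. -/
def CochainMap.comp {C C' C'' : BasedFreeComplex Γ}
    (g : CochainMap C' C'') (f : CochainMap C C') : CochainMap C C'' where
  f := fun j => g.f j * f.f j
  comm := fun j => by
    rw [Matrix.mul_assoc, f.comm j, ← Matrix.mul_assoc, g.comm j, Matrix.mul_assoc]

/-- Two cochain maps are chain homotopic over `ℤΓ`. -/
def CochainMap.Homotopic {C C' : BasedFreeComplex Γ} (φ ψ : CochainMap C C') : Prop :=
  ∃ h : (j : ℕ) → Matrix (C'.basis j) (C.basis (j + 1)) (MonoidAlgebra ℤ Γ),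
    ψ.f 0 - φ.f 0 = h 0 * C.d 0 ∧
    ∀ j, ψ.f (j + 1) - φ.f (j + 1) = h (j + 1) * C.d (j + 1) + C'.d j * h j

/-- A cochain map is a chain homotopy equivalence over `ℤΓ`. -/
def CochainMap.IsHomotopyEquivalence {C C' : BasedFreeComplex Γ} (φ : CochainMap C C') : Prop :=
  ∃ ψ : CochainMap C' C,
    (ψ.comp φ).Homotopic (CochainMap.id C) ∧ (φ.comp ψ).Homotopic (CochainMap.id C')

section AbstractLog
open Filter Topology

variable {A : Type*} [CStarAlgebra A]

/-- positive invertible -/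
def PosInv (a : A) : Prop := ∃ S : A, IsUnit S ∧ a = star S * S

theorem PosInv.sa {a : A} (h : PosInv a) : IsSelfAdjoint a := by
  obtain ⟨S, _, rfl⟩ := h
  exact IsSelfAdjoint.star_mul_self S

theorem PosInv.isUnit {a : A} (h : PosInv a) : IsUnit a := by
  obtain ⟨S, hS, rfl⟩ := h
  exact hS.star.mul hS

theorem PosInv.pos {a : A} (h : PosInv a) : ∀ x ∈ spectrum ℝ a, 0 < x := by
  intro x hx
  have hu := h.isUnit
  obtain ⟨S, hS, rfl⟩ := h
  have h1 := spectrum_star_mul_self_nonneg (b := S) x hx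
  have h2 : x ≠ 0 := by
    rintro rfl
    exact spectrum.zero_notMem ℝ hu hx
  exact lt_of_le_of_ne h1 (Ne.symm h2)

theorem PosInv.le {a : A} (h : PosInv a) : ∀ x ∈ spectrum ℝ a, x ≤ ‖a‖ := by
  intro x hx
  have := norm_apply_le_norm_cfc (𝕜 := ℝ) (fun x : ℝ => x) a hx (by fun_prop) h.sa
  rw [cfc_id' ℝ a h.sa] at this
  exact (le_abs_self x).trans this

theorem PosInv.one : PosInv (1 : A) := ⟨1, isUnit_one, by simp⟩

theorem PosInv.cont {a : A} (h : PosInv a) : ContinuousOn Real.log (spectrum ℝ a) :=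
  Real.continuousOn_log.mono fun x hx => (h.pos x hx).ne'

theorem cfc_one_sub {a : A} (ha : IsSelfAdjoint a) (c : ℝ) (k : ℕ) :
    cfc (fun x : ℝ => (1 - c⁻¹ * x) ^ k) a = (1 - c⁻¹ • a) ^ k := by
  rw [cfc_pow (fun x : ℝ => 1 - c⁻¹ * x) k a (by fun_prop) ha,
    cfc_sub (fun _ : ℝ => 1) (fun x : ℝ => c⁻¹ * x) a (by fun_prop) (by fun_prop),
    cfc_const_one ℝ a, cfc_const_mul_id c⁻¹ a]

theorem PosInv.norm_lt {a : A} (h : PosInv a) {c : ℝ} (hc : 0 < c) (hac : ‖a‖ ≤ c) :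
    ‖1 - c⁻¹ • a‖ < 1 := by
  have := cfc_one_sub h.sa c 1
  rw [pow_one] at this
  rw [← this]
  apply norm_cfc_lt one_pos
  intro x hx
  have h1 := h.pos x hx
  have h2 := (h.le x hx).trans hac
  have h3 : 0 < c⁻¹ * x := by positivity
  have h4 : c⁻¹ * x ≤ 1 := by
    rw [inv_mul_le_iff₀ hc]; simpa using h2
  rw [pow_one, Real.norm_eq_abs, abs_lt]
  constructor <;> linarith

/-- partial sums approximating the logarithm -/
def plog (c : ℝ) (a : A) (n : ℕ) : A :=
  (Real.log c) • (1 : A) - ∑ k ∈ Finset.range n, ((k : ℝ) + 1)⁻¹ • (1 - c⁻¹ • a) ^ (k + 1)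

theorem plog_eq_cfc {a : A} (ha : IsSelfAdjoint a) (c : ℝ) (n : ℕ) :
    plog c a n = cfc (fun x : ℝ => Real.log c -
      ∑ k ∈ Finset.range n, ((k : ℝ) + 1)⁻¹ * (1 - c⁻¹ * x) ^ (k + 1)) a := by
  rw [cfc_sub (fun _ : ℝ => Real.log c) _ a (by fun_prop) (by fun_prop), cfc_const _ a ha, plog,
    Algebra.algebraMap_eq_smul_one]
  congr 1
  have := cfc_sum (fun (k : ℕ) (x : ℝ) => ((k : ℝ) + 1)⁻¹ * (1 - c⁻¹ * x) ^ (k + 1)) a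
    (Finset.range n) (fun i _ => by fun_prop)
  have e : (∑ k ∈ Finset.range n, fun x : ℝ => ((k : ℝ) + 1)⁻¹ * (1 - c⁻¹ * x) ^ (k + 1))
    = fun x : ℝ => ∑ k ∈ Finset.range n, ((k : ℝ) + 1)⁻¹ * (1 - c⁻¹ * x) ^ (k + 1) := by
    funext x; simp
  rw [e] at this
  rw [this]
  refine Finset.sum_congr rfl fun k _ => ?_
  rw [cfc_const_mul _ _ a (by fun_prop), cfc_one_sub ha]

theorem PosInv.tendsto_plog {a : A} (h : PosInv a) {c : ℝ} (hc : 0 < c) (hac : ‖a‖ ≤ c) :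
    Tendsto (plog c a) atTop (𝓝 (cfc Real.log a)) := by
  set r := ‖1 - c⁻¹ • a‖ with hr
  have hr1 : r < 1 := h.norm_lt hc hac
  have hr0 : 0 ≤ r := norm_nonneg _
  rw [tendsto_iff_norm_sub_tendsto_zero]
  refine squeeze_zero (g := fun n => r ^ (n + 1) / (1 - r)) (fun _ => norm_nonneg _) ?_ ?_
  · intro n
    rw [plog_eq_cfc h.sa, ← cfc_sub _ _ a (by fun_prop) h.cont]
    have h1r : 0 < 1 - r := by linarith
    apply norm_cfc_le (by positivity)
    intro x hx
    have hz : |1 - c⁻¹ * x| ≤ r := by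
      have := norm_apply_le_norm_cfc (𝕜 := ℝ) (fun x : ℝ => (1 - c⁻¹ * x) ^ 1) a hx
        (by fun_prop) h.sa
      rw [cfc_one_sub h.sa c 1] at this
      simpa using this
    have hx0 := h.pos x hx
    have key := Real.abs_log_sub_add_sum_range_le (x := 1 - c⁻¹ * x) (by linarith) n
    have e : Real.log (1 - (1 - c⁻¹ * x)) = Real.log x - Real.log c := by
      rw [sub_sub_cancel, Real.log_mul (by positivity) hx0.ne', Real.log_inv]; ring
    rw [e] at key
    have e2 : Real.log c - ∑ k ∈ Finset.range n, ((k : ℝ) + 1)⁻¹ * (1 - c⁻¹ * x) ^ (k + 1)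
        - Real.log x = -(∑ i ∈ Finset.range n, (1 - c⁻¹ * x) ^ (i + 1) / ((i : ℝ) + 1)
          + (Real.log x - Real.log c)) := by
      have : ∀ k : ℕ, ((k : ℝ) + 1)⁻¹ * (1 - c⁻¹ * x) ^ (k + 1)
        = (1 - c⁻¹ * x) ^ (k + 1) / ((k : ℝ) + 1) := fun k => by rw [div_eq_mul_inv, mul_comm]
      simp only [this]; ring
    rw [e2, norm_neg, Real.norm_eq_abs]
    refine key.trans ?_
    gcongr
  · have := (tendsto_pow_atTop_nhds_zero_of_lt_one hr0 hr1).comp (tendsto_add_atTop_nat 1)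
    simpa using this.div_const (1 - r)

/-- Transfer principle: linear functionals agreeing on powers agree on logs. -/
theorem log_transfer {B E : Type*} [CStarAlgebra B] [NormedAddCommGroup E] [NormedSpace ℝ E]
    {a : A} {b : B} (ha : PosInv a) (hb : PosInv b) (L : A →L[ℝ] E) (R : B →L[ℝ] E)
    (h : ∀ k, L (a ^ k) = R (b ^ k)) : L (cfc Real.log a) = R (cfc Real.log b) := by
  set c := ‖a‖ + ‖b‖ + 1
  have hc : 0 < c := by positivity
  have h1 := (L.continuous.tendsto _).comp (ha.tendsto_plog hc (by
    have := norm_nonneg b; simp only [c]; linarith))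
  have h2 := (R.continuous.tendsto _).comp (hb.tendsto_plog hc (by
    have := norm_nonneg a; simp only [c]; linarith))
  have e : ∀ k, L ((1 - c⁻¹ • a) ^ k) = R ((1 - c⁻¹ • b) ^ k) := by
    intro k
    have ca : ∀ {X : Type _} [CStarAlgebra X] (x : X), (1 - c⁻¹ • x) ^ k
        = ∑ m ∈ Finset.range (k + 1), ((-c⁻¹) ^ m * (k.choose m : ℝ)) • x ^ m := by
      intro X _ x
      rw [sub_eq_neg_add, ← neg_smul, (Commute.one_right _).add_pow]
      refine Finset.sum_congr rfl fun m _ => ?_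
      rw [smul_pow, one_pow, mul_one, mul_smul, smul_mul_assoc]
      congr 1
      rw [← nsmul_eq_mul', Nat.cast_smul_eq_nsmul]
    have cb : (1 - c⁻¹ • b) ^ k
        = ∑ m ∈ Finset.range (k + 1), ((-c⁻¹) ^ m * (k.choose m : ℝ)) • b ^ m := by
      rw [sub_eq_neg_add, ← neg_smul, (Commute.one_right _).add_pow]
      refine Finset.sum_congr rfl fun m _ => ?_
      rw [smul_pow, one_pow, mul_one, mul_smul, smul_mul_assoc]
      congr 1
      rw [← nsmul_eq_mul', Nat.cast_smul_eq_nsmul]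
    rw [ca, cb]
    simp only [map_sum, map_smul, h]
  refine tendsto_nhds_unique h1 (h2.congr fun n => ?_)
  have h0 := h 0
  simp only [pow_zero] at h0
  simp only [Function.comp, plog, map_sub, map_sum, map_smul, e, h0]

theorem log_intertwine {a b V : A} (ha : PosInv a) (hb : PosInv b) (h : a * V = V * b) :
    cfc Real.log a * V = V * cfc Real.log b := by
  have := log_transfer ha hb ((ContinuousLinearMap.mul ℝ A).flip V) (ContinuousLinearMap.mul ℝ A V)
    (fun k => by
      simp only [ContinuousLinearMap.flip_apply, ContinuousLinearMap.mul_apply']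
      induction k with
      | zero => simp
      | succ k ih => rw [pow_succ, mul_assoc, h, ← mul_assoc, ih, mul_assoc, ← pow_succ])
  simpa using this

theorem log_one' : cfc Real.log (1 : A) = 0 := by
  have : cfc Real.log (1 : A) = cfc (fun _ => (0:ℝ)) (1 : A) := by
    apply cfc_congr
    intro x hx
    rcases subsingleton_or_nontrivial A with hA | hA
    · simp [spectrum.of_subsingleton] at hx
    · rw [spectrum.one_eq] at hx
      simp at hx
      simp [hx]
  rw [this]
  simp

theorem log_inv' {a b : A} (ha : PosInv a) (hab : a * b = 1) (hba : b * a = 1) :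
    cfc Real.log b = - cfc Real.log a := by
  have hb : b = cfc (fun x : ℝ => x⁻¹) a := by
    have h1 := cfc_inv (fun x : ℝ => x) a (fun x hx => (ha.pos x hx).ne') (by fun_prop) ha.sa
    rw [cfc_id' ℝ a ha.sa] at h1
    rw [h1]
    let u : Aˣ := ⟨a, b, hab, hba⟩
    exact (Ring.inverse_unit u).symm
  have hc : ContinuousOn (fun x : ℝ => x⁻¹) (spectrum ℝ a) :=
    ContinuousOn.inv₀ (by fun_prop) (fun x hx => (ha.pos x hx).ne')
  rw [hb, ← cfc_comp Real.log _ a ha.sa ?_ hc, ← cfc_neg]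
  · apply cfc_congr
    intro x hx
    simp
  · apply Real.continuousOn_log.mono
    rintro _ ⟨x, hx, rfl⟩
    simpa using (ha.pos x hx).ne'

theorem log_sq' {a : A} (ha : PosInv a) :
    cfc Real.log (a * a) = (2:ℝ) • cfc Real.log a := by
  have hb : a * a = cfc (fun x : ℝ => x ^ 2) a := by
    rw [cfc_pow_id a 2 ha.sa, sq]
  rw [hb, ← cfc_comp Real.log (fun x : ℝ => x ^ 2) a ha.sa ?_ (by fun_prop),
    ← cfc_smul _ _ a ha.cont]
  · apply cfc_congr
    intro x hx
    simp
  · apply Real.continuousOn_log.mono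
    rintro _ ⟨x, hx, rfl⟩
    simpa using (ha.pos x hx).ne'

end AbstractLog

section AbstractMul
open Filter Topology

variable {A : Type*} [CStarAlgebra A]

/-- derivative of trace of the power series along an affine path -/
theorem trace_pow_deriv (τ : A →L[ℝ] ℝ) (hτ : ∀ x y, τ (x * y) = τ (y * x)) (ε z v : A)
    (hz : ε * z = z * ε) (hv : ε * v = v * ε) (t : ℝ) (k : ℕ) :
    HasDerivAt (fun t : ℝ => τ (ε * (z + t • v) ^ (k + 1)))
      (((k : ℝ) + 1) * τ (ε * (z + t • v) ^ k * v)) t := by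
  have h1 : HasDerivAt (fun t : ℝ => z + t • v) v t := by
    simpa using ((hasDerivAt_id t).smul_const v).const_add z
  have h2 := h1.pow' (k + 1)
  have h3 := (τ.hasFDerivAt.comp_hasDerivAt t (h2.const_mul ε))
  refine h3.congr_deriv ?_
  set y := z + t • v with hy
  have hc : Commute ε y := by
    rw [hy]
    have h1 : Commute ε z := hz
    have h2 : Commute ε v := hv
    exact h1.add_right (h2.smul_right t)
  simp only [Finset.mul_sum, map_sum]
  have : ∀ i ∈ Finset.range (k + 1), τ (ε * (y ^ ((k + 1).pred - i) * v * y ^ i))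
      = τ (ε * y ^ k * v) := by
    intro i hi
    have hi' : i ≤ k := by simpa [Nat.lt_succ_iff] using hi
    have e : y ^ k = y ^ i * y ^ (k - i) := by rw [← pow_add]; congr 1; omega
    rw [show ε * (y ^ ((k + 1).pred - i) * v * y ^ i) = (ε * y ^ ((k + 1).pred - i) * v) * y ^ i by
      simp only [mul_assoc], hτ, e, Nat.pred_succ, ← mul_assoc, ← mul_assoc, ← mul_assoc,
      (hc.pow_right i).eq]
  rw [Finset.sum_congr rfl this]
  simp

theorem gsum_deriv (τ : A →L[ℝ] ℝ) (hτ : ∀ x y, τ (x * y) = τ (y * x)) (ε z v : A)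
    (hz : ε * z = z * ε) (hv : ε * v = v * ε) (t : ℝ) (n : ℕ) :
    HasDerivAt (fun t : ℝ => ∑ k ∈ Finset.range n, ((k:ℝ) + 1)⁻¹ * τ (ε * (z + t • v) ^ (k + 1)))
      (τ (ε * (∑ k ∈ Finset.range n, (z + t • v) ^ k) * v)) t := by
  have := HasDerivAt.fun_sum (u := Finset.range n) (fun k _ =>
    (trace_pow_deriv τ hτ ε z v hz hv t k).const_mul (((k:ℝ) + 1)⁻¹))
  refine this.congr_deriv ?_
  rw [Finset.mul_sum, Finset.sum_mul, map_sum]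
  refine Finset.sum_congr rfl fun k _ => ?_
  rw [← mul_assoc, inv_mul_cancel₀ (by positivity), one_mul]

/-- closeness to the derivative of the logarithm -/
theorem gsum_close (τ : A →L[ℝ] ℝ) (ε z v u : A) {r : ℝ} (hr : r < 1) (hzr : ‖z‖ ≤ r)
    (hu : (1 - z) * u = 1) (n : ℕ) :
    |τ (ε * (∑ k ∈ Finset.range n, z ^ k) * v) - τ (ε * u * v)|
      ≤ ‖τ‖ * ‖ε‖ * (‖(1:A)‖ / (1 - r)) * ‖v‖ * (r ^ n * ‖(1:A)‖) := by
  have hr0 : 0 ≤ r := (norm_nonneg _).trans hzr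
  have h1 : ∑ k ∈ Finset.range n, z ^ k = u - z ^ n * u := by
    have := geom_sum_mul_neg z n
    calc ∑ k ∈ Finset.range n, z ^ k = (∑ k ∈ Finset.range n, z ^ k) * ((1 - z) * u) := by
          rw [hu, mul_one]
      _ = u - z ^ n * u := by rw [← mul_assoc, this, sub_mul, one_mul]
  have h2 : ‖u‖ ≤ ‖(1:A)‖ / (1 - r) := by
    rw [le_div_iff₀ (by linarith)]
    have : u = 1 + z * u := by rw [← hu]; noncomm_ring
    have h3 : ‖u‖ ≤ ‖(1:A)‖ + r * ‖u‖ := by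
      calc ‖u‖ = ‖1 + z * u‖ := by rw [← this]
        _ ≤ ‖(1:A)‖ + ‖z * u‖ := norm_add_le _ _
        _ ≤ ‖(1:A)‖ + ‖z‖ * ‖u‖ := by gcongr; exact norm_mul_le _ _
        _ ≤ _ := by gcongr
    linarith
  have hpow : ‖z ^ n‖ ≤ r ^ n * ‖(1:A)‖ := by
    rcases n with _ | n
    · simp
    · rcases subsingleton_or_nontrivial A with hA | hA
      · have : z ^ (n+1) = 0 := Subsingleton.elim _ _
        rw [this, norm_zero]; positivity
      · rw [norm_one, mul_one]
        exact (norm_pow_le' z (Nat.succ_pos n)).trans (by gcongr)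
  rw [← map_sub, h1]
  have : ε * (u - z ^ n * u) * v - ε * u * v = -(ε * (z ^ n * u) * v) := by noncomm_ring
  rw [this, map_neg, abs_neg, ← Real.norm_eq_abs]
  calc ‖τ (ε * (z ^ n * u) * v)‖ ≤ ‖τ‖ * ‖ε * (z ^ n * u) * v‖ := τ.le_opNorm _
    _ ≤ ‖τ‖ * (‖ε‖ * (‖z ^ n‖ * ‖u‖) * ‖v‖) := by
        gcongr
        refine (norm_mul_le _ _).trans ?_
        gcongr
        refine (norm_mul_le _ _).trans ?_
        gcongr
        exact norm_mul_le _ _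
    _ ≤ ‖τ‖ * (‖ε‖ * ((r ^ n * ‖(1:A)‖) * (‖(1:A)‖ / (1 - r))) * ‖v‖) := by gcongr
    _ = _ := by ring

/-- comparing two paths with the same logarithmic derivative -/
theorem path_compare (τ : A →L[ℝ] ℝ) (hτ : ∀ x y, τ (x * y) = τ (y * x)) (ε : A) (θ : ℝ)
    {x0 x1 y0 y1 : A} (hx0 : PosInv x0) (hx1 : PosInv x1) (hy0 : PosInv y0) (hy1 : PosInv y1)
    (cx0 : ε * x0 = x0 * ε) (cx1 : ε * x1 = x1 * ε)
    (cy0 : ε * y0 = y0 * ε) (cy1 : ε * y1 = y1 * ε)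
    (H : ∀ t : ℝ, ∀ u w : A, (x0 + t • (x1 - x0)) * u = 1 → u * (x0 + t • (x1 - x0)) = 1 →
      (y0 + t • (y1 - y0)) * w = 1 → w * (y0 + t • (y1 - y0)) = 1 →
      τ (ε * u * (x1 - x0)) = θ * τ (ε * w * (y1 - y0))) :
    τ (ε * cfc Real.log x1) - τ (ε * cfc Real.log x0)
      = θ * (τ (ε * cfc Real.log y1) - τ (ε * cfc Real.log y0)) := by
  set c := ‖x0‖ + ‖x1‖ + ‖y0‖ + ‖y1‖ + 1 with hcdef
  have n1 := norm_nonneg x0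
  have n2 := norm_nonneg x1
  have n3 := norm_nonneg y0
  have n4 := norm_nonneg y1
  have hc : 0 < c := by positivity
  set r := max (max ‖1 - c⁻¹ • x0‖ ‖1 - c⁻¹ • x1‖) (max ‖1 - c⁻¹ • y0‖ ‖1 - c⁻¹ • y1‖) with hr
  have hr1 : r < 1 := by
    simp only [hr, max_lt_iff]
    exact ⟨⟨hx0.norm_lt hc (by linarith), hx1.norm_lt hc (by linarith)⟩,
      ⟨hy0.norm_lt hc (by linarith), hy1.norm_lt hc (by linarith)⟩⟩
  have hr0 : 0 ≤ r := (norm_nonneg _).trans ((le_max_left _ _).trans (le_max_left _ _))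
  -- affine paths
  have hpath : ∀ a b : A, ‖1 - c⁻¹ • a‖ ≤ r → ‖1 - c⁻¹ • b‖ ≤ r → ∀ t ∈ Set.Icc (0:ℝ) 1,
      ‖(1 - c⁻¹ • a) + t • (c⁻¹ • (a - b))‖ ≤ r := by
    intro a b ha hb t ht
    have e : (1 - c⁻¹ • a) + t • (c⁻¹ • (a - b)) = (1 - t) • (1 - c⁻¹ • a) + t • (1 - c⁻¹ • b) := by
      module
    rw [e]
    calc _ ≤ ‖(1 - t) • (1 - c⁻¹ • a)‖ + ‖t • (1 - c⁻¹ • b)‖ := norm_add_le _ _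
      _ = (1 - t) * ‖1 - c⁻¹ • a‖ + t * ‖1 - c⁻¹ • b‖ := by
          rw [norm_smul, norm_smul, Real.norm_of_nonneg (by linarith [ht.2]),
            Real.norm_of_nonneg ht.1]
      _ ≤ (1 - t) * r + t * r := by
          have := ht.1; have := ht.2
          gcongr
      _ = r := by ring
  have hX := hpath x0 x1 ((le_max_left _ _).trans (le_max_left _ _))
    ((le_max_right _ _).trans (le_max_left _ _))
  have hY := hpath y0 y1 ((le_max_left _ _).trans (le_max_right _ _))
    ((le_max_right _ _).trans (le_max_right _ _))
  have comm1 : ∀ a : A, ε * a = a * ε → ε * (1 - c⁻¹ • a) = (1 - c⁻¹ • a) * ε := by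
    intro a ha
    rw [mul_sub, sub_mul, mul_smul_comm, smul_mul_assoc, ha, one_mul, mul_one]
  have comm2 : ∀ a b : A, ε * a = a * ε → ε * b = b * ε →
      ε * (c⁻¹ • (a - b)) = (c⁻¹ • (a - b)) * ε := by
    intro a b ha hb
    rw [mul_smul_comm, smul_mul_assoc, mul_sub, sub_mul, ha, hb]
  let g : A → A → ℕ → ℝ → ℝ := fun a b n t => ∑ k ∈ Finset.range n,
    ((k:ℝ) + 1)⁻¹ * τ (ε * ((1 - c⁻¹ • a) + t • (c⁻¹ • (a - b))) ^ (k + 1))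
  have hg0 : ∀ a b n, τ (ε * plog c a n) = Real.log c * τ ε - g a b n 0 := by
    intro a b n
    simp only [g, plog, zero_smul, add_zero, mul_sub, Finset.mul_sum, map_sub, map_sum,
      mul_smul_comm, map_smul, mul_one, smul_eq_mul]
  have hg1 : ∀ a b n, τ (ε * plog c b n) = Real.log c * τ ε - g a b n 1 := by
    intro a b n
    have : ∀ a b : A, (1 - c⁻¹ • a) + (1:ℝ) • (c⁻¹ • (a - b)) = 1 - c⁻¹ • b := by
      intro a b; module
    simp only [g, plog, this, mul_sub, Finset.mul_sum, map_sub, map_sum,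
      mul_smul_comm, map_smul, mul_one, smul_eq_mul]
  obtain ⟨K, hK⟩ : ∃ K : ℝ, ∀ n, |(g x0 x1 n 1 - g x0 x1 n 0) - θ * (g y0 y1 n 1 - g y0 y1 n 0)|
      ≤ K * r ^ n := by
    refine ⟨‖τ‖ * ‖ε‖ * (‖(1:A)‖ / (1 - r)) * ‖c⁻¹ • (x0 - x1)‖ * ‖(1:A)‖ +
      |θ| * (‖τ‖ * ‖ε‖ * (‖(1:A)‖ / (1 - r)) * ‖c⁻¹ • (y0 - y1)‖ * ‖(1:A)‖), fun n => ?_⟩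
    have := norm_image_sub_le_of_norm_deriv_le_segment_01'
      (f := fun t => g x0 x1 n t - θ * g y0 y1 n t)
      (f' := fun t => τ (ε * (∑ k ∈ Finset.range n,
          ((1 - c⁻¹ • x0) + t • (c⁻¹ • (x0 - x1))) ^ k) * (c⁻¹ • (x0 - x1)))
        - θ * τ (ε * (∑ k ∈ Finset.range n,
          ((1 - c⁻¹ • y0) + t • (c⁻¹ • (y0 - y1))) ^ k) * (c⁻¹ • (y0 - y1))))
      (C := (‖τ‖ * ‖ε‖ * (‖(1:A)‖ / (1 - r)) * ‖c⁻¹ • (x0 - x1)‖ * ‖(1:A)‖ +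
      |θ| * (‖τ‖ * ‖ε‖ * (‖(1:A)‖ / (1 - r)) * ‖c⁻¹ • (y0 - y1)‖ * ‖(1:A)‖)) * r ^ n)
      (fun t _ => by
        refine HasDerivAt.hasDerivWithinAt ?_
        exact (gsum_deriv τ hτ ε _ _ (comm1 _ cx0) (comm2 _ _ cx0 cx1) t n).sub
          ((gsum_deriv τ hτ ε _ _ (comm1 _ cy0) (comm2 _ _ cy0 cy1) t n).const_mul θ))
      (fun t ht => ?_)
    · have e : (g x0 x1 n 1 - g x0 x1 n 0) - θ * (g y0 y1 n 1 - g y0 y1 n 0)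
        = (g x0 x1 n 1 - θ * g y0 y1 n 1) - (g x0 x1 n 0 - θ * g y0 y1 n 0) := by ring
      rw [e, ← Real.norm_eq_abs]
      exact this
    · have ht' : t ∈ Set.Icc (0:ℝ) 1 := ⟨ht.1, ht.2.le⟩
      set zx := (1 - c⁻¹ • x0) + t • (c⁻¹ • (x0 - x1)) with hzx
      set zy := (1 - c⁻¹ • y0) + t • (c⁻¹ • (y0 - y1)) with hzy
      have hzxn : ‖zx‖ ≤ r := hX t ht'
      have hzyn : ‖zy‖ ≤ r := hY t ht'
      set ux := Units.oneSub zx (hzxn.trans_lt hr1)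
      set uy := Units.oneSub zy (hzyn.trans_lt hr1)
      have hux1 : (1 - zx) * (↑ux⁻¹ : A) = 1 := ux.mul_inv
      have hux2 : (↑ux⁻¹ : A) * (1 - zx) = 1 := ux.inv_mul
      have huy1 : (1 - zy) * (↑uy⁻¹ : A) = 1 := uy.mul_inv
      have huy2 : (↑uy⁻¹ : A) * (1 - zy) = 1 := uy.inv_mul
      have b1 := gsum_close τ ε zx (c⁻¹ • (x0 - x1)) _ hr1 hzxn hux1 n
      have b2 := gsum_close τ ε zy (c⁻¹ • (y0 - y1)) _ hr1 hzyn huy1 n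
      have e1 : ∀ a b : A, c • (1 - ((1 - c⁻¹ • a) + t • (c⁻¹ • (a - b)))) = a + t • (b - a) := by
        intro a b
        have : c • (1 - ((1 - c⁻¹ • a) + t • (c⁻¹ • (a - b)))) = (c * c⁻¹) • (a + t • (b - a)) := by
          module
        rw [this, mul_inv_cancel₀ hc.ne', one_smul]
      have Hx := H t (c⁻¹ • (↑ux⁻¹ : A)) (c⁻¹ • (↑uy⁻¹ : A))
        (by rw [← e1, ← hzx, smul_mul_smul_comm, hux1, mul_inv_cancel₀ hc.ne', one_smul])
        (by rw [← e1, ← hzx, smul_mul_smul_comm, hux2, inv_mul_cancel₀ hc.ne', one_smul])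
        (by rw [← e1, ← hzy, smul_mul_smul_comm, huy1, mul_inv_cancel₀ hc.ne', one_smul])
        (by rw [← e1, ← hzy, smul_mul_smul_comm, huy2, inv_mul_cancel₀ hc.ne', one_smul])
      have Hx' : τ (ε * (↑ux⁻¹ : A) * (c⁻¹ • (x0 - x1))) = θ * τ (ε * (↑uy⁻¹ : A) * (c⁻¹ • (y0 - y1))) := by
        have q : ∀ (a b : A) (u : A), τ (ε * u * (c⁻¹ • (a - b))) = - τ (ε * (c⁻¹ • u) * (b - a)) := by
          intro a b u
          rw [← map_neg]
          congr 1
          rw [mul_smul_comm, mul_smul_comm, smul_mul_assoc, ← smul_neg]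
          congr 1
          noncomm_ring
        rw [q, q, Hx]; ring
      set P := τ (ε * (∑ k ∈ Finset.range n, zx ^ k) * (c⁻¹ • (x0 - x1)))
      set Q := τ (ε * (∑ k ∈ Finset.range n, zy ^ k) * (c⁻¹ • (y0 - y1)))
      set P' := τ (ε * (↑ux⁻¹ : A) * (c⁻¹ • (x0 - x1)))
      set Q' := τ (ε * (↑uy⁻¹ : A) * (c⁻¹ • (y0 - y1)))
      rw [Real.norm_eq_abs]
      calc |P - θ * Q| = |(P - P') - θ * (Q - Q')| := by rw [Hx']; congr 1; ring
        _ ≤ |P - P'| + |θ * (Q - Q')| := abs_sub _ _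
        _ = |P - P'| + |θ| * |Q - Q'| := by rw [abs_mul]
        _ ≤ _ := by
          refine (add_le_add b1 (mul_le_mul_of_nonneg_left b2 (abs_nonneg θ))).trans (le_of_eq ?_)
          ring
  have lim : ∀ a : A, PosInv a → ‖a‖ ≤ c →
      Tendsto (fun n => τ (ε * plog c a n)) atTop (𝓝 (τ (ε * cfc Real.log a))) := by
    intro a ha hac
    exact (τ.continuous.tendsto _).comp ((ha.tendsto_plog hc hac).const_mul ε)
  have L : Tendsto (fun n => (g x0 x1 n 1 - g x0 x1 n 0) - θ * (g y0 y1 n 1 - g y0 y1 n 0)) atTop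
      (𝓝 (-((τ (ε * cfc Real.log x1) - τ (ε * cfc Real.log x0))
        - θ * (τ (ε * cfc Real.log y1) - τ (ε * cfc Real.log y0))))) := by
    have := (((lim x1 hx1 (by linarith)).sub (lim x0 hx0 (by linarith))).sub
      (((lim y1 hy1 (by linarith)).sub (lim y0 hy0 (by linarith))).const_mul θ)).neg
    refine this.congr fun n => ?_
    rw [hg1 x0 x1, hg0 x0 x1, hg1 y0 y1, hg0 y0 y1]
    ring
  have L0 : Tendsto (fun n => (g x0 x1 n 1 - g x0 x1 n 0) - θ * (g y0 y1 n 1 - g y0 y1 n 0)) atTop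
      (𝓝 0) := by
    apply squeeze_zero_norm (a := fun n => K * r ^ n) hK
    simpa using (tendsto_pow_atTop_nhds_zero_of_lt_one hr0 hr1).const_mul K
  have := tendsto_nhds_unique L L0
  linarith

/-- weighted log-determinant -/
def sL (τ : A →L[ℝ] ℝ) (ε S : A) : ℝ := τ (ε * cfc Real.log (star S * S))

theorem sL_mul (τ : A →L[ℝ] ℝ) (hτ : ∀ x y, τ (x * y) = τ (y * x)) {ε S T : A} {θ η : ℝ}
    (hε : star ε = ε) (hθ : θ * θ = 1) (hη : η * η = 1) (hS : IsUnit S) (hT : IsUnit T)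
    (pS : S * ε = η • (ε * S)) (pT : T * ε = θ • (ε * T)) :
    sL τ ε (S * T) = sL τ ε T + θ * sL τ ε S := by
  have star_par : ∀ {X : A} {κ : ℝ}, κ * κ = 1 → X * ε = κ • (ε * X) →
      star X * ε = κ • (ε * star X) := by
    intro X κ hκ h
    have := congrArg star h
    rw [star_mul, star_smul, star_mul, hε] at this
    rw [this, smul_smul]
    simp [hκ]
  have comm : ∀ {X Y : A} {κ : ℝ}, κ * κ = 1 → X * ε = κ • (ε * X) → Y * ε = κ • (ε * Y) →
      ε * (X * Y) = (X * Y) * ε := by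
    intro X Y κ hκ hX hY
    rw [mul_assoc, hY, mul_smul_comm, ← mul_assoc X, hX, smul_mul_assoc, smul_smul, hκ, one_smul,
      mul_assoc]
  set a := star S * S with ha
  have cA : ε * a = a * ε := comm hη (star_par hη pS) pS
  have cT : ε * (star T * T) = (star T * T) * ε := comm hθ (star_par hθ pT) pT
  have cST : ε * (star (S * T) * (S * T)) = (star (S * T) * (S * T)) * ε := by
    have pST : (S * T) * ε = (θ * η) • (ε * (S * T)) := by
      rw [mul_assoc, pT, mul_smul_comm, ← mul_assoc, pS, smul_mul_assoc, smul_smul, mul_assoc]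
    have hh : (θ * η) * (θ * η) = 1 := by linear_combination η * η * hθ + hη
    exact comm hh (star_par hh pST) pST
  have key := path_compare τ hτ ε θ (x0 := star T * T) (x1 := star (S * T) * (S * T))
    (y0 := 1) (y1 := a) ⟨T, hT, rfl⟩ ⟨S * T, hS.mul hT, rfl⟩ PosInv.one ⟨S, hS, rfl⟩
    cT cST (by simp) cA ?_
  · rw [log_one'] at key
    simp only [mul_zero, map_zero, sub_zero] at key
    simp only [sL]
    linarith
  · intro t u w hu1 hu2 hw1 hw2
    obtain ⟨T', rfl⟩ := hT
    set b := (1 : A) + t • (a - 1) with hb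
    have e1 : star (T' : A) * (T' : A) + t • (star (S * T') * (S * T') - star (T' : A) * (T' : A))
        = star (T' : A) * b * T' := by
      rw [hb, star_mul, ha]
      simp only [mul_add, add_mul, mul_one, mul_smul_comm, smul_mul_assoc, mul_sub, sub_mul,
        mul_assoc]
    have e2 : star (S * T') * (S * T') - star (T' : A) * (T' : A) = star (T' : A) * (a - 1) * T' := by
      rw [star_mul, ha]
      simp only [mul_one, mul_sub, sub_mul, mul_assoc]
    rw [e1] at hu1 hu2
    rw [e2]
    have s1 : star (T' : A) * star (↑T'⁻¹ : A) = 1 := by rw [← star_mul]; simp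
    have s2 : star (↑T'⁻¹ : A) * star (T' : A) = 1 := by rw [← star_mul]; simp
    have hu : u = (↑T'⁻¹ : A) * w * star (↑T'⁻¹ : A) := by
      have h : (star (T' : A) * b * T') * ((↑T'⁻¹ : A) * w * star (↑T'⁻¹ : A)) = 1 := by
        calc _ = star (T' : A) * b * (T' * ↑T'⁻¹) * w * star (↑T'⁻¹ : A) := by
              simp only [mul_assoc]
          _ = star (T' : A) * (b * w) * star (↑T'⁻¹ : A) := by simp [mul_assoc]
          _ = 1 := by rw [hw1, mul_one, s1]
      exact left_inv_eq_right_inv hu2 h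
    have e3 : ε * u * (star (T' : A) * (a - 1) * T') = (ε * (↑T'⁻¹ : A) * w * (a - 1)) * T' := by
      rw [hu]
      calc _ = ε * (↑T'⁻¹ : A) * w * (star (↑T'⁻¹ : A) * star (T' : A)) * (a - 1) * T' := by
            simp only [mul_assoc]
        _ = _ := by rw [s2]; simp
    rw [e3, hτ]
    have e4 : (T' : A) * (ε * (↑T'⁻¹ : A) * w * (a - 1)) = θ • (ε * w * (a - 1)) := by
      calc _ = ((T' : A) * ε) * (↑T'⁻¹ : A) * w * (a - 1) := by simp only [mul_assoc]
        _ = θ • (ε * (T' * (↑T'⁻¹ : A)) * w * (a - 1)) := by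
            rw [pT]; simp only [smul_mul_assoc, mul_assoc]
        _ = _ := by simp
    rw [e4, map_smul, smul_eq_mul]

end AbstractMul

section AbstractMain
variable {A : Type*} [CStarAlgebra A]

theorem isUnit_of_inv {x y : A} (h : x * y = 1) (h' : y * x = 1) : IsUnit x :=
  ⟨⟨x, y, h, h'⟩, rfl⟩

theorem sL_one (τ : A →L[ℝ] ℝ) (ε : A) : sL τ ε 1 = 0 := by
  simp [sL]

/-- unipotent elements have trivial log-determinant -/
theorem sL_unip (τ : A →L[ℝ] ℝ) (hτ : ∀ x y, τ (x * y) = τ (y * x)) {ε p N : A}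
    (hε : star ε = ε) (hp : p * p = p) (hpε : p * ε = ε * p) (hNε : N * ε = ε * N)
    (hpN : p * N = N) (hNp : N * p = 0) : sL τ ε (1 + N) = 0 := by
  have hNN : N * N = 0 := by
    calc N * N = N * (p * N) := by rw [hpN]
      _ = (N * p) * N := by rw [mul_assoc]
      _ = 0 := by rw [hNp, zero_mul]
  have m : ∀ {S T : A}, IsUnit S → IsUnit T → S * ε = ε * S → T * ε = ε * T →
      sL τ ε (S * T) = sL τ ε T + sL τ ε S := by
    intro S T hS hT h1 h2
    have := sL_mul τ hτ (θ := 1) (η := 1) hε (by norm_num) (by norm_num) hS hT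
      (by rw [one_smul, h1]) (by rw [one_smul, h2])
    rw [this, one_mul]
  set k := 1 + p with hk
  set k' := 1 - (1/2 : ℝ) • p with hk'
  have kk' : k * k' = 1 := by
    simp only [hk, hk', mul_sub, add_mul, mul_smul_comm, mul_one, one_mul, hp]
    module
  have k'k : k' * k = 1 := by
    simp only [hk, hk', mul_add, sub_mul, smul_mul_assoc, mul_one, one_mul, hp]
    module
  have uN : IsUnit (1 + N) := isUnit_of_inv (y := 1 - N)
    (by linear_combination (norm := noncomm_ring) -hNN)
    (by linear_combination (norm := noncomm_ring) -hNN)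
  have hNk' : N * k' = N := by
    simp [hk', mul_sub, hNp]
  have hkN : k * N = N + N := by
    rw [hk, add_mul, one_mul, hpN]
  have conj : k * ((1 + N) * k') = (1 + N) * (1 + N) := by
    rw [show (1 + N) * k' = k' + N by rw [add_mul, one_mul, hNk'], mul_add, kk', hkN]
    linear_combination (norm := noncomm_ring) -hNN
  have ck : k * ε = ε * k := by rw [hk, add_mul, mul_add, hpε, one_mul, mul_one]
  have ck' : k' * ε = ε * k' := by
    rw [hk', sub_mul, mul_sub, smul_mul_assoc, mul_smul_comm, hpε, one_mul, mul_one]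
  have cN : (1 + N) * ε = ε * (1 + N) := by rw [add_mul, mul_add, hNε, one_mul, mul_one]
  have uk := isUnit_of_inv kk' k'k
  have uk' := isUnit_of_inv k'k kk'
  have e1 := m uk (uN.mul uk') ck (by rw [mul_assoc, ck', ← mul_assoc, cN, mul_assoc])
  have e2 := m uN uk' cN ck'
  have e3 := m uN uN cN cN
  have e4 := m uk uk' ck ck'
  rw [kk', sL_one] at e4
  rw [conj] at e1
  linarith

/-- independence of the contraction -/
theorem sL_contraction (τ : A →L[ℝ] ℝ) (hτ : ∀ x y, τ (x * y) = τ (y * x)) {ε D s t : A}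
    (hε : star ε = ε) (hDD : D * D = 0) (hD : D * ε = -(ε * D))
    (hs : D * s + s * D = 1) (hss : s * s = 0) (hsε : s * ε = -(ε * s))
    (ht : D * t + t * D = 1) (htt : t * t = 0) (htε : t * ε = -(ε * t)) :
    sL τ ε (D + s) = sL τ ε (D + t) := by
  have inv : ∀ x : A, D * x + x * D = 1 → x * x = 0 → (D + x) * (D + x) = 1 := by
    intro x h1 h2
    linear_combination (norm := noncomm_ring) hDD + h1 + h2
  set X := (s - t) * D with hX
  have hXX : X * X = 0 := by
    rw [hX]
    have h1 : D * (s - t) = -((s - t) * D) := by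
      linear_combination (norm := noncomm_ring) hs - ht
    calc (s - t) * D * ((s - t) * D) = (s - t) * (D * (s - t)) * D := by noncomm_ring
      _ = -((s - t) * (s - t) * (D * D)) := by rw [h1]; noncomm_ring
      _ = 0 := by rw [hDD]; simp
  have hg : (D + s) * (1 + X) = (1 + X) * (D + t) := by
    rw [hX]
    linear_combination (norm := noncomm_ring) hs * D - ht * D - (s - t) * hDD + hss * D - s * ht
      + t * ht - (s - t) * hDD - htt * D
  have hXε : X * ε = ε * X := by
    rw [hX]
    linear_combination (norm := noncomm_ring) (s - t) * hD - hsε * D + htε * D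
  have hDsD : D * s * D = D := by
    linear_combination (norm := noncomm_ring) D * hs - hDD * s
  have u0 : sL τ ε (1 + X) = 0 := by
    apply sL_unip τ hτ (p := D * s) hε
    · linear_combination (norm := noncomm_ring) hDsD * s
    · linear_combination (norm := noncomm_ring) D * hsε - hD * s
    · exact hXε
    · rw [hX]
      linear_combination (norm := noncomm_ring) D * s * (hs - ht) - hDsD * (s - t) - (hs - ht)
    · rw [hX]
      linear_combination (norm := noncomm_ring) (s - t) * hDD * s
  have uX : IsUnit (1 + X) := isUnit_of_inv (y := 1 - X)
    (by linear_combination (norm := noncomm_ring) -hXX)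
    (by linear_combination (norm := noncomm_ring) -hXX)
  have us := isUnit_of_inv (inv s hs hss) (inv s hs hss)
  have ut := isUnit_of_inv (inv t ht htt) (inv t ht htt)
  have pX : (1 + X) * ε = (1:ℝ) • (ε * (1 + X)) := by
    rw [one_smul, add_mul, mul_add, hXε, one_mul, mul_one]
  have ps : (D + s) * ε = (-1:ℝ) • (ε * (D + s)) := by
    rw [neg_one_smul]
    linear_combination (norm := noncomm_ring) hD + hsε
  have pt : (D + t) * ε = (-1:ℝ) • (ε * (D + t)) := by
    rw [neg_one_smul]
    linear_combination (norm := noncomm_ring) hD + htε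
  have e1 := sL_mul τ hτ hε (by norm_num) (by norm_num) us uX ps pX
  have e2 := sL_mul τ hτ hε (by norm_num) (by norm_num) uX ut pX pt
  rw [hg] at e1
  linarith


theorem abstract_main (τ : A →L[ℝ] ℝ) (hτ : ∀ x y, τ (x * y) = τ (y * x)) {ε w p κ d F σ : A}
    (hε : star ε = ε) (hp : p * p = p) (hps : star p = p)
    (hκ : κ * κ = 1) (hκs : star κ = κ) (hκd : κ * d = d * κ) (hκp : κ * p = p * κ)
    (hκε : κ * ε = ε * κ)
    (hpd : p * d = d * p) (hpε : p * ε = ε * p) (hdd : d * d = 0) (hdε : d * ε = -(ε * d))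
    (hwd : w * d = -(d * (w + ε)))
    (hΔ : IsUnit (star d * d + d * star d))
    (hpF : p * F = F) (hFp : F * p = 0) (hκF : κ * F = F) (hFκ : F * κ = -F)
    (hFε : F * ε = -(ε * F)) (hdF : d * F = F * d)
    (hσ : (κ * d + F) * σ + σ * (κ * d + F) = 1) (hσσ : σ * σ = 0) (hσε : σ * ε = -(ε * σ))
    (hW : sL τ ε (κ * d + F + σ) = 0) :
    τ (w * cfc Real.log (star d * d + d * star d)) = 0 := by
  set e := star d with he
  have hee : e * e = 0 := by rw [he, ← star_mul, hdd, star_zero]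
  have heε : e * ε = -(ε * e) := by
    have := congrArg star hdε
    rw [star_mul, star_neg, star_mul, hε, ← he] at this
    rw [this, neg_neg]
  have hpe : p * e = e * p := by
    have := congrArg star hpd
    rw [star_mul, star_mul, hps, ← he] at this
    exact this.symm
  have hκe : κ * e = e * κ := by
    have := congrArg star hκd
    rw [star_mul, star_mul, hκs, ← he] at this
    exact this.symm
  set Δ := e * d + d * e with hΔdef
  have hΔpos : PosInv Δ := by
    have h1 : Δ = star (d + e) * (d + e) := by
      rw [star_add, he, star_star, ← he, hΔdef]
      linear_combination (norm := noncomm_ring) -hdd - hee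
    refine ⟨d + e, ?_, h1⟩
    have h2 : Δ = (d + e) ^ 2 := by
      rw [hΔdef]
      linear_combination (norm := noncomm_ring) -hdd - hee
    rw [h2] at hΔ
    exact (isUnit_pow_iff two_ne_zero).1 hΔ
  obtain ⟨u, hu⟩ := hΔ
  set g : A := ↑u⁻¹ with hg
  have hgΔ : g * Δ = 1 := by rw [← hu, hg]; simp
  have hΔg : Δ * g = 1 := by rw [← hu, hg]; simp
  have gcomm : ∀ x : A, x * Δ = Δ * x → x * g = g * x := by
    intro x hx
    linear_combination (norm := noncomm_ring) -g * hx * g - hgΔ * (x * g) + g * x * hΔg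
  have hgd : d * g = g * d := by
    apply gcomm
    rw [hΔdef]
    linear_combination (norm := noncomm_ring) -e * hdd + hdd * e
  have hge : e * g = g * e := by
    apply gcomm
    rw [hΔdef]
    linear_combination (norm := noncomm_ring) -d * hee + hee * d
  have hgp : p * g = g * p := by
    apply gcomm
    rw [hΔdef]
    linear_combination (norm := noncomm_ring) hpe * d + e * hpd + hpd * e + d * hpe
  have hgκ : κ * g = g * κ := by
    apply gcomm
    rw [hΔdef]
    linear_combination (norm := noncomm_ring) hκe * d + e * hκd + hκd * e + d * hκe
  have hgε : ε * g = g * ε := by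
    apply gcomm
    rw [hΔdef]
    linear_combination (norm := noncomm_ring) heε * d - e * hdε + hdε * e - d * heε
  have hgs : star g = g := by
    have h1 : star Δ = Δ := hΔpos.sa
    have h2 : star g * Δ = 1 := by
      have := congrArg star hΔg
      rwa [star_mul, h1, star_one] at this
    exact left_inv_eq_right_inv h2 hΔg
  have hΔg' : (e * d + d * e) * g = 1 := by rw [← hΔdef]; exact hΔg
  have hgΔ' : g * (e * d + d * e) = 1 := by rw [← hΔdef]; exact hgΔ
  obtain ⟨s, hs⟩ : ∃ s, s = e * g := ⟨_, rfl⟩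
  have hds : d * s + s * d = 1 := by
    rw [hs]
    linear_combination (norm := noncomm_ring) hΔg' - e * hgd
  have hss : s * s = 0 := by
    rw [hs]
    linear_combination (norm := noncomm_ring) -e * hge * g + hee * g * g
  have hsε : s * ε = -(ε * s) := by
    rw [hs]
    linear_combination (norm := noncomm_ring) heε * g - e * hgε
  have hsp : p * s = s * p := by
    rw [hs]
    linear_combination (norm := noncomm_ring) hpe * g + e * hgp
  have hsκ : κ * s = s * κ := by
    rw [hs]
    linear_combination (norm := noncomm_ring) hκe * g + e * hgκ
  -- step A
  set l := cfc Real.log Δ with hl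
  have hld : l * d = d * l := log_intertwine hΔpos hΔpos (by
    rw [hΔdef]
    linear_combination (norm := noncomm_ring) e * hdd - hdd * e)
  have ds2 : (d + s) * (d + s) = 1 := by
    linear_combination (norm := noncomm_ring) hdd + hds + hss
  have uds : IsUnit (d + s) := isUnit_of_inv ds2 ds2
  have stepA : sL τ ε (d + s) = -2 * τ (w * l) := by
    set a := star (d + s) * (d + s) with ha
    have hstars : star s = g * d := by
      rw [hs, star_mul, hgs, he, star_star]
    have ha' : a = e * d + g * g * (d * e) := by
      rw [ha, star_add, hstars, ← he, hs]
      linear_combination (norm := noncomm_ring) g * hdd + hee * g + g * d * hge + g * hgd * e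
    have apos : PosInv a := ⟨d + s, uds, rfl⟩
    have gpos : PosInv g := by
      obtain ⟨S, hS, hSe⟩ := hΔpos
      refine ⟨S * g, hS.mul ⟨u⁻¹, rfl⟩, ?_⟩
      rw [star_mul, hgs, show g * star S * (S * g) = g * (star S * S) * g by noncomm_ring, ← hSe,
        hgΔ, one_mul]
    have xx : e * d * (e * d) * g = e * d := by
      linear_combination (norm := noncomm_ring) e * d * hΔg' - e * hdd * e * g
    have yy : g * (d * e) * (d * e) = d * e := by
      linear_combination (norm := noncomm_ring) hgΔ' * d * e - g * e * hdd * e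
    have hQ : cfc Real.log a * (e * d * g) = (e * d * g) * l := by
      apply log_intertwine apos hΔpos
      rw [ha']
      linear_combination (norm := noncomm_ring) xx - e * d * hgΔ + g * g * d * hee * d * g
    have hP : cfc Real.log a * (d * e * g) = (d * e * g) * (-l) := by
      have hll : -l = cfc Real.log g := (log_inv' hΔpos hΔg hgΔ).symm
      rw [hll]
      apply log_intertwine apos gpos
      rw [ha']
      linear_combination (norm := noncomm_ring) e * hdd * e * g + g * yy * g
        - hgd * e * g - d * hge * g
    have hPQ : e * d * g + d * e * g = 1 := by
      linear_combination (norm := noncomm_ring) hΔg'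
    have hla : cfc Real.log a = (e * d * g) * l - (d * e * g) * l := by
      linear_combination (norm := noncomm_ring) hQ + hP - cfc Real.log a * hPQ
    have tr : ∀ v v' : A, v * d = -(d * v') →
        τ (v * ((d * e * g) * l)) = - τ (v' * ((e * d * g) * l)) := by
      intro v v' hv
      have e1 : v * ((d * e * g) * l) = -(d * (v' * (e * g * l))) := by
        linear_combination (norm := noncomm_ring) hv * e * g * l
      have e2 : v' * (e * g * l) * d = v' * ((e * d * g) * l) := by
        linear_combination (norm := noncomm_ring) v' * e * g * hld - v' * e * hgd * l
      rw [e1, map_neg, hτ, e2]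
    have t1 := tr w (w + ε) hwd
    have t2 := tr ε ε (by rw [hdε, neg_neg])
    have t3 : τ (w * l) = τ (w * ((e * d * g) * l)) + τ (w * ((d * e * g) * l)) := by
      rw [← map_add]
      congr 1
      linear_combination (norm := noncomm_ring) -w * hPQ * l
    rw [add_mul, map_add] at t1
    rw [sL, ← ha, hla, mul_sub, map_sub]
    linarith
  -- step C
  have hFF : F * F = 0 := by
    linear_combination (norm := noncomm_ring) -F * hpF + hFp * F
  have hFsF : F * s * F = 0 := by
    linear_combination (norm := noncomm_ring) -F * s * hpF + hFp * s * F - F * hsp * F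
  set D := κ * d + F with hD
  have hDD : D * D = 0 := by
    rw [hD]
    linear_combination (norm := noncomm_ring) -κ * hκd * d + κ * κ * hdd + hκd * F + d * hκF
      + hFκ * d + hdF + hFF
  have hDε : D * ε = -(ε * D) := by
    rw [hD]
    linear_combination (norm := noncomm_ring) κ * hdε - hκε * d + hFε
  set b := s * F * s with hb
  have c1 : D * (κ * s + b) + (κ * s + b) * D = 1 := by
    rw [hD, hb]
    linear_combination (norm := noncomm_ring) -κ * hκd * s + hκ * d * s + hκd * s * F * s
      + d * hsκ * F * s + d * s * hκF * s + hFκ * s + hFsF * s - κ * hsκ * d + hκ * s * d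
      + hsκ * F + s * hκF - s * F * hsκ * d + s * hFκ * s * d + s * hFsF + hds + hds * F * s
      - s * hdF * s - s * F * hds
  have c2 : (κ * s + b) * (κ * s + b) = 0 := by
    rw [hb]
    linear_combination (norm := noncomm_ring) -κ * hsκ * s + κ * κ * hss + κ * hss * F * s
      - s * F * hsκ * s + s * F * κ * hss + s * F * hss * F * s
  have c3 : (κ * s + b) * ε = -(ε * (κ * s + b)) := by
    rw [hb]
    linear_combination (norm := noncomm_ring) κ * hsε - hκε * s + s * F * hsε - s * hFε * s
      + hsε * F * s
  have hcon := sL_contraction τ hτ hε hDD hDε hσ hσσ hσε c1 c2 c3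
  rw [hW] at hcon
  set N := (d + s) * (κ * (F + b)) with hN
  have hfac : D + (κ * s + b) = (κ * (d + s)) * (1 + N) := by
    rw [hN, hD]
    linear_combination (norm := noncomm_ring) -κ * ds2 * κ * (F + b) - hκ * (F + b)
  have pds : (d + s) * ε = (-1:ℝ) • (ε * (d + s)) := by
    rw [neg_one_smul]
    linear_combination (norm := noncomm_ring) hdε + hsε
  have pds' : (κ * (d + s)) * ε = (-1:ℝ) • (ε * (κ * (d + s))) := by
    rw [neg_one_smul]
    linear_combination (norm := noncomm_ring) κ * (hdε + hsε) - hκε * (d + s)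
  have hNε : N * ε = ε * N := by
    rw [hN, hb]
    linear_combination (norm := noncomm_ring) (d + s) * κ * (hFε + s * F * hsε - s * hFε * s
      + hsε * F * s) - (d + s) * hκε * (F + s * F * s) - (hdε + hsε) * κ * (F + s * F * s)
  have hpN : p * N = N := by
    rw [hN, hb]
    linear_combination (norm := noncomm_ring) (hpd + hsp) * κ * (F + s * F * s)
      - (d + s) * hκp * (F + s * F * s) + (d + s) * κ * (hpF + hsp * F * s + s * hpF * s)
  have hNp : N * p = 0 := by
    rw [hN, hb]
    linear_combination (norm := noncomm_ring) (d + s) * κ * (hFp - s * F * hsp + s * hFp * s)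
  have hNN : N * N = 0 := by
    linear_combination (norm := noncomm_ring) -N * hpN + hNp * N
  have uN : IsUnit (1 + N) := isUnit_of_inv (y := 1 - N)
    (by linear_combination (norm := noncomm_ring) -hNN)
    (by linear_combination (norm := noncomm_ring) -hNN)
  have uκ : IsUnit κ := isUnit_of_inv hκ hκ
  have hN0 := sL_unip τ hτ hε hp hpε hNε hpN hNp
  have e1 := sL_mul τ hτ (θ := 1) hε (by norm_num) (by norm_num) (uκ.mul uds) uN pds'
    (by rw [one_smul, add_mul, mul_add, hNε, one_mul, mul_one])
  rw [← hfac, ← hcon, hN0] at e1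
  have e2 : sL τ ε (κ * (d + s)) = sL τ ε (d + s) := by
    rw [sL, sL, star_mul, hκs]
    congr 3
    linear_combination (norm := noncomm_ring) star (d + s) * hκ * (d + s)
  rw [e2, stepA] at e1
  linarith

end AbstractMain

section Concrete
open ContinuousLinearMap

theorem rho_apply (γ : Γ) (f : l2 Γ) (x : Γ) : rho γ f x = f (x * γ) := rfl

def rhoHom : Γ →* (l2 Γ →L[ℂ] l2 Γ) where
  toFun := rho
  map_one' := by ext f x; simp [rho_apply]
  map_mul' a b := by ext f x; simp [rho_apply, mul_assoc]

theorem Rop_eq (a : MonoidAlgebra ℤ Γ) :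
    Rop a = MonoidAlgebra.lift ℤ (l2 Γ →L[ℂ] l2 Γ) Γ rhoHom a := by
  rw [MonoidAlgebra.lift_apply, Rop]
  congr 1
  funext γ k
  exact Int.cast_smul_eq_zsmul ℂ k (rho γ)

theorem Rop_single (γ : Γ) (k : ℤ) : Rop (MonoidAlgebra.single γ k) = (k : ℂ) • rho γ := by
  rw [Rop_eq, MonoidAlgebra.lift_single]
  exact (Int.cast_smul_eq_zsmul ℂ k (rho γ)).symm

theorem Rop_add (a b : MonoidAlgebra ℤ Γ) : Rop (a + b) = Rop a + Rop b := by
  simp only [Rop_eq, map_add]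

theorem Rop_zero : Rop (0 : MonoidAlgebra ℤ Γ) = 0 := by
  simp only [Rop_eq, map_zero]

theorem Rop_one : Rop (1 : MonoidAlgebra ℤ Γ) = 1 := by
  simp only [Rop_eq, map_one]

theorem Rop_mul (a b : MonoidAlgebra ℤ Γ) : Rop (a * b) = Rop a * Rop b := by
  simp only [Rop_eq, map_mul]

theorem Rop_neg (a : MonoidAlgebra ℤ Γ) : Rop (-a) = -Rop a := by
  simp only [Rop_eq, map_neg]

theorem Rop_sum {ι : Type} (s : Finset ι) (a : ι → MonoidAlgebra ℤ Γ) :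
    Rop (∑ i ∈ s, a i) = ∑ i ∈ s, Rop (a i) := by
  simp only [Rop_eq, map_sum]

variable {ι κ μ : Type} [Fintype ι] [Fintype κ] [Fintype μ]

theorem RA_apply (A : Matrix ι κ (MonoidAlgebra ℤ Γ)) (v : Hn Γ κ) (i : ι) :
    RA A v i = ∑ j, Rop (A i j) (v j) := by
  classical
  simp only [RA, ContinuousLinearMap.sum_apply, ContinuousLinearMap.comp_apply]
  rw [WithLp.ofLp_sum, Finset.sum_apply]
  have : ∀ i' : ι, ∀ x : l2 Γ, (@inclL Γ _ ι _ (Classical.decEq ι) i' x) i = if i = i' then x else 0 := by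
    intro i' x
    simp [inclL, Pi.single_apply]
  simp only [WithLp.ofLp_sum, Finset.sum_apply, this]
  rw [Finset.sum_eq_single i]
  · simp; rfl
  · intro b _ hb
    simp [Ne.symm hb]
  · simp

theorem RA_ext {T S : Hn Γ κ →L[ℂ] Hn Γ ι} (h : ∀ v i, T v i = S v i) : T = S := by
  ext v i x
  rw [h]

theorem RA_add (A B : Matrix ι κ (MonoidAlgebra ℤ Γ)) : RA (A + B) = RA A + RA B := by
  apply RA_ext; intro v i
  simp [RA_apply, Rop_add, Finset.sum_add_distrib]

theorem RA_neg (A : Matrix ι κ (MonoidAlgebra ℤ Γ)) : RA (-A) = -RA A := by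
  apply RA_ext; intro v i
  simp [RA_apply, Rop_neg]

theorem RA_sub (A B : Matrix ι κ (MonoidAlgebra ℤ Γ)) : RA (A - B) = RA A - RA B := by
  rw [sub_eq_add_neg, RA_add, RA_neg, sub_eq_add_neg]

theorem RA_zero : RA (0 : Matrix ι κ (MonoidAlgebra ℤ Γ)) = 0 := by
  apply RA_ext; intro v i
  simp [RA_apply, Rop_zero]

theorem RA_one [DecidableEq ι] : RA (1 : Matrix ι ι (MonoidAlgebra ℤ Γ)) = 1 := by
  apply RA_ext; intro v i
  rw [RA_apply, Finset.sum_eq_single i]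
  · simp [Rop_one]
  · intro b _ hb; simp [Matrix.one_apply_ne hb.symm, Rop_zero]
  · simp

theorem RA_comp (A : Matrix ι κ (MonoidAlgebra ℤ Γ)) (B : Matrix κ μ (MonoidAlgebra ℤ Γ)) :
    RA (A * B) = (RA A).comp (RA B) := by
  apply RA_ext; intro v i
  simp only [RA_apply, ContinuousLinearMap.comp_apply, Matrix.mul_apply, Rop_sum, Rop_mul, map_sum,
    ContinuousLinearMap.sum_apply, ContinuousLinearMap.mul_apply]
  rw [Finset.sum_comm]

theorem RA_mul (A B : Matrix ι ι (MonoidAlgebra ℤ Γ)) : RA (A * B) = RA A * RA B := RA_comp A B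

theorem RA_pow [DecidableEq ι] (A : Matrix ι ι (MonoidAlgebra ℤ Γ)) (k : ℕ) :
    RA (A ^ k) = RA A ^ k := by
  induction k with
  | zero => simp [RA_one]
  | succ k ih => rw [pow_succ, pow_succ, RA_mul, ih]

/-- the involution on the group ring -/
def gstar (a : MonoidAlgebra ℤ Γ) : MonoidAlgebra ℤ Γ :=
  MonoidAlgebra.ofCoeff (a.coeff.equivMapDomain (Equiv.inv Γ))

theorem gstar_coeff (a : MonoidAlgebra ℤ Γ) (γ : Γ) : (gstar a).coeff γ = a.coeff γ⁻¹ := by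
  simp [gstar]

theorem gstar_add (a b : MonoidAlgebra ℤ Γ) : gstar (a + b) = gstar a + gstar b := by
  apply MonoidAlgebra.coeff_injective; ext γ
  simp [gstar_coeff]

theorem gstar_zero : gstar (0 : MonoidAlgebra ℤ Γ) = 0 := by
  apply MonoidAlgebra.coeff_injective; ext γ
  simp [gstar_coeff]

theorem gstar_single (γ : Γ) (k : ℤ) :
    gstar (MonoidAlgebra.single γ k) = MonoidAlgebra.single γ⁻¹ k := by
  apply MonoidAlgebra.coeff_injective; ext x
  classical
  simp [gstar_coeff, Finsupp.single_apply, inv_eq_iff_eq_inv]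

theorem gstar_gstar (a : MonoidAlgebra ℤ Γ) : gstar (gstar a) = a := by
  apply MonoidAlgebra.coeff_injective; ext γ
  simp [gstar_coeff]

theorem adjoint_rho (γ : Γ) : adjoint (rho γ) = rho γ⁻¹ := by
  symm
  rw [ContinuousLinearMap.eq_adjoint_iff]
  intro f g
  rw [lp.inner_eq_tsum, lp.inner_eq_tsum]
  simp only [rho_apply]
  rw [← (Equiv.mulRight γ).tsum_eq]
  simp

theorem adjoint_Rop (a : MonoidAlgebra ℤ Γ) : adjoint (Rop a) = Rop (gstar a) := by
  induction a using MonoidAlgebra.induction_linear with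
  | zero => simp [gstar_zero, Rop_zero]
  | add f g hf hg => simp only [gstar_add, Rop_add, map_add, hf, hg]
  | single γ k =>
    rw [gstar_single, Rop_single, Rop_single, ← adjoint_rho]
    rw [map_smulₛₗ]
    simp

def adjM (A : Matrix ι κ (MonoidAlgebra ℤ Γ)) : Matrix κ ι (MonoidAlgebra ℤ Γ) :=
  fun i j => gstar (A j i)

theorem adjoint_RA (A : Matrix ι κ (MonoidAlgebra ℤ Γ)) : adjoint (RA A) = RA (adjM A) := by
  symm
  rw [ContinuousLinearMap.eq_adjoint_iff]
  intro f g
  rw [PiLp.inner_apply, PiLp.inner_apply]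
  simp only [RA_apply, adjM, sum_inner, inner_sum, ← adjoint_Rop, adjoint_inner_left]
  rw [Finset.sum_comm]

theorem star_RA (A : Matrix ι ι (MonoidAlgebra ℤ Γ)) : star (RA A) = RA (adjM A) := adjoint_RA A

/-- basis vectors -/
def dlt (x : Γ) (i : ι) : Hn Γ ι :=
  letI := Classical.decEq ι
  letI := Classical.decEq Γ
  (PiLp.continuousLinearEquiv 2 ℂ (fun _ : ι => l2 Γ)).symm
    (Pi.single i (lp.single 2 x 1))

theorem deltaE_eq (i : ι) : deltaE Γ i = dlt 1 i := rfl

theorem dlt_apply [DecidableEq ι] [DecidableEq Γ] (x : Γ) (i : ι) (y : Γ) (j : ι) :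
    (dlt x i : Hn Γ ι) j y = if j = i ∧ y = x then 1 else 0 := by
  simp only [dlt]
  by_cases h : j = i
  · subst h
    simp [lp.single_apply, Pi.single_apply]
  · simp [h, Pi.single_apply]

theorem inner_dlt (x : Γ) (i : ι) (v : Hn Γ ι) : inner ℂ (dlt x i) v = v i x := by
  classical
  rw [PiLp.inner_apply, Finset.sum_eq_single i]
  · rw [lp.inner_eq_tsum, tsum_eq_single x]
    · simp [dlt_apply]
    · intro b hb; simp [dlt_apply, hb]
  · intro b _ hb
    rw [lp.inner_eq_tsum]
    simp [dlt_apply, hb]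
  · simp

theorem Rop_apply_apply (a : MonoidAlgebra ℤ Γ) (f : l2 Γ) (x : Γ) :
    Rop a f x = a.coeff.sum fun γ k => (k : ℂ) * f (x * γ) := by
  induction a using MonoidAlgebra.induction_linear with
  | zero => simp [Rop_zero]
  | add p q hp hq =>
    rw [Rop_add, MonoidAlgebra.coeff_add, Finsupp.sum_add_index', ← hp, ← hq]
    · simp
    · simp
    · intros; push_cast; ring
  | single γ k => rw [Rop_single]; simp [rho_apply]

theorem RA_dlt (A : Matrix ι κ (MonoidAlgebra ℤ Γ)) (y : Γ) (j : κ) (x : Γ) (i : ι) :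
    RA A (dlt y j) i x = ((A i j).coeff (x⁻¹ * y) : ℂ) := by
  classical
  rw [RA_apply, Finset.sum_eq_single j]
  · rw [Rop_apply_apply, Finsupp.sum, Finset.sum_eq_single (x⁻¹ * y)]
    · simp [dlt_apply]
    · intro b _ hb
      have : x * b ≠ y := fun h => hb (by rw [← h]; group)
      simp [dlt_apply, this]
    · intro h
      simp [Finsupp.notMem_support_iff.1 h]
  · intro b _ hb
    have : (dlt y j : Hn Γ κ) b = 0 := by ext z; simp [dlt_apply, hb]
    rw [this, map_zero]
  · simp

theorem RA_inj {A B : Matrix ι κ (MonoidAlgebra ℤ Γ)} (h : RA A = RA B) : A = B := by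
  refine Matrix.ext fun i j => ?_
  apply MonoidAlgebra.coeff_injective
  ext γ
  have := RA_dlt A γ j 1 i
  rw [h, RA_dlt] at this
  simpa using this.symm

theorem adjM_adjM (A : Matrix ι κ (MonoidAlgebra ℤ Γ)) : adjM (adjM A) = A := by
  funext i j
  simp [adjM, gstar_gstar]

theorem adjM_mul (A B : Matrix ι ι (MonoidAlgebra ℤ Γ)) : adjM (A * B) = adjM B * adjM A := by
  apply RA_inj
  rw [← star_RA, RA_mul, star_mul, RA_mul, star_RA, star_RA]

theorem adjM_one [DecidableEq ι] : adjM (1 : Matrix ι ι (MonoidAlgebra ℤ Γ)) = 1 := by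
  apply RA_inj
  rw [← star_RA, RA_one, star_one]

/-! left translations -/
theorem ltranslate_memℓp (γ : Γ) (f : l2 Γ) :
    Memℓp (fun x : Γ => f (γ * x)) (2 : ℝ≥0∞) := by
  have h2 : (0:ℝ) < (2 : ℝ≥0∞).toReal := by norm_num
  apply memℓp_gen
  have hs : Summable fun i : Γ => ‖f i‖ ^ (2 : ℝ≥0∞).toReal := (lp.memℓp f).summable h2
  exact ((Equiv.mulLeft γ).summable_iff (f := fun i : Γ => ‖f i‖ ^ (2 : ℝ≥0∞).toReal)).2 hs

def lamL (γ : Γ) : l2 Γ →ₗᵢ[ℂ] l2 Γ where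
  toFun f := ⟨fun x => f (γ * x), ltranslate_memℓp γ f⟩
  map_add' f g := by ext x; simp; rfl
  map_smul' c f := by ext x; simp [lp.coeFn_smul]
  norm_map' f := by
    have : ∀ g : l2 Γ, ‖g‖ ^ 2 = ∑' x, ‖g x‖ ^ 2 := by
      intro g
      have := lp.norm_rpow_eq_tsum (p := 2) (by norm_num) g
      simpa using this
    rw [← sq_eq_sq₀ (norm_nonneg _) (norm_nonneg _), this, this]
    exact (Equiv.mulLeft γ).tsum_eq fun x => ‖f x‖ ^ 2

def lam (ι : Type) [Fintype ι] (γ : Γ) : Hn Γ ι →L[ℂ] Hn Γ ι :=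
  (((PiLp.continuousLinearEquiv 2 ℂ (fun _ : ι => l2 Γ)).symm.toContinuousLinearMap).comp
    (ContinuousLinearMap.piMap fun _ : ι => (lamL γ).toContinuousLinearMap)).comp
    (PiLp.continuousLinearEquiv 2 ℂ (fun _ : ι => l2 Γ)).toContinuousLinearMap

theorem lam_apply (γ : Γ) (v : Hn Γ ι) (i : ι) (x : Γ) : lam ι γ v i x = v i (γ * x) := rfl

theorem lam_dlt (γ x : Γ) (i : ι) : lam ι γ (dlt x i) = dlt (γ⁻¹ * x) i := by
  classical
  ext j y
  rw [lam_apply, dlt_apply, dlt_apply]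
  simp only [eq_inv_mul_iff_mul_eq]

variable (Γ ι) in
/-- the group von Neumann algebra (matrices) -/
def VN : StarSubalgebra ℂ (Hn Γ ι →L[ℂ] Hn Γ ι) :=
  StarSubalgebra.centralizer ℂ (Set.range (lam ι : Γ → _))

theorem RA_lam (A : Matrix ι ι (MonoidAlgebra ℤ Γ)) (γ : Γ) : lam ι γ * RA A = RA A * lam ι γ := by
  ext v i x
  simp only [ContinuousLinearMap.mul_apply, lam_apply, RA_apply, lp.coeFn_sum, Finset.sum_apply,
    Rop_apply_apply, mul_assoc]

theorem RA_mem (A : Matrix ι ι (MonoidAlgebra ℤ Γ)) : RA A ∈ VN Γ ι := by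
  rw [VN, StarSubalgebra.mem_centralizer_iff]
  rintro _ ⟨γ, rfl⟩
  refine ⟨RA_lam A γ, ?_⟩
  have := congrArg star (RA_lam (adjM A) γ)
  rw [star_mul, star_mul, star_RA, adjM_adjM] at this
  exact this.symm

instance : CStarAlgebra (VN Γ ι) :=
  StarSubalgebra.cstarAlgebra _ (h_closed := by
    rw [VN, StarSubalgebra.coe_centralizer]
    exact Set.isClosed_centralizer _)

theorem vn_shift {T : Hn Γ ι →L[ℂ] Hn Γ ι} (hT : T ∈ VN Γ ι) (x y : Γ) (i j : ι) :
    T (dlt y j) i x = T (dlt 1 j) i (y⁻¹ * x) := by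
  rw [VN, StarSubalgebra.mem_centralizer_iff] at hT
  have h := (hT _ ⟨y⁻¹, rfl⟩).1
  have h2 := congrArg (fun S : Hn Γ ι →L[ℂ] Hn Γ ι => S (dlt 1 j) i x) h
  simp only [ContinuousLinearMap.mul_apply, lam_apply, lam_dlt] at h2
  rw [h2]
  simp

theorem vnTrace_mul_comm {S T : Hn Γ ι →L[ℂ] Hn Γ ι} (hS : S ∈ VN Γ ι) (hT : T ∈ VN Γ ι) :
    vnTrace (S * T) = vnTrace (T * S) := by
  have key : ∀ {S T : Hn Γ ι →L[ℂ] Hn Γ ι}, S ∈ VN Γ ι →  vnTrace (S * T) =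
      ∑ i, ∑ j, ∑' x : Γ, (starRingEnd ℂ) (T (dlt 1 i) j x * S (dlt 1 j) i x⁻¹) := by
    intro S T hS
    rw [vnTrace]
    congr 1; funext i
    rw [deltaE_eq, ContinuousLinearMap.mul_apply, ← adjoint_inner_right, PiLp.inner_apply]
    congr 1; funext j
    rw [lp.inner_eq_tsum]
    congr 1; funext x
    rw [← inner_dlt x j (adjoint S _), adjoint_inner_right,
      ← inner_conj_symm (S (dlt x j)) (dlt 1 i), inner_dlt, vn_shift hS]
    simp only [mul_one, map_mul]
    simp only [RCLike.inner_apply]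
    ring
  rw [key hS, key hT, Finset.sum_comm]
  congr 1; funext i
  congr 1; funext j
  rw [← (Equiv.inv Γ).tsum_eq]
  congr 1; funext x
  simp [mul_comm]

variable (Γ ι) in
/-- real part of the trace, as a continuous functional -/
def trRe : (Hn Γ ι →L[ℂ] Hn Γ ι) →L[ℝ] ℝ :=
  LinearMap.mkContinuousOfExistsBound
    { toFun := fun T => (vnTrace T).re
      map_add' := by intro S T; simp [vnTrace, inner_add_left, Finset.sum_add_distrib]
      map_smul' := by
        intro c T
        have : c • T = (c : ℂ) • T := (Complex.coe_smul c T).symm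
        rw [this]
        simp [vnTrace, inner_smul_left, Finset.mul_sum] }
    ⟨∑ i : ι, ‖deltaE Γ i‖ * ‖deltaE Γ i‖, by
      intro T
      simp only [LinearMap.coe_mk, AddHom.coe_mk]
      refine (Complex.abs_re_le_norm _).trans ?_
      refine (norm_sum_le _ _).trans ?_
      rw [Finset.sum_mul]
      refine Finset.sum_le_sum fun i _ => ?_
      refine (norm_inner_le_norm _ _).trans ?_
      have := T.le_opNorm (deltaE Γ i)
      nlinarith [norm_nonneg (deltaE Γ i)]⟩

theorem trRe_apply (T : Hn Γ ι →L[ℂ] Hn Γ ι) : trRe Γ ι T = (vnTrace T).re := rfl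

variable (Γ ι) in
def trV : VN Γ ι →L[ℝ] ℝ :=
  (trRe Γ ι).comp ((VN Γ ι).toSubmodule.subtypeL.restrictScalars ℝ)

theorem trV_apply (T : VN Γ ι) : trV Γ ι T = (vnTrace (T : Hn Γ ι →L[ℂ] Hn Γ ι)).re := rfl

theorem trV_comm (S T : VN Γ ι) : trV Γ ι (S * T) = trV Γ ι (T * S) := by
  rw [trV_apply, trV_apply]
  congr 1
  exact vnTrace_mul_comm S.2 T.2

theorem vn_cfc {a : VN Γ ι} (ha : PosInv a) :
    ((cfc Real.log a : VN Γ ι) : Hn Γ ι →L[ℂ] Hn Γ ι) = cfc Real.log (a : Hn Γ ι →L[ℂ] Hn Γ ι) := by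
  have := StarAlgHomClass.map_cfc (R := ℝ) (S := ℂ) (VN Γ ι).subtype Real.log a ha.cont
    (by exact continuous_subtype_val) ha.sa (by exact ha.sa.map (VN Γ ι).subtype)
  exact this

variable (ι) in
/-- integral elements of VN -/
def RV (A : Matrix ι ι (MonoidAlgebra ℤ Γ)) : VN Γ ι := ⟨RA A, RA_mem A⟩

theorem vnTrace_RA (A : Matrix ι ι (MonoidAlgebra ℤ Γ)) :
    vnTrace (RA A) = ∑ i, ((A i i).coeff 1 : ℂ) := by
  rw [vnTrace]
  congr 1; funext i
  rw [deltaE_eq, ← inner_conj_symm, inner_dlt, RA_dlt]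
  simp

end Concrete

section FinMat
open Polynomial

/-- polynomial approximating the logarithm from above -/
def Qpoly (c : ℝ) (n : ℕ) : ℝ[X] :=
  C (Real.log c) - ∑ k ∈ Finset.range n, C ((k : ℝ) + 1)⁻¹ * (1 - C c⁻¹ * X) ^ (k + 1)

theorem Qpoly_natDegree (c : ℝ) (n : ℕ) : (Qpoly c n).natDegree ≤ n := by
  unfold Qpoly
  refine (natDegree_sub_le _ _).trans (max_le (by simp) ?_)
  apply natDegree_sum_le_of_forall_le
  intro k hk
  have hk := Finset.mem_range.1 hk
  refine (natDegree_C_mul_le _ _).trans (natDegree_pow_le.trans ?_)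
  have : (1 - C c⁻¹ * X : ℝ[X]).natDegree ≤ 1 := by
    refine (natDegree_sub_le _ _).trans (max_le (by simp) ?_)
    exact (natDegree_C_mul_le _ _).trans natDegree_X_le
  nlinarith

theorem Qpoly_aeval {R : Type*} [Ring R] [Algebra ℝ R] (c : ℝ) (n : ℕ) (a : R) :
    aeval a (Qpoly c n) = Real.log c • (1 : R) -
      ∑ k ∈ Finset.range n, ((k : ℝ) + 1)⁻¹ • (1 - c⁻¹ • a) ^ (k + 1) := by
  simp [Qpoly, Algebra.algebraMap_eq_smul_one, -map_inv₀, -map_add]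

theorem log_le_Qpoly {c x : ℝ} (hx : 0 < x) (hxc : x ≤ c) (n : ℕ) :
    Real.log x ≤ (Qpoly c n).eval x := by
  have hc : 0 < c := hx.trans_le hxc
  have h1 : 0 < c⁻¹ * x := by positivity
  have h2 : c⁻¹ * x ≤ 1 := by rw [inv_mul_le_iff₀ hc]; simpa using hxc
  have h3 := Real.hasSum_pow_div_log_of_abs_lt_one (x := 1 - c⁻¹ * x)
    (by rw [abs_lt]; constructor <;> linarith)
  have h4 := sum_le_hasSum (Finset.range n) (fun k _ => by
    have : 0 ≤ 1 - c⁻¹ * x := by linarith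
    positivity) h3
  have h5 : Real.log (1 - (1 - c⁻¹ * x)) = Real.log x - Real.log c := by
    rw [sub_sub_cancel, Real.log_mul (by positivity) (by positivity), Real.log_inv]; ring
  rw [h5] at h4
  simp only [Qpoly, eval_sub, eval_C, eval_finsetSum, eval_mul, eval_pow, eval_one, eval_X]
  have h6 : ∑ k ∈ Finset.range n, ((k : ℝ) + 1)⁻¹ * (1 - c⁻¹ * x) ^ (k + 1)
      = ∑ k ∈ Finset.range n, (1 - c⁻¹ * x) ^ (k + 1) / ((k : ℝ) + 1) := by
    apply Finset.sum_congr rfl; intros; rw [div_eq_inv_mul]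
  rw [h6]
  linarith

variable {W : Type} [Fintype W] [DecidableEq W]

theorem aeval_diagonal (q : ℝ[X]) (v : W → ℝ) :
    aeval (Matrix.diagonal v) q = Matrix.diagonal fun i => q.eval (v i) := by
  have := Polynomial.aeval_algHom_apply (Matrix.diagonalAlgHom (n := W) (α := ℝ) ℝ) v q
  rw [Matrix.diagonalAlgHom_apply] at this
  rw [this, Matrix.diagonalAlgHom_apply]
  congr 1
  funext i
  have h2 := Polynomial.aeval_algHom_apply (Pi.evalAlgHom ℝ (fun _ : W => ℝ) i) v q
  simp only [Pi.evalAlgHom_apply] at h2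
  rw [← h2, Polynomial.coe_aeval_eq_eval]

theorem herm_aeval {M : Matrix W W ℝ} (hM : M.IsHermitian) (q : ℝ[X]) :
    aeval M q = (hM.eigenvectorUnitary : Matrix W W ℝ) *
      Matrix.diagonal (fun i => q.eval (hM.eigenvalues i)) *
        star (hM.eigenvectorUnitary : Matrix W W ℝ) := by
  have h := hM.spectral_theorem
  have h2 := Polynomial.aeval_algHom_apply
    (Unitary.conjStarAlgAut ℝ _ hM.eigenvectorUnitary : Matrix W W ℝ →ₐ[ℝ] Matrix W W ℝ)
    (Matrix.diagonal (hM.eigenvalues)) q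
  rw [aeval_diagonal] at h2
  have h3 : M = (Unitary.conjStarAlgAut ℝ _ hM.eigenvectorUnitary : Matrix W W ℝ →ₐ[ℝ] Matrix W W ℝ)
    (Matrix.diagonal (hM.eigenvalues)) := h
  rw [← h3] at h2
  rw [h2]
  exact Unitary.conjStarAlgAut_apply (S := ℝ) _ _

theorem herm_aeval_trace {M : Matrix W W ℝ} (hM : M.IsHermitian) (q : ℝ[X]) :
    ∑ w, (aeval M q) w w = ∑ i, q.eval (hM.eigenvalues i) := by
  have : ∑ w, (aeval M q) w w = (aeval M q).trace := rfl
  rw [this, herm_aeval hM, Matrix.trace_mul_comm, ← Matrix.mul_assoc]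
  simp [Matrix.trace]

theorem herm_aeval_psd {M : Matrix W W ℝ} (hM : M.IsHermitian) (q : ℝ[X])
    (h : ∀ i, 0 ≤ q.eval (hM.eigenvalues i)) (w : W) : 0 ≤ (aeval M q) w w := by
  have : (Matrix.diagonal (fun i => q.eval (hM.eigenvalues i))).PosSemidef :=
    Matrix.PosSemidef.diagonal h
  have := (this.mul_mul_conjTranspose_same (hM.eigenvectorUnitary : Matrix W W ℝ)).diag_nonneg (i := w)
  rwa [herm_aeval hM]

theorem eig_le {M : Matrix W W ℝ} (hM : M.IsHermitian) {c : ℝ} (hrow : ∀ w, ∑ w', |M w w'| ≤ c)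
    (i : W) : hM.eigenvalues i ≤ c := by
  have hev : Module.End.HasEigenvalue (Matrix.toLin' M) (hM.eigenvalues i) := by
    apply Module.End.hasEigenvalue_of_hasEigenvector (x := (hM.eigenvectorBasis i).ofLp)
    refine ⟨?_, ?_⟩
    · rw [Module.End.mem_eigenspace_iff, Matrix.toLin'_apply]
      exact hM.mulVec_eigenvectorBasis i
    · intro h
      apply hM.eigenvectorBasis.orthonormal.ne_zero i
      ext j
      exact congrFun h j
  obtain ⟨k, hk⟩ := eigenvalue_mem_ball hev
  rw [Metric.mem_closedBall, Real.dist_eq] at hk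
  have h1 := hrow k
  rw [← Finset.add_sum_erase _ _ (Finset.mem_univ k)] at h1
  have h2 := le_abs_self (M k k)
  have h3 := le_abs_self (hM.eigenvalues i - M k k)
  simp only [Real.norm_eq_abs] at hk
  linarith

theorem fin_trace_nonneg (M : Matrix W W ℤ) (hpd : (M.map (Int.cast : ℤ → ℝ)).PosDef) {c : ℝ}
    (hrow : ∀ w, ∑ w', |(M w w' : ℝ)| ≤ c) (n : ℕ) :
    0 ≤ ∑ w, (aeval (M.map (Int.cast : ℤ → ℝ)) (Qpoly c n)) w w := by
  rw [herm_aeval_trace hpd.1]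
  have hdet : 0 < (M.map (Int.cast : ℤ → ℝ)).det := hpd.det_pos
  have h1 : (M.map (Int.cast : ℤ → ℝ)).det = (M.det : ℝ) :=
    (Int.cast_det M).symm
  have h2 : 1 ≤ (M.map (Int.cast : ℤ → ℝ)).det := by
    rw [h1] at hdet ⊢
    have : 0 < M.det := by exact_mod_cast hdet
    exact_mod_cast this
  have h3 := hpd.1.det_eq_prod_eigenvalues
  have h4 : 0 ≤ Real.log (M.map (Int.cast : ℤ → ℝ)).det := Real.log_nonneg h2
  rw [h3] at h4
  have h5 := Real.log_prod (s := Finset.univ) (f := fun i => hpd.1.eigenvalues i)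
    (fun i _ => (hpd.eigenvalues_pos i).ne')
  simp only [RCLike.ofReal_real_eq_id, id] at h4
  rw [h5] at h4
  refine h4.trans (Finset.sum_le_sum fun i _ => ?_)
  exact log_le_Qpoly (hpd.eigenvalues_pos i) (eig_le hpd.1 hrow i) n

theorem fin_diag_le (M : Matrix W W ℤ) (hpd : (M.map (Int.cast : ℤ → ℝ)).PosDef) {c : ℝ}
    (hrow : ∀ w, ∑ w', |(M w w' : ℝ)| ≤ c) (n : ℕ) (w : W) :
    (aeval (M.map (Int.cast : ℤ → ℝ)) (Qpoly c n)) w w ≤ Real.log c := by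
  have h := herm_aeval_psd hpd.1 (C (Real.log c) - Qpoly c n) (fun i => by
    have hp := hpd.eigenvalues_pos i
    have hl := eig_le hpd.1 hrow i
    have hc : 0 < c := hp.trans_le hl
    have h2 : c⁻¹ * hpd.1.eigenvalues i ≤ 1 := by rw [inv_mul_le_iff₀ hc]; simpa using hl
    have h3 : 0 ≤ 1 - c⁻¹ * hpd.1.eigenvalues i := by linarith
    simp only [Qpoly, eval_sub, eval_C, eval_finsetSum, eval_mul, eval_pow, eval_one, eval_X,
      sub_sub_cancel]
    apply Finset.sum_nonneg; intros; positivity) w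
  rw [map_sub, Matrix.sub_apply, aeval_C, Algebra.algebraMap_eq_smul_one] at h
  simp at h
  exact h

end FinMat

section Approx
open Polynomial Filter Topology
variable {ι : Type} [Fintype ι] [DecidableEq ι]

/-- finite approximation of `Z` of order `n` with error `δ` -/
def FinApprox (Z : Matrix ι ι (MonoidAlgebra ℤ Γ)) (c : ℝ) (n : ℕ) (δ : ℝ) : Prop :=
  ∃ (V : Type) (_ : Fintype V) (_ : DecidableEq V) (_ : Nonempty V) (good : Finset V)
    (M : Matrix (V × ι) (V × ι) ℤ),
    (M.map (Int.cast : ℤ → ℝ)).PosDef ∧ (∀ w, ∑ w', |(M w w' : ℝ)| ≤ c) ∧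
    ((Fintype.card V : ℝ) - good.card ≤ δ * Fintype.card V) ∧
    ∀ x ∈ good, ∀ i, ∀ k ≤ n, (M ^ k) (x, i) (x, i) = ((Z ^ k) i i).coeff 1

theorem vnTrace_aeval (Z : Matrix ι ι (MonoidAlgebra ℤ Γ)) (q : ℝ[X]) :
    trV Γ ι (aeval (RV ι Z) q) =
      ∑ i, ∑ m ∈ Finset.range (q.natDegree + 1), q.coeff m * (((Z ^ m) i i).coeff 1 : ℝ) := by
  rw [aeval_eq_sum_range, map_sum, Finset.sum_comm]
  refine Finset.sum_congr rfl fun m _ => ?_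
  rw [map_smul, trV_apply, smul_eq_mul, ← Finset.mul_sum]
  congr 1
  have : ((RV ι Z ^ m : VN Γ ι) : Hn Γ ι →L[ℂ] Hn Γ ι) = RA (Z ^ m) := by
    rw [RA_pow]; rfl
  rw [this, vnTrace_RA]
  simp

theorem approx_nonneg (Z : Matrix ι ι (MonoidAlgebra ℤ Γ)) (hZ : PosInv (RV ι Z)) {c : ℝ}
    (hc : 1 ≤ c) (hcn : ‖RV ι Z‖ ≤ c)
    (happ : ∀ n : ℕ, ∀ δ : ℝ, 0 < δ → FinApprox Z c n δ) :
    0 ≤ trV Γ ι (cfc Real.log (RV ι Z)) := by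
  have hlim := hZ.tendsto_plog (by linarith : 0 < c) hcn
  have hlim2 := ((trV Γ ι).continuous.tendsto _).comp hlim
  refine ge_of_tendsto' hlim2 fun n => ?_
  simp only [Function.comp]
  have hQ : plog c (RV ι Z) n = aeval (RV ι Z) (Qpoly c n) := by
    rw [Qpoly_aeval]; rfl
  rw [hQ]
  set t := trV Γ ι (aeval (RV ι Z) (Qpoly c n)) with ht
  by_contra hneg
  push Not at hneg
  have hlog : 0 ≤ Real.log c := Real.log_nonneg hc
  set K := (Fintype.card ι : ℝ) * Real.log c with hK
  have hK0 : 0 ≤ K := by positivity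
  obtain ⟨V, _, _, _, good, M, hpd, hrow, hbad, hgood⟩ := happ n (min (1/2) (-t / (4 * (K + 1))))
    (lt_min (by norm_num) (div_pos (by linarith) (by positivity)))
  set δ := min (1/2) (-t / (4 * (K + 1))) with hδ
  have hδ1 : δ ≤ 1/2 := min_le_left _ _
  have hδ2 : δ * (4 * (K + 1)) ≤ -t := by
    rw [← le_div_iff₀ (by positivity)]; exact min_le_right _ _
  have hδ0 : 0 < δ := lt_min (by norm_num) (div_pos (by linarith) (by positivity))
  have h0 := fin_trace_nonneg M hpd hrow n
  rw [Fintype.sum_prod_type] at h0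
  have hg : ∀ x ∈ good, ∑ i, (aeval (M.map (Int.cast : ℤ → ℝ)) (Qpoly c n)) (x, i) (x, i) = t := by
    intro x hx
    rw [ht, vnTrace_aeval]
    refine Finset.sum_congr rfl fun i _ => ?_
    rw [aeval_eq_sum_range, Matrix.sum_apply]
    refine Finset.sum_congr rfl fun m hm => ?_
    rw [Matrix.smul_apply, smul_eq_mul]
    congr 1
    have hmn : m ≤ n := (Finset.mem_range_succ_iff.1 hm).trans (Qpoly_natDegree c n)
    rw [← hgood x hx i m hmn]
    have : (M.map (Int.cast : ℤ → ℝ)) ^ m = (M ^ m).map (Int.cast : ℤ → ℝ) :=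
      (Matrix.map_pow M (Int.castRingHom ℝ) m).symm
    rw [this]; rfl
  have hb : ∀ x, ∑ i, (aeval (M.map (Int.cast : ℤ → ℝ)) (Qpoly c n)) (x, i) (x, i) ≤ K := by
    intro x
    refine (Finset.sum_le_sum fun i _ => fin_diag_le M hpd hrow n (x, i)).trans ?_
    simp [hK]
  rw [← Finset.sum_add_sum_compl good, Finset.sum_congr rfl hg] at h0
  have h1 := Finset.sum_le_sum fun x (_ : x ∈ goodᶜ) => hb x
  simp only [Finset.sum_const, nsmul_eq_mul, Finset.card_compl] at h0 h1
  rw [Nat.cast_sub (Finset.card_le_univ good)] at h1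
  have hV : (0:ℝ) < Fintype.card V := by exact_mod_cast Fintype.card_pos
  have h2 : (1 - δ) * Fintype.card V ≤ good.card := by linarith
  have h3 : (Fintype.card V : ℝ) / 2 * (-t) ≤ good.card * (-t) := by
    apply mul_le_mul_of_nonneg_right _ (by linarith)
    nlinarith
  have h4 := mul_le_mul_of_nonneg_right hbad hK0
  have h5 : (Fintype.card V : ℝ) * (-t / 2 - δ * K) ≤ 0 := by nlinarith
  have h6 : 0 < -t / 2 - δ * K := by nlinarith
  nlinarith

end Approx

section ResFin
variable {ι : Type} [Fintype ι] [DecidableEq ι]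

theorem rf_finset (h : IsResiduallyFinite Γ) (S : Finset Γ) :
    ∃ (G : Type) (_ : Group G) (_ : Finite G) (φ : Γ →* G), ∀ γ ∈ S, φ γ = 1 → γ = 1 := by
  classical
  induction S using Finset.induction_on with
  | empty => exact ⟨Unit, inferInstance, inferInstance, 1, by simp⟩
  | insert a S _ ih =>
    obtain ⟨G, _, _, φ, hφ⟩ := ih
    by_cases ha : a = 1
    · refine ⟨G, inferInstance, inferInstance, φ, fun γ hγ h1 => ?_⟩
      rcases Finset.mem_insert.1 hγ with rfl | h2
      · exact ha
      · exact hφ γ h2 h1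
    · obtain ⟨G', _, _, φ', hφ'⟩ := h a ha
      refine ⟨G × G', inferInstance, inferInstance, φ.prod φ', fun γ hγ h1 => ?_⟩
      rw [MonoidHom.prod_apply, Prod.mk_eq_one] at h1
      rcases Finset.mem_insert.1 hγ with rfl | h2
      · exact absurd h1.2 hφ'
      · exact hφ γ h2 h1.1

variable {G : Type} [Group G] [Fintype G] [DecidableEq G]

def permHom (φ : Γ →* G) : Γ →* Matrix G G ℤ where
  toFun γ := Matrix.of fun x y => if x * φ γ = y then 1 else 0
  map_one' := by ext x y; simp [Matrix.one_apply]
  map_mul' a b := by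
    ext x y
    rw [Matrix.mul_apply, Finset.sum_eq_single (x * φ a)]
    · simp [mul_assoc]
    · intro b _ hb; simp [Ne.symm hb]
    · simp

def Phi (φ : Γ →* G) : MonoidAlgebra ℤ Γ →ₐ[ℤ] Matrix G G ℤ := MonoidAlgebra.lift ℤ _ Γ (permHom φ)

theorem Phi_apply (φ : Γ →* G) (a : MonoidAlgebra ℤ Γ) (x y : G) :
    Phi φ a x y = ∑ γ ∈ a.coeff.support, if x * φ γ = y then a.coeff γ else 0 := by
  rw [Phi, MonoidAlgebra.lift_apply, Finsupp.sum, Matrix.sum_apply]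
  refine Finset.sum_congr rfl fun γ _ => ?_
  simp [permHom]

theorem Phi_gstar (φ : Γ →* G) (a : MonoidAlgebra ℤ Γ) :
    Phi φ (gstar a) = (Phi φ a).transpose := by
  induction a using MonoidAlgebra.induction_linear with
  | zero => simp [gstar_zero]
  | add f g hf hg => rw [gstar_add, map_add, hf, hg, map_add, Matrix.transpose_add]
  | single γ k =>
    rw [gstar_single]
    ext x y
    have : x * (φ γ)⁻¹ = y ↔ y * φ γ = x := by
      rw [mul_inv_eq_iff_eq_mul, eq_comm]
    simp [Phi, permHom, MonoidAlgebra.lift_single, this]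

def Psi (φ : Γ →* G) (A : Matrix ι ι (MonoidAlgebra ℤ Γ)) : Matrix (G × ι) (G × ι) ℤ :=
  fun p q => Phi φ (A p.2 q.2) p.1 q.1

theorem Psi_mul (φ : Γ →* G) (A B : Matrix ι ι (MonoidAlgebra ℤ Γ)) :
    Psi φ (A * B) = Psi φ A * Psi φ B := by
  ext ⟨x, i⟩ ⟨y, j⟩
  rw [Matrix.mul_apply, Fintype.sum_prod_type, Finset.sum_comm]
  simp only [Psi, Matrix.mul_apply, map_sum, map_mul, Matrix.sum_apply]

theorem Psi_one (φ : Γ →* G) : Psi φ (1 : Matrix ι ι (MonoidAlgebra ℤ Γ)) = 1 := by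
  ext ⟨x, i⟩ ⟨y, j⟩
  by_cases h : i = j
  · subst h
    simp [Psi, Matrix.one_apply]
  · simp [Psi, Matrix.one_apply, h]

theorem Psi_pow (φ : Γ →* G) (A : Matrix ι ι (MonoidAlgebra ℤ Γ)) (k : ℕ) :
    Psi φ (A ^ k) = Psi φ A ^ k := by
  induction k with
  | zero => simp [Psi_one]
  | succ k ih => rw [pow_succ, pow_succ, Psi_mul, ih]

theorem Psi_adjM (φ : Γ →* G) (A : Matrix ι ι (MonoidAlgebra ℤ Γ)) :
    Psi φ (adjM A) = (Psi φ A).transpose := by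
  ext ⟨x, i⟩ ⟨y, j⟩
  simp [Psi, adjM, Phi_gstar]

/-- l1 norm -/
def l1n (a : MonoidAlgebra ℤ Γ) : ℝ := ∑ γ ∈ a.coeff.support, |(a.coeff γ : ℝ)|

theorem finApprox_rf (h : IsResiduallyFinite Γ) {X Y : Matrix ι ι (MonoidAlgebra ℤ Γ)}
    (hYX : Y * X = 1) {c : ℝ} (hc : ∀ i, ∑ j, l1n ((adjM X * X) i j) ≤ c) (n : ℕ)
    (δ : ℝ) (hδ : 0 < δ) : FinApprox (adjM X * X) c n δ := by
  classical
  set Z := adjM X * X with hZ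
  obtain ⟨G, _, _, φ, hφ⟩ := rf_finset h
    ((Finset.range (n+1)).biUnion fun k => Finset.univ.biUnion fun i => ((Z ^ k) i i).coeff.support)
  have := Fintype.ofFinite G
  refine ⟨G, inferInstance, inferInstance, inferInstance, Finset.univ, Psi φ Z, ?_, ?_, ?_, ?_⟩
  · have h1 : (Psi φ Z).map (Int.cast : ℤ → ℝ) =
        Matrix.conjTranspose ((Psi φ X).map (Int.cast : ℤ → ℝ)) * ((Psi φ X).map (Int.cast : ℤ → ℝ)) := by
      rw [hZ, Psi_mul, Psi_adjM]
      have := Matrix.map_mul (L := (Psi φ X).transpose) (M := Psi φ X) (f := Int.castRingHom ℝ)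
      refine this.trans ?_
      congr 1
    rw [h1]
    apply Matrix.PosDef.conjTranspose_mul_self
    have h2 : ((Psi φ Y).map (Int.cast : ℤ → ℝ)) * ((Psi φ X).map (Int.cast : ℤ → ℝ)) = 1 := by
      have := Matrix.map_mul (L := Psi φ Y) (M := Psi φ X) (f := Int.castRingHom ℝ)
      rw [← Psi_mul, hYX, Psi_one] at this
      refine this.symm.trans ?_
      simp
    intro v w hvw
    have h3 := congrArg (((Psi φ Y).map (Int.cast : ℤ → ℝ)).mulVec) hvw
    simpa [Matrix.mulVec_mulVec, h2] using h3
  · rintro ⟨x, i⟩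
    rw [Fintype.sum_prod_type, Finset.sum_comm]
    refine le_trans (Finset.sum_le_sum fun j _ => ?_) (hc i)
    simp only [Psi, Phi_apply]
    have : ∀ y, |((∑ γ ∈ (Z i j).coeff.support, if x * φ γ = y then (Z i j).coeff γ else 0 : ℤ) : ℝ)|
        ≤ ∑ γ ∈ (Z i j).coeff.support, if x * φ γ = y then |((Z i j).coeff γ : ℝ)| else 0 := by
      intro y
      push_cast
      refine (Finset.abs_sum_le_sum_abs _ _).trans (Finset.sum_le_sum fun γ _ => ?_)
      split_ifs <;> simp
    refine (Finset.sum_le_sum fun y _ => this y).trans ?_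
    rw [Finset.sum_comm]
    simp [l1n]
  · simp; positivity
  · intro x _ i k hk
    rw [← Psi_pow]
    simp only [Psi, Phi_apply]
    have : ∀ γ ∈ ((Z ^ k) i i).coeff.support, (if x * φ γ = x then ((Z ^ k) i i).coeff γ else 0)
        = if γ = 1 then ((Z ^ k) i i).coeff γ else 0 := by
      intro γ hγ
      by_cases h1 : γ = 1
      · simp [h1]
      · have : φ γ ≠ 1 := fun h2 => h1 (hφ γ (by
          simp only [Finset.mem_biUnion]
          exact ⟨k, Finset.mem_range_succ_iff.2 hk, i, Finset.mem_univ i, hγ⟩) h2)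
        simp [this, h1]
    rw [Finset.sum_congr rfl this, Finset.sum_ite_eq']
    split_ifs with h1
    · rfl
    · exact (Finsupp.notMem_support_iff.1 h1).symm

end ResFin

section Folner
variable {ι : Type} [Fintype ι] [DecidableEq ι]

open Classical in
def FolnerR (Γ : Type) [Group Γ] : Prop :=
  ∀ (U : Finset Γ) (δ : ℝ), 0 < δ → ∃ F : Finset Γ, F.Nonempty ∧
    ((F.filter fun x => ∃ u ∈ U, x * u ∉ F).card : ℝ) ≤ δ * F.card

theorem finApprox_folner (h : FolnerR Γ) {X Y : Matrix ι ι (MonoidAlgebra ℤ Γ)}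
    (hYX : Y * X = 1) {c : ℝ} (hc : ∀ i, ∑ j, l1n ((adjM X * X) i j) ≤ c) (n : ℕ)
    (δ : ℝ) (hδ : 0 < δ) : FinApprox (adjM X * X) c n δ := by
  classical
  set Z := adjM X * X with hZ
  have hZs : ∀ i j γ, (Z i j).coeff γ = (Z j i).coeff γ⁻¹ := by
    intro i j γ
    have : adjM Z = Z := by rw [hZ, adjM_mul, adjM_adjM]
    conv_lhs => rw [← this]
    simp [adjM, gstar_coeff]
  obtain ⟨F, hF, hFd⟩ := h ((Finset.range (n+1)).biUnion fun k => Finset.univ.biUnion fun i =>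
    Finset.univ.biUnion fun j => ((Z ^ k) i j).coeff.support) δ hδ
  set U := ((Finset.range (n+1)).biUnion fun k => Finset.univ.biUnion fun i =>
    Finset.univ.biUnion fun j => ((Z ^ k) i j).coeff.support) with hU
  have hUm : ∀ k ≤ n, ∀ i j, ∀ γ, ((Z ^ k) i j).coeff γ ≠ 0 → γ ∈ U := by
    intro k hk i j γ hγ
    rw [hU]
    simp only [Finset.mem_biUnion]
    exact ⟨k, Finset.mem_range_succ_iff.2 hk, i, Finset.mem_univ i, j, Finset.mem_univ j,
      Finsupp.mem_support_iff.2 hγ⟩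
  obtain ⟨M, hM⟩ : ∃ M : Matrix (F × ι) (F × ι) ℤ,
    ∀ p q, M p q = (Z p.2 q.2).coeff ((p.1 : Γ)⁻¹ * q.1) := ⟨fun p q => _, fun _ _ => rfl⟩
  refine ⟨F, inferInstance, inferInstance, hF.to_subtype,
    Finset.univ.filter (fun x : F => ∀ u ∈ U, (x : Γ) * u ∈ F), M, ?_, ?_, ?_, ?_⟩
  · refine Matrix.PosDef.of_dotProduct_mulVec_pos ?_ ?_
    · ext ⟨x, i⟩ ⟨y, j⟩
      simp only [Matrix.conjTranspose_apply, Matrix.map_apply, star_trivial, hM]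
      rw [hZs j i]
      simp
    · intro v hv
      set u : Hn Γ ι := ∑ p : F × ι, (v p : ℂ) • dlt (p.1 : Γ) p.2 with hu
      have hup : ∀ p : F × ι, u p.2 (p.1 : Γ) = v p := by
        rintro ⟨x, i⟩
        rw [← inner_dlt, hu, inner_sum, Finset.sum_eq_single (x, i)]
        · rw [inner_smul_right, inner_dlt, dlt_apply]; simp
        · rintro ⟨y, j⟩ _ hne
          rw [inner_smul_right, inner_dlt, dlt_apply, if_neg, mul_zero]
          rintro ⟨h1, h2⟩
          apply hne
          ext
          · exact h2.symm
          · exact h1.symm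
        · simp
      have hu0 : u ≠ 0 := by
        intro h0
        apply hv
        funext p
        have := hup p
        rw [h0] at this
        simpa using this.symm
      have hXu : RA X u ≠ 0 := by
        intro h0
        apply hu0
        have : RA (Y * X) u = 0 := by rw [RA_mul, mul_apply_eq_comp, h0, map_zero]
        rwa [hYX, RA_one] at this
      have h1 : inner ℂ u (RA Z u) = ((‖RA X u‖ ^ 2 : ℝ) : ℂ) := by
        rw [hZ, RA_mul, ← adjoint_RA, mul_apply_eq_comp,
          ContinuousLinearMap.adjoint_inner_right, inner_self_eq_norm_sq_to_K]
        norm_num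
      have h2 : inner ℂ u (RA Z u) = ((star v ⬝ᵥ (M.map (Int.cast : ℤ → ℝ)).mulVec v : ℝ) : ℂ) := by
        conv_lhs => rw [hu]
        rw [map_sum, sum_inner]
        simp only [dotProduct, Matrix.mulVec]
        push_cast
        refine Finset.sum_congr rfl fun p _ => ?_
        rw [inner_smul_left, inner_sum]
        simp only [map_smul, inner_smul_right, inner_dlt, RA_dlt, Matrix.map_apply, hM]
        simp [mul_comm]
      rw [h1] at h2
      have h3 : ‖RA X u‖ ^ 2 = star v ⬝ᵥ (M.map (Int.cast : ℤ → ℝ)).mulVec v := by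
        exact_mod_cast h2
      rw [← h3]
      have := norm_pos_iff.2 hXu
      positivity
  · rintro ⟨x, i⟩
    rw [Fintype.sum_prod_type, Finset.sum_comm]
    refine le_trans (Finset.sum_le_sum fun j _ => ?_) (hc i)
    simp only [hM, l1n]
    have h1 : ∑ y : F, |((Z i j).coeff ((x : Γ)⁻¹ * y) : ℝ)| =
        ∑ γ ∈ F.image (fun y => (x : Γ)⁻¹ * y), |((Z i j).coeff γ : ℝ)| := by
      rw [Finset.sum_image (fun a _ b _ hab => mul_left_cancel hab)]
      exact Finset.sum_coe_sort F fun y => |((Z i j).coeff ((x : Γ)⁻¹ * y) : ℝ)|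
    rw [h1]
    rw [← Finset.sum_filter_ne_zero]
    refine Finset.sum_le_sum_of_subset_of_nonneg ?_ (fun _ _ _ => abs_nonneg _)
    intro γ hγ
    rw [Finset.mem_filter] at hγ
    rw [Finsupp.mem_support_iff]
    intro h0
    exact hγ.2 (by simp [h0])
  · have h1 : (Finset.univ.filter (fun x : F => ∀ u ∈ U, (x : Γ) * u ∈ F)).card
        + (F.filter fun x => ∃ u ∈ U, x * u ∉ F).card = F.card := by
      rw [← Finset.card_filter_add_card_filter_not (s := F) (fun x => ∀ u ∈ U, x * u ∈ F)]
      congr 1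
      · rw [← Finset.card_map (Function.Embedding.subtype _)]
        congr 1
        ext x
        simp
        tauto
      · congr 1
        ext x
        simp
    rw [Fintype.card_coe]
    have h2 : ((Finset.univ.filter (fun x : F => ∀ u ∈ U, (x : Γ) * u ∈ F)).card : ℝ)
        + (F.filter fun x => ∃ u ∈ U, x * u ∉ F).card = F.card := by exact_mod_cast h1
    linarith
  · intro x hx
    have hx' : ∀ u ∈ U, (x : Γ) * u ∈ F := by simpa using hx
    have key : ∀ k ≤ n, ∀ i, ∀ q : F × ι,
        (M ^ k) (x, i) q = ((Z ^ k) i q.2).coeff ((x : Γ)⁻¹ * q.1) := by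
      intro k
      induction k with
      | zero =>
        rintro _ i ⟨y, j⟩
        by_cases hij : i = j
        · subst hij
          have : (1 : Γ) = (x : Γ)⁻¹ * y ↔ x = y := by
            rw [eq_comm, inv_mul_eq_one, Subtype.ext_iff]
          simp [Matrix.one_apply, MonoidAlgebra.one_def, Finsupp.single_apply, this]
        · simp [Matrix.one_apply, hij]
      | succ k ih =>
        rintro hk i ⟨y, j⟩
        rw [pow_succ, Matrix.mul_apply, Fintype.sum_prod_type, Finset.sum_comm, pow_succ,
          Matrix.mul_apply]
        rw [MonoidAlgebra.coeff_sum, Finsupp.finsetSum_apply]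
        refine Finset.sum_congr rfl fun l _ => ?_
        rw [MonoidAlgebra.coeff_mul_apply_left, Finsupp.sum]
        simp only [ih (by omega), hM]
        have h1 : ∑ z : F, ((Z ^ k) i l).coeff ((x : Γ)⁻¹ * z) * (Z l j).coeff ((z : Γ)⁻¹ * y) =
            ∑ γ ∈ F.image (fun z => (x : Γ)⁻¹ * z),
              ((Z ^ k) i l).coeff γ * (Z l j).coeff (γ⁻¹ * ((x : Γ)⁻¹ * y)) := by
          rw [Finset.sum_image (fun a _ b _ hab => mul_left_cancel hab)]
          rw [← Finset.sum_coe_sort F]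
          refine Finset.sum_congr rfl fun z _ => ?_
          congr 2
          group
        rw [h1]
        symm
        apply Finset.sum_subset
        · intro γ hγ
          rw [Finset.mem_image]
          refine ⟨x * γ, hx' γ (hUm k (by omega) i l γ (Finsupp.mem_support_iff.1 hγ)), by group⟩
        · intro γ _ hγ
          rw [Finsupp.notMem_support_iff.1 hγ, zero_mul]
    intro i k hk
    rw [key k hk]
    simp

end Folner

section Folner
open Classical in
theorem namioka_level (U : Finset Γ) (δ : ℝ) : ∀ (n : ℕ) (S : Finset Γ) (f : Γ → ℝ), S.card ≤ n →
    (∀ x ∈ S, 0 < f x) → (∀ x, x ∉ S → f x = 0) →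
    (∑ s ∈ U, ∑ y ∈ S, |f (y * s) - f y| < δ * ∑ y ∈ S, f y) →
    ∃ F : Finset Γ, F.Nonempty ∧
      ∑ s ∈ U, ∑ y ∈ F, (if y * s ∈ F then (0:ℝ) else 1) ≤ δ * F.card := by
  intro n
  induction n with
  | zero =>
    intro S f hS _ _ h
    have : S = ∅ := Finset.card_eq_zero.1 (by omega)
    subst this; simp at h
  | succ n ih =>
    intro S f hS hpos hz h
    rcases S.eq_empty_or_nonempty with rfl | hne
    · simp at h
    obtain ⟨x0, hx0, hmin⟩ := S.exists_min_image f hne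
    by_cases hgood : ∑ s ∈ U, ∑ y ∈ S, (if y * s ∈ S then (0:ℝ) else 1) ≤ δ * S.card
    · exact ⟨S, hne, hgood⟩
    push Not at hgood
    set m := f x0 with hm
    have hm0 : 0 < m := hpos _ hx0
    set S' := S.filter (fun x => m < f x) with hS'
    set f' : Γ → ℝ := fun x => if x ∈ S then f x - m else 0 with hf'
    have hsub : S' ⊆ S := Finset.filter_subset _ _
    have hoff : ∀ x, x ∉ S' → f' x = 0 := by
      intro x hx
      by_cases h1 : x ∈ S
      · have : f x = m := by
          have h2 : ¬ m < f x := fun h2 => hx (by simp [hS', h1, h2])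
          exact le_antisymm (not_lt.1 h2) (hmin x h1)
        simp [hf', h1, this]
      · simp [hf', h1]
    apply ih S' f'
    · have : S'.card < S.card := Finset.card_lt_card (Finset.filter_ssubset.2 ⟨x0, hx0, by simp [hm]⟩)
      omega
    · intro x hx
      have := Finset.mem_filter.1 hx
      simp [hf', this.1, this.2]
    · exact hoff
    · have e1 : ∑ y ∈ S', f' y = ∑ y ∈ S, f y - m * S.card := by
        rw [Finset.sum_subset hsub (fun x _ hx => hoff x hx)]
        rw [Finset.sum_congr rfl (g := fun x => f x - m) (fun x hx => by simp [hf', hx])]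
        simp [Finset.sum_sub_distrib, mul_comm]
      have e2 : ∀ s ∈ U, ∑ y ∈ S', |f' (y * s) - f' y| ≤
          ∑ y ∈ S, |f (y * s) - f y| - m * ∑ y ∈ S, (if y * s ∈ S then (0:ℝ) else 1) := by
        intro s _
        calc _ ≤ ∑ y ∈ S, |f' (y * s) - f' y| :=
              Finset.sum_le_sum_of_subset_of_nonneg hsub (fun _ _ _ => abs_nonneg _)
          _ = _ := by
            rw [Finset.mul_sum, ← Finset.sum_sub_distrib]
            refine Finset.sum_congr rfl fun y hy => ?_
            by_cases h1 : y * s ∈ S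
            · simp [hf', h1, hy]
            · have h3 := hmin y hy
              simp only [hf', h1, hy, if_true, if_false, hz _ h1, zero_sub, abs_neg]
              rw [abs_of_nonneg (by linarith), abs_of_pos (hpos y hy)]; ring
      have e3 := Finset.sum_le_sum e2
      rw [Finset.sum_sub_distrib, ← Finset.mul_sum] at e3
      rw [e1]
      nlinarith

theorem folner_of_almost (H : ∀ (U : Finset Γ) (δ : ℝ), 0 < δ → ∃ f : Γ →₀ ℝ, (∀ x, 0 ≤ f x) ∧
    ∑ y ∈ f.support, f y = 1 ∧ ∑ s ∈ U, ∑ y ∈ f.support, |f (y * s) - f y| < δ) : FolnerR Γ := by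
  classical
  intro U δ hδ
  obtain ⟨f, h0, h1, h2⟩ := H U δ hδ
  obtain ⟨F, hF, h⟩ := namioka_level U δ f.support.card f.support f le_rfl
    (fun x hx => lt_of_le_of_ne (h0 x) (Ne.symm (Finsupp.mem_support_iff.1 hx)))
    (fun x hx => Finsupp.notMem_support_iff.1 hx) (by rw [h1]; linarith)
  refine ⟨F, hF, le_trans ?_ h⟩
  rw [Finset.sum_comm, Finset.card_filter]
  push_cast
  refine Finset.sum_le_sum fun x _ => ?_
  split_ifs with hx
  · obtain ⟨u, hu, hxu⟩ := hx
    have := Finset.single_le_sum (f := fun s => if x * s ∈ F then (0:ℝ) else 1)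
      (fun i _ => by positivity) hu
    simpa [hxu] using this
  · exact Finset.sum_nonneg fun i _ => by positivity

theorem almost_of_amenable (h : IsAmenable Γ) (U : Finset Γ) (δ : ℝ) (hδ : 0 < δ) :
    ∃ f : Γ →₀ ℝ, (∀ x, 0 ≤ f x) ∧
    ∑ y ∈ f.support, f y = 1 ∧ ∑ s ∈ U, ∑ y ∈ f.support, |f (y * s) - f y| < δ := by
  classical
  letI : TopologicalSpace Γ := ⊥
  haveI : DiscreteTopology Γ := ⟨rfl⟩
  obtain ⟨m, hm0, hm1, hmi⟩ := h
  by_contra hcon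
  push Not at hcon
  let E := lp (fun _ : Γ × Γ => ℝ) 1
  let e : Γ × Γ → E := fun z => lp.single 1 z (1:ℝ)
  let T : (Γ →₀ ℝ) →ₗ[ℝ] E := Finsupp.linearCombination ℝ
    (fun x : Γ => ∑ s ∈ U, (e (s, x * s⁻¹) - e (s, x)))
  let ev : Γ × Γ → E →ₗ[ℝ] ℝ := fun w =>
    { toFun := fun a => a.1 w, map_add' := fun _ _ => rfl, map_smul' := fun _ _ => rfl }
  have he : ∀ z w, ev w (e z) = if w = z then 1 else 0 := by
    intro z w
    show (lp.single 1 z (1:ℝ) : E).1 w = _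
    rw [lp.single_apply, Pi.single_apply]
  have hT : ∀ f s y, s ∈ U → ev (s, y) (T f) = f (y * s) - f y := by
    intro f s y hs
    induction f using Finsupp.induction_linear with
    | zero => simp
    | add f g hf hg => rw [map_add, map_add, hf, hg]; simp; ring
    | single x a =>
      simp only [T, Finsupp.linearCombination_single, map_smul, map_sum, map_sub, he, smul_eq_mul,
        Prod.mk.injEq]
      have : ∑ c ∈ U, ((if s = c ∧ y = x * c⁻¹ then (1:ℝ) else 0) - if s = c ∧ y = x then 1 else 0)
          = (if y = x * s⁻¹ then (1:ℝ) else 0) - if y = x then 1 else 0 := by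
        rw [Finset.sum_eq_single s]
        · simp
        · intro b _ hb; simp [Ne.symm hb]
        · intro h; exact absurd hs h
      rw [this]
      simp only [Finsupp.single_apply, eq_mul_inv_iff_mul_eq, eq_comm (a := x)]
      split_ifs <;> simp
  have hnorm : ∀ f : Γ →₀ ℝ, ∑ s ∈ U, ∑ y ∈ f.support, |f (y * s) - f y| ≤ ‖T f‖ := by
    intro f
    have := lp.sum_rpow_le_norm_rpow (p := 1) (by norm_num) (T f) (U ×ˢ f.support)
    simp only [ENNReal.toReal_one, Real.rpow_one] at this
    rw [Finset.sum_product] at this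
    refine le_trans (le_of_eq ?_) this
    refine Finset.sum_congr rfl fun s hs => Finset.sum_congr rfl fun y _ => ?_
    rw [← hT f s y hs, ← Real.norm_eq_abs]; rfl
  let P : Set (Γ →₀ ℝ) := {f | (∀ x, 0 ≤ f x) ∧ f.sum (fun _ a => a) = 1}
  have hPc : Convex ℝ P := by
    rintro f ⟨hf, hf1⟩ g ⟨hg, hg1⟩ a b ha hb hab
    refine ⟨fun x => by
      have := hf x; have := hg x
      simp only [Finsupp.coe_add, Finsupp.coe_smul, Pi.add_apply, Pi.smul_apply, smul_eq_mul]; positivity, ?_⟩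
    rw [Finsupp.sum_add_index' (by simp) (by simp), Finsupp.sum_smul_index (by simp),
      Finsupp.sum_smul_index (by simp), ← Finsupp.mul_sum, ← Finsupp.mul_sum, hf1, hg1]
    linarith
  have hdisj : Disjoint (Metric.ball (0:E) δ) (T '' P) := by
    rw [Set.disjoint_left]
    rintro _ hx ⟨f, ⟨hf, hf1⟩, rfl⟩
    have h1 := hcon f hf hf1
    have h2 := hnorm f
    rw [mem_ball_zero_iff] at hx
    linarith
  obtain ⟨φ, u, h1, h2⟩ := geometric_hahn_banach_open (convex_ball (0:E) δ) Metric.isOpen_ball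
    (hPc.linear_image T) hdisj
  have hu : 0 < u := by simpa using h1 0 (by simpa using hδ)
  have hb : ∀ z, |φ (e z)| ≤ ‖φ‖ := by
    intro z
    have := φ.le_opNorm (e z)
    have hz : ‖e z‖ = 1 := by
      have := lp.norm_single (E := fun _ : Γ × Γ => ℝ) (p := 1) (by norm_num) z (1:ℝ)
      exact this.trans norm_one
    rw [hz] at this
    simpa using this
  let g : Γ → BoundedContinuousFunction Γ ℝ := fun s =>
    BoundedContinuousFunction.ofNormedAddCommGroup (fun x => φ (e (s, x⁻¹)))
      continuous_of_discreteTopology ‖φ‖ (fun x => hb _)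
  let G : BoundedContinuousFunction Γ ℝ := ∑ s ∈ U,
    ((g s).compContinuous ⟨fun x => (s⁻¹)⁻¹ * x, continuous_of_discreteTopology⟩ - g s)
  have hG : m G = 0 := by
    simp only [G, map_sum, map_sub, hmi, sub_self, Finset.sum_const_zero]
  have hGu : ∀ x, u ≤ G x := by
    intro x
    have h3 := h2 (T (Finsupp.single x⁻¹ 1)) ⟨_, ⟨fun y => by
      rw [Finsupp.single_apply]; split_ifs <;> norm_num, by simp⟩, rfl⟩
    refine h3.trans (le_of_eq ?_)
    simp only [T, Finsupp.linearCombination_single, one_smul, map_sum, map_sub, G]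
    rw [BoundedContinuousFunction.coe_sum, Finset.sum_apply]
    refine Finset.sum_congr rfl fun s _ => ?_
    simp [g]
  have h4 := hm0 (G - u • 1) (fun x => by have := hGu x; simp; linarith)
  rw [map_sub, hG, map_smul, hm1] at h4
  simp at h4
  linarith

theorem folner_of_amenable (h : IsAmenable Γ) : FolnerR Γ :=
  folner_of_almost (almost_of_amenable h)
end Folner

section Integrality
variable {ι : Type} [Fintype ι]

theorem RV_mul (A B : Matrix ι ι (MonoidAlgebra ℤ Γ)) : RV ι (A * B) = RV ι A * RV ι B :=
  Subtype.ext (RA_mul A B)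
theorem RV_add (A B : Matrix ι ι (MonoidAlgebra ℤ Γ)) : RV ι (A + B) = RV ι A + RV ι B :=
  Subtype.ext (RA_add A B)
theorem RV_sub (A B : Matrix ι ι (MonoidAlgebra ℤ Γ)) : RV ι (A - B) = RV ι A - RV ι B :=
  Subtype.ext (RA_sub A B)
theorem RV_neg (A : Matrix ι ι (MonoidAlgebra ℤ Γ)) : RV ι (-A) = -RV ι A :=
  Subtype.ext (RA_neg A)
theorem RV_zero : RV ι (0 : Matrix ι ι (MonoidAlgebra ℤ Γ)) = 0 :=
  Subtype.ext RA_zero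
theorem RV_one [DecidableEq ι] : RV ι (1 : Matrix ι ι (MonoidAlgebra ℤ Γ)) = 1 :=
  Subtype.ext RA_one
theorem RV_star (A : Matrix ι ι (MonoidAlgebra ℤ Γ)) : RV ι (adjM A) = star (RV ι A) :=
  Subtype.ext (star_RA A).symm

theorem int_nonneg (hG : IsAmenable Γ ∨ IsResiduallyFinite Γ) [DecidableEq ι]
    {X Y : Matrix ι ι (MonoidAlgebra ℤ Γ)} (hXY : X * Y = 1) (hYX : Y * X = 1) :
    0 ≤ trV Γ ι (cfc Real.log (star (RV ι X) * RV ι X)) := by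
  rw [← RV_star, ← RV_mul]
  set Z := adjM X * X with hZ
  set c : ℝ := 1 + ‖RV ι Z‖ + ∑ i, ∑ j, l1n (Z i j) with hc
  have hl : ∀ i j, 0 ≤ l1n (Z i j) := fun i j => Finset.sum_nonneg fun _ _ => abs_nonneg _
  have hcs : ∀ i, ∑ j, l1n (Z i j) ≤ c := by
    intro i
    have h1 := Finset.single_le_sum (f := fun i => ∑ j, l1n (Z i j))
      (fun i _ => Finset.sum_nonneg fun j _ => hl i j) (Finset.mem_univ i)
    have := norm_nonneg (RV ι Z)
    linarith
  have hs : 0 ≤ ∑ i, ∑ j, l1n (Z i j) :=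
    Finset.sum_nonneg fun i _ => Finset.sum_nonneg fun j _ => hl i j
  have hn := norm_nonneg (RV ι Z)
  refine approx_nonneg Z ⟨RV ι X, ?_, by rw [hZ, RV_mul, RV_star]⟩ (c := c) (by linarith)
    (by linarith) ?_
  · exact isUnit_of_inv (y := RV ι Y) (by rw [← RV_mul, hXY, RV_one]) (by rw [← RV_mul, hYX, RV_one])
  · intro n δ hδ
    rcases hG with h | h
    · exact finApprox_folner (folner_of_amenable h) hYX hcs n δ hδ
    · exact finApprox_rf h hYX hcs n δ hδ

theorem int_zero (hG : IsAmenable Γ ∨ IsResiduallyFinite Γ) [DecidableEq ι]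
    {X Y : Matrix ι ι (MonoidAlgebra ℤ Γ)} (hXY : X * Y = 1) (hYX : Y * X = 1) :
    trV Γ ι (cfc Real.log (star (RV ι X) * RV ι X)) = 0 := by
  have h1 := int_nonneg hG hXY hYX
  have h2 := int_nonneg hG (X := adjM Y) (Y := adjM X) (by rw [← adjM_mul, hXY, adjM_one])
    (by rw [← adjM_mul, hYX, adjM_one])
  have x1 : RV ι X * RV ι Y = 1 := by rw [← RV_mul, hXY, RV_one]
  have x2 : RV ι Y * RV ι X = 1 := by rw [← RV_mul, hYX, RV_one]
  have y1 : star (RV ι Y) * star (RV ι X) = 1 := by rw [← star_mul, x1, star_one]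
  have y2 : star (RV ι X) * star (RV ι Y) = 1 := by rw [← star_mul, x2, star_one]
  rw [RV_star, star_star] at h2
  rw [log_inv' (a := star (RV ι X) * RV ι X) ⟨RV ι X, isUnit_of_inv x1 x2, rfl⟩
    (by rw [mul_assoc, ← mul_assoc (RV ι X), x1, one_mul, y2])
    (by rw [mul_assoc, ← mul_assoc (star (RV ι Y)), y1, one_mul, x2]), map_neg] at h2
  linarith

theorem half_zero (hG : IsAmenable Γ ∨ IsResiduallyFinite Γ) [DecidableEq ι]
    {a b W : Matrix ι ι (MonoidAlgebra ℤ Γ)} (hab1 : a + b = 1) (haa : a * a = a)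
    (hbb : b * b = b) (hab : a * b = 0) (hba : b * a = 0) (has : adjM a = a) (hbs : adjM b = b)
    (hW : W * W = 1) (hWa : W * a = b * W) (hWb : W * b = a * W) :
    trV Γ ι (RV ι a * cfc Real.log (star (RV ι W) * RV ι W)) = 0 := by
  have hW's : adjM W * adjM W = 1 := by rw [← adjM_mul, hW, adjM_one]
  have hWa' : adjM W * a = b * adjM W := by
    have := congrArg adjM hWb
    rw [adjM_mul, adjM_mul, has, hbs] at this
    exact this.symm
  have hWb' : adjM W * b = a * adjM W := by
    have := congrArg adjM hWa
    rw [adjM_mul, adjM_mul, has, hbs] at this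
    exact this.symm
  set Z := adjM W * W with hZ
  set Z' := W * adjM W with hZ'
  have hZs : adjM Z = Z := by rw [hZ, adjM_mul, adjM_adjM]
  have hZa : Z * a = a * Z := by
    rw [hZ, mul_assoc, hWa, ← mul_assoc, hWb', mul_assoc]
  have hZb : Z * b = b * Z := by
    rw [hZ, mul_assoc, hWb, ← mul_assoc, hWa', mul_assoc]
  have hZa' : Z' * a = a * Z' := by
    rw [hZ', mul_assoc, hWa', ← mul_assoc, hWb, mul_assoc]
  have hZZ' : Z * Z' = 1 := by
    rw [hZ, hZ', mul_assoc, ← mul_assoc W, hW, one_mul, hW's]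
  have hZ'Z : Z' * Z = 1 := by
    rw [hZ, hZ', mul_assoc, ← mul_assoc (adjM W), hW's, one_mul, hW]
  set T := a * Z + b with hT
  set T' := a * Z' + b with hT'
  have hTa : T * a = a * Z := by
    rw [hT, add_mul, mul_assoc, hZa, ← mul_assoc, haa, hba, add_zero]
  have hTb : T * b = b := by
    rw [hT, add_mul, mul_assoc, hZb, ← mul_assoc, hab, zero_mul, zero_add, hbb]
  have hT'a : T' * a = a * Z' := by
    rw [hT', add_mul, mul_assoc, hZa', ← mul_assoc, haa, hba, add_zero]
  have hT'b : T' * b = b := by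
    have hZb' : Z' * b = b * Z' := by
      rw [hZ', mul_assoc, hWb', ← mul_assoc, hWa, mul_assoc]
    rw [hT', add_mul, mul_assoc, hZb', ← mul_assoc, hab, zero_mul, zero_add, hbb]
  have hTT' : T * T' = 1 := by
    rw [hT', mul_add, ← mul_assoc, hTa, hTb, mul_assoc, hZZ', mul_one, hab1]
  have hT'T : T' * T = 1 := by
    rw [hT, mul_add, ← mul_assoc, hT'a, hT'b, mul_assoc, hZ'Z, mul_one, hab1]
  have aux : ∀ A B : Matrix ι ι (MonoidAlgebra ℤ Γ), adjM (A + B) = adjM A + adjM B := by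
    intro A B; apply RA_inj; rw [← adjoint_RA, RA_add, map_add, RA_add, adjoint_RA, adjoint_RA]
  have hTs : adjM T = T := by
    rw [hT, aux, adjM_mul, has, hbs, hZs, hZa]
  have h0 := int_zero hG hTT' hT'T
  rw [← RV_star, hTs] at h0
  have uT : IsUnit (RV ι T) := isUnit_of_inv (y := RV ι T') (by rw [← RV_mul, hTT', RV_one])
    (by rw [← RV_mul, hT'T, RV_one])
  have uZ : IsUnit (RV ι Z) := isUnit_of_inv (y := RV ι Z') (by rw [← RV_mul, hZZ', RV_one])
    (by rw [← RV_mul, hZ'Z, RV_one])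
  have uW : IsUnit (RV ι W) := isUnit_of_inv (y := RV ι W) (by rw [← RV_mul, hW, RV_one])
    (by rw [← RV_mul, hW, RV_one])
  have pT : PosInv (RV ι T * RV ι T) := ⟨RV ι T, uT, by rw [← RV_star, hTs]⟩
  have pZZ : PosInv (RV ι Z * RV ι Z) := ⟨RV ι Z, uZ, by rw [← RV_star, hZs]⟩
  have pZ : PosInv (RV ι Z) := ⟨RV ι W, uW, by rw [← RV_star, ← RV_mul]⟩
  have i1 := log_intertwine (V := RV ι a) pT pZZ (by
    simp only [← RV_mul]; rw [mul_assoc, hTa, ← mul_assoc, hTa, mul_assoc])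
  have i2 := log_intertwine (V := RV ι b) pT PosInv.one (by
    simp only [← RV_mul, mul_one]; rw [mul_assoc, hTb, hTb])
  rw [log_one', mul_zero] at i2
  rw [log_sq' pZ] at i1
  have h3 : cfc Real.log (RV ι T * RV ι T) = (2:ℝ) • (RV ι a * cfc Real.log (RV ι Z)) := by
    calc _ = cfc Real.log (RV ι T * RV ι T) * (RV ι a + RV ι b) := by
          rw [← RV_add, hab1, RV_one, mul_one]
      _ = _ := by rw [mul_add, i1, i2, add_zero, mul_smul_comm]
  rw [h3, map_smul] at h0
  rw [← RV_star, ← RV_mul]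
  simpa using h0

theorem sL_int_zero (hG : IsAmenable Γ ∨ IsResiduallyFinite Γ) [DecidableEq ι]
    {a b W : Matrix ι ι (MonoidAlgebra ℤ Γ)} (hab1 : a + b = 1) (haa : a * a = a)
    (hbb : b * b = b) (hab : a * b = 0) (hba : b * a = 0) (has : adjM a = a) (hbs : adjM b = b)
    (hW : W * W = 1) (hWa : W * a = b * W) (hWb : W * b = a * W) :
    sL (trV Γ ι) (RV ι (a - b)) (RV ι W) = 0 := by
  rw [sL, RV_sub, sub_mul, map_sub, half_zero hG hab1 haa hbb hab hba has hbs hW hWa hWb,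
    half_zero hG (by rw [add_comm, hab1]) hbb haa hba hab hbs has hW hWb hWa, sub_zero]
end Integrality

section Tot
variable {R : Type} [Ring R] {X Y Z : ℕ → Type} [∀ j, Fintype (X j)] [∀ j, Fintype (Y j)]
  [∀ j, Fintype (Z j)] (M : ℕ)

def tot (F : (i j : ℕ) → Matrix (X i) (Y j) R) :
    Matrix (Σ j : Fin M, X j) (Σ j : Fin M, Y j) R := fun s t => F s.1 t.1 s.2 t.2

theorem tot_mul (F : (i j : ℕ) → Matrix (X i) (Y j) R) (G : (i j : ℕ) → Matrix (Y i) (Z j) R) :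
    tot M F * tot M G = tot M (fun i k => ∑ j : Fin M, F i j * G j k) := by
  ext s t
  rw [Matrix.mul_apply, Fintype.sum_sigma]
  simp only [tot, Matrix.sum_apply, Matrix.mul_apply]

theorem tot_mul_eq (F : (i j : ℕ) → Matrix (X i) (Y j) R) (G : (i j : ℕ) → Matrix (Y i) (Z j) R)
    (H : (i j : ℕ) → Matrix (X i) (Z j) R) (hY : ∀ j, M ≤ j → IsEmpty (Y j))
    (φ : ℕ → ℕ → ℕ)
    (h0 : ∀ i k j, j ≠ φ i k → F i j * G j k = 0)
    (h1 : ∀ i k, F i (φ i k) * G (φ i k) k = H i k) :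
    tot M F * tot M G = tot M H := by
  rw [tot_mul]
  congr 1
  funext i k
  rw [← h1]
  by_cases h : φ i k < M
  · rw [Finset.sum_eq_single ⟨φ i k, h⟩]
    · intro b _ hb
      exact h0 i k b (fun e => hb (Fin.ext e))
    · simp
  · have := hY _ (not_lt.1 h)
    rw [Finset.sum_eq_zero]
    · ext x z
      rw [Matrix.mul_apply]; simp
    · intro b _
      exact h0 i k b (fun e => h (e ▸ b.2))

def up (a : ∀ j, Matrix (Y (j + 1)) (X j) R) (i j : ℕ) : Matrix (Y i) (X j) R :=
  if h : i = j + 1 then (h ▸ a j) else 0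
def mid (a : ∀ j, Matrix (Y j) (X j) R) (i j : ℕ) : Matrix (Y i) (X j) R :=
  if h : i = j then (h ▸ a i) else 0
def dn (a : ∀ j, Matrix (Y j) (X (j + 1)) R) (i j : ℕ) : Matrix (Y i) (X j) R :=
  if h : j = i + 1 then (h ▸ a i) else 0

@[simp] theorem up_self (a : ∀ j, Matrix (Y (j + 1)) (X j) R) (j : ℕ) : up a (j + 1) j = a j := by
  simp [up]
@[simp] theorem mid_self (a : ∀ j, Matrix (Y j) (X j) R) (j : ℕ) : mid a j j = a j := by
  simp [mid]
@[simp] theorem dn_self (a : ∀ j, Matrix (Y j) (X (j + 1)) R) (j : ℕ) : dn a j (j + 1) = a j := by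
  simp [dn]
theorem up_ne (a : ∀ j, Matrix (Y (j + 1)) (X j) R) {i j : ℕ} (h : i ≠ j + 1) : up a i j = 0 := by
  simp [up, h]
theorem mid_ne (a : ∀ j, Matrix (Y j) (X j) R) {i j : ℕ} (h : i ≠ j) : mid a i j = 0 := by
  simp [mid, h]
theorem dn_ne (a : ∀ j, Matrix (Y j) (X (j + 1)) R) {i j : ℕ} (h : j ≠ i + 1) : dn a i j = 0 := by
  simp [dn, h]

variable {M}

theorem mid_mul_mid (hY : ∀ j, M ≤ j → IsEmpty (Y j))
    (a : ∀ j, Matrix (X j) (Y j) R) (b : ∀ j, Matrix (Y j) (Z j) R) :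
    tot M (mid a) * tot M (mid b) = tot M (mid fun j => a j * b j) := by
  refine tot_mul_eq M _ _ _ hY (fun i k => k) ?_ ?_
  · intro i k j h; rw [mid_ne b h, Matrix.mul_zero]
  · intro i k
    by_cases h : i = k
    · subst h; simp
    · rw [mid_ne a h, mid_ne _ h, Matrix.zero_mul]

theorem up_mul_mid (hY : ∀ j, M ≤ j → IsEmpty (Y j))
    (a : ∀ j, Matrix (X (j + 1)) (Y j) R) (b : ∀ j, Matrix (Y j) (Z j) R) :
    tot M (up a) * tot M (mid b) = tot M (up fun j => a j * b j) := by
  refine tot_mul_eq M _ _ _ hY (fun i k => k) ?_ ?_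
  · intro i k j h; rw [mid_ne b h, Matrix.mul_zero]
  · intro i k
    by_cases h : i = k + 1
    · subst h; simp
    · rw [up_ne a h, up_ne _ h, Matrix.zero_mul]

theorem mid_mul_up (hY : ∀ j, M ≤ j → IsEmpty (Y j))
    (a : ∀ j, Matrix (X j) (Y j) R) (b : ∀ j, Matrix (Y (j + 1)) (Z j) R) :
    tot M (mid a) * tot M (up b) = tot M (up fun j => a (j + 1) * b j) := by
  refine tot_mul_eq M _ _ _ hY (fun i k => k + 1) ?_ ?_
  · intro i k j h; rw [up_ne b h, Matrix.mul_zero]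
  · intro i k
    by_cases h : i = k + 1
    · subst h; simp
    · rw [mid_ne a h, up_ne _ h, Matrix.zero_mul]

theorem up_mul_up (hY : ∀ j, M ≤ j → IsEmpty (Y j))
    (a : ∀ j, Matrix (X (j + 1)) (Y j) R) (b : ∀ j, Matrix (Y (j + 1)) (Z j) R)
    (hab : ∀ j, a (j + 1) * b j = 0) :
    tot M (up a) * tot M (up b) = 0 := by
  have : (0 : Matrix (Σ j : Fin M, X j) (Σ j : Fin M, Z j) R) = tot M (fun _ _ => 0) := rfl
  rw [this]
  refine tot_mul_eq M _ _ _ hY (fun i k => k + 1) ?_ ?_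
  · intro i k j h; rw [up_ne b h, Matrix.mul_zero]
  · intro i k
    by_cases h : i = k + 1 + 1
    · subst h; simp [hab]
    · rw [up_ne a h, Matrix.zero_mul]

theorem dn_mul_up (hY : ∀ j, M ≤ j → IsEmpty (Y j))
    (a : ∀ j, Matrix (X j) (Y (j + 1)) R) (b : ∀ j, Matrix (Y (j + 1)) (Z j) R) :
    tot M (dn a) * tot M (up b) = tot M (mid fun j => a j * b j) := by
  refine tot_mul_eq M _ _ _ hY (fun i k => k + 1) ?_ ?_
  · intro i k j h; rw [up_ne b h, Matrix.mul_zero]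
  · intro i k
    by_cases h : i = k
    · subst h; simp
    · rw [dn_ne a (by omega), mid_ne _ h, Matrix.zero_mul]

def updn (a : ∀ j, Matrix (X (j + 1)) (Y j) R) (b : ∀ j, Matrix (Y j) (Z (j + 1)) R) :
    ∀ j, Matrix (X j) (Z j) R
  | 0 => 0
  | j + 1 => a j * b j

theorem up_mul_dn (hY : ∀ j, M ≤ j → IsEmpty (Y j))
    (a : ∀ j, Matrix (X (j + 1)) (Y j) R) (b : ∀ j, Matrix (Y j) (Z (j + 1)) R) :
    tot M (up a) * tot M (dn b) = tot M (mid (updn a b)) := by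
  refine tot_mul_eq M _ _ _ hY (fun i k => i - 1) ?_ ?_
  · intro i k j h
    by_cases h1 : i = j + 1
    · subst h1; simp at h
    · rw [up_ne a h1, Matrix.zero_mul]
  · intro i k
    rcases i with _ | i
    · rw [up_ne a (by omega), Matrix.zero_mul]
      by_cases h : 0 = k
      · subst h; simp [updn]
      · rw [mid_ne _ h]
    · show up a (i + 1) i * dn b i k = _
      rw [up_self]
      by_cases h : i + 1 = k
      · subst h; simp [updn]
      · rw [mid_ne _ h, dn_ne _ (by omega), Matrix.mul_zero]

theorem tot_add (F G : (i j : ℕ) → Matrix (X i) (Y j) R) :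
    tot M F + tot M G = tot M (fun i j => F i j + G i j) := rfl

theorem mid_add (a b : ∀ j, Matrix (X j) (Y j) R) :
    tot M (mid a) + tot M (mid b) = tot M (mid fun j => a j + b j) := by
  rw [tot_add]
  congr 1; funext i j
  by_cases h : i = j
  · subst h; simp
  · simp [mid_ne _ h]
theorem tot_mid_one [∀ j, DecidableEq (X j)] : tot M (mid fun j => (1 : Matrix (X j) (X j) R)) = 1 := by
  classical
  ext ⟨⟨i, hi⟩, x⟩ ⟨⟨j, hj⟩, y⟩
  by_cases h : i = j
  · subst h
    simp [tot, Matrix.one_apply]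
  · simp [tot, mid_ne _ h, Matrix.one_apply, h]
end Tot

section RingLemmas
variable {R : Type*} [Ring R]

theorem odd_contraction {D s n a b : R} (hDD : D * D = 0) (hs : D * s + s * D = 1 + n)
    (hn : n * n = 0) (hDa : D * a = b * D) (hDb : D * b = a * D)
    (hsa : s * a = b * s) (hsb : s * b = a * s) :
    ∃ σ, D * σ + σ * D = 1 ∧ σ * σ = 0 ∧ σ * a = b * σ ∧ σ * b = a * σ := by
  have hn' : n = D * s + s * D - 1 := by rw [hs]; abel
  have hDn : D * n = n * D := by
    rw [hn']
    linear_combination (norm := noncomm_ring) hDD * s - s * hDD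
  have hna : n * a = a * n := by
    rw [hn']
    linear_combination (norm := noncomm_ring) D * hsa + hDb * s + s * hDa + hsb * D
  have hnb : n * b = b * n := by
    rw [hn']
    linear_combination (norm := noncomm_ring) D * hsb + hDa * s + s * hDb + hsa * D
  set s1 := s * (1 - n) with hs1
  have h1 : D * s1 + s1 * D = 1 := by
    have : D * s1 + s1 * D = (D * s + s * D) * (1 - n) := by
      rw [hs1]; linear_combination (norm := noncomm_ring) s * hDn
    rw [this, hs]
    linear_combination (norm := noncomm_ring) -hn
  have h1a : s1 * a = b * s1 := by
    rw [hs1]; linear_combination (norm := noncomm_ring) hsa - s * hna - hsa * n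
  have h1b : s1 * b = a * s1 := by
    rw [hs1]; linear_combination (norm := noncomm_ring) hsb - s * hnb - hsb * n
  have k1 : D * s1 * D = D := by
    linear_combination (norm := noncomm_ring) h1 * D - s1 * hDD
  have k2 : D * s1 * s1 * D = 0 := by
    have : D * s1 * (D * s1 + s1 * D) = D * s1 := by rw [h1, mul_one]
    linear_combination (norm := noncomm_ring) this - k1 * s1
  refine ⟨s1 * D * s1, ?_, ?_, ?_, ?_⟩
  · linear_combination (norm := noncomm_ring) k1 * s1 + s1 * k1 + h1
  · linear_combination (norm := noncomm_ring) s1 * k2 * s1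
  · linear_combination (norm := noncomm_ring) s1 * D * h1a + s1 * hDb * s1 + h1a * D * s1
  · linear_combination (norm := noncomm_ring) s1 * D * h1b + s1 * hDa * s1 + h1b * D * s1
end RingLemmas

section Dg
variable {E : Type} [Fintype E] [DecidableEq E]

def dg (u : E → ℤ) : Matrix E E (MonoidAlgebra ℤ Γ) := Matrix.diagonal fun e => (u e : MonoidAlgebra ℤ Γ)

theorem dg_mul (u v : E → ℤ) : (dg u * dg v : Matrix E E (MonoidAlgebra ℤ Γ)) = dg (u * v) := by
  simp [dg, Matrix.diagonal_mul_diagonal]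
theorem dg_add (u v : E → ℤ) : (dg u + dg v : Matrix E E (MonoidAlgebra ℤ Γ)) = dg (u + v) := by
  simp [dg, Matrix.diagonal_add]
theorem dg_sub (u v : E → ℤ) : (dg u - dg v : Matrix E E (MonoidAlgebra ℤ Γ)) = dg (u - v) := by
  simp [dg, Matrix.diagonal_sub]
theorem dg_neg (u : E → ℤ) : (- dg u : Matrix E E (MonoidAlgebra ℤ Γ)) = dg (-u) := by
  simp [dg, Matrix.diagonal_neg]
theorem dg_one : (dg 1 : Matrix E E (MonoidAlgebra ℤ Γ)) = 1 := by
  simp [dg]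
theorem dg_zero : (dg 0 : Matrix E E (MonoidAlgebra ℤ Γ)) = 0 := by
  simp [dg]
theorem dg_comm (u v : E → ℤ) (X : Matrix E E (MonoidAlgebra ℤ Γ))
    (h : ∀ s t, X s t ≠ 0 → u t = v s) : X * dg u = dg v * X := by
  ext1 s t
  rw [dg, dg, Matrix.mul_diagonal, Matrix.diagonal_mul]
  by_cases hX : X s t = 0
  · rw [hX, zero_mul, mul_zero]
  · rw [h s t hX]
    exact (Int.cast_commute _ _).symm.eq
theorem dg_mul_left (u v : E → ℤ) (X : Matrix E E (MonoidAlgebra ℤ Γ))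
    (h : ∀ s t, X s t ≠ 0 → u s = v s) : dg u * X = dg v * X := by
  ext1 s t
  rw [dg, dg, Matrix.diagonal_mul, Matrix.diagonal_mul]
  by_cases hX : X s t = 0
  · rw [hX, mul_zero, mul_zero]
  · rw [h s t hX]
theorem adjM_dg (u : E → ℤ) : adjM (dg u : Matrix E E (MonoidAlgebra ℤ Γ)) = dg u := by
  ext1 s t
  by_cases h : s = t
  · subst h
    have h1 : ∀ k : ℤ, (k : MonoidAlgebra ℤ Γ) = MonoidAlgebra.single 1 k := by
      intro k
      rw [MonoidAlgebra.intCast_def]; simp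
    simp only [adjM, dg, Matrix.diagonal_apply_eq, h1, gstar_single, inv_one]
  · simp [adjM, dg, Matrix.diagonal_apply_ne _ h, Matrix.diagonal_apply_ne _ (Ne.symm h), gstar_zero]
end Dg

section Cplx

abbrev BI (C : BasedFreeComplex Γ) (M : ℕ) : Type := Σ j : Fin M, C.basis j

def dT (C : BasedFreeComplex Γ) (M : ℕ) : Matrix (BI C M) (BI C M) (MonoidAlgebra ℤ Γ) :=
  tot M (up C.d)

theorem cempty {C : BasedFreeComplex Γ} {M : ℕ} (hM : C.N < M) (j : ℕ) (hj : M ≤ j) :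
    IsEmpty (C.basis j) := C.bounded j (by omega)

theorem dT_sq {C : BasedFreeComplex Γ} {M : ℕ} (hM : C.N < M) : dT C M * dT C M = 0 :=
  up_mul_up (cempty hM) _ _ C.dd

def fT {C C' : BasedFreeComplex Γ} (φ : CochainMap C C') (M : ℕ) :
    Matrix (BI C' M) (BI C M) (MonoidAlgebra ℤ Γ) := tot M (mid φ.f)

theorem fT_comm {C C' : BasedFreeComplex Γ} (φ : CochainMap C C') {M : ℕ} (hM : C.N < M)
    (hM' : C'.N < M) : dT C' M * fT φ M = fT φ M * dT C M := by
  rw [dT, dT, fT, up_mul_mid (cempty hM'), mid_mul_up (cempty hM)]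
  congr 2
  funext j
  exact (φ.comm j).symm

theorem homot_tot [∀ (C : BasedFreeComplex Γ) j, DecidableEq (C.basis j)]
    {C C' : BasedFreeComplex Γ} {φ : CochainMap C C'} {ψ : CochainMap C' C}
    (h : (ψ.comp φ).Homotopic (CochainMap.id C)) {M : ℕ} (hM : C.N < M) (hM' : C'.N < M) :
    ∃ h : (j : ℕ) → Matrix (C.basis j) (C.basis (j + 1)) (MonoidAlgebra ℤ Γ),
      fT ψ M * fT φ M + tot M (dn h) * dT C M + dT C M * tot M (dn h) = 1 := by
  obtain ⟨h, h0, h1⟩ := h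
  refine ⟨h, ?_⟩
  rw [dT, fT, fT, mid_mul_mid (cempty hM'), dn_mul_up (cempty hM), up_mul_dn (cempty hM), mid_add,
    mid_add]
  trans tot M (mid fun j => (1 : Matrix (C.basis j) (C.basis j) (MonoidAlgebra ℤ Γ)))
  · congr 2
    funext j
    have hid : ∀ j, (CochainMap.id C).f j = 1 := by
      intro j; simp only [CochainMap.id]; congr!
    rcases j with _ | j
    · rw [hid] at h0
      simp only [updn, add_zero]
      rw [← h0]
      simp [CochainMap.comp]
    · have := h1 j
      rw [hid] at this
      simp only [updn]
      rw [add_assoc, ← this]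
      simp [CochainMap.comp]
  · rw [tot_mid_one]

/-- integral matrix of the Laplacian -/
def lapM (C : BasedFreeComplex Γ) (j : ℕ) : Matrix (C.basis j) (C.basis j) (MonoidAlgebra ℤ Γ) :=
  adjM (C.d j) * C.d j + updn C.d (fun j => adjM (C.d j)) j

theorem lap_eq (C : BasedFreeComplex Γ) (j : ℕ) : C.lap j = RA (lapM C j) := by
  rcases j with _ | j
  · simp only [lapM, updn, add_zero]
    rw [RA_comp, ← adjoint_RA]; rfl
  · simp only [lapM, updn]
    rw [RA_add, RA_comp, RA_comp, ← adjoint_RA, ← adjoint_RA]; rfl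

theorem adjM_dT (C : BasedFreeComplex Γ) (M : ℕ) :
    adjM (dT C M) = tot M (dn fun j => adjM (C.d j)) := by
  ext1 ⟨⟨i, hi⟩, x⟩ ⟨⟨j, hj⟩, y⟩
  show gstar (up C.d j i y x) = dn (fun j => adjM (C.d j)) i j x y
  by_cases h : j = i + 1
  · subst h
    rw [up_self, dn_self]; rfl
  · rw [up_ne _ h, dn_ne _ h, Matrix.zero_apply, gstar_zero, Matrix.zero_apply]

theorem LT_eq {C : BasedFreeComplex Γ} {M : ℕ} (hM : C.N < M) :
    adjM (dT C M) * dT C M + dT C M * adjM (dT C M) = tot M (mid (lapM C)) := by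
  rw [adjM_dT, dT, dn_mul_up (cempty hM), up_mul_dn (cempty hM), mid_add]
  rfl

theorem LT_pow [∀ (C : BasedFreeComplex Γ) j, DecidableEq (C.basis j)]
    {C : BasedFreeComplex Γ} {M : ℕ} (hM : C.N < M) (k : ℕ) :
    tot M (mid (lapM C)) ^ k = tot M (mid fun j => lapM C j ^ k) := by
  induction k with
  | zero => simp only [pow_zero]; rw [tot_mid_one]
  | succ k ih => rw [pow_succ, ih, mid_mul_mid (cempty hM)]; simp only [pow_succ]

theorem RA_tot_mid (C : BasedFreeComplex Γ) (M : ℕ)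
    (L : ∀ j, Matrix (C.basis j) (C.basis j) (MonoidAlgebra ℤ Γ))
    (v : Hn Γ (BI C M)) (j : Fin M) (x : C.basis j) :
    RA (tot M (mid L)) v ⟨j, x⟩ = RA (L j) (WithLp.toLp 2 fun y => v ⟨j, y⟩) x := by
  rw [RA_apply, RA_apply, Fintype.sum_sigma, Finset.sum_eq_single j]
  · simp [tot]
  · intro b _ hb
    refine Finset.sum_eq_zero fun y _ => ?_
    have : mid L (j : ℕ) (b : ℕ) = 0 := mid_ne _ (fun h => hb (Fin.ext h.symm))
    simp [tot, this, Rop_zero]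
  · simp

theorem bij_tot_mid (C : BasedFreeComplex Γ) (M : ℕ)
    (L : ∀ j, Matrix (C.basis j) (C.basis j) (MonoidAlgebra ℤ Γ))
    (h : ∀ j, IsUnit (RA (L j))) : Function.Bijective (RA (tot M (mid L))) := by
  have hb := fun j => (ContinuousLinearMap.isUnit_iff_bijective).1 (h j)
  constructor
  · intro v v' hv
    ext ⟨j, x⟩ γ
    have : (WithLp.toLp 2 fun y => v ⟨j, y⟩ : Hn Γ (C.basis j)) = WithLp.toLp 2 fun y => v' ⟨j, y⟩ := by
      apply (hb j).1
      ext x γ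
      rw [← RA_tot_mid, ← RA_tot_mid, hv]
    exact congrArg (fun u : Hn Γ (C.basis j) => u x γ) this
  · intro w
    choose u hu using fun j : Fin M => (hb j).2 (WithLp.toLp 2 fun y => w ⟨j, y⟩)
    refine ⟨WithLp.toLp 2 fun s => u s.1 s.2, ?_⟩
    ext ⟨j, x⟩ γ
    rw [RA_tot_mid]
    exact congrArg (fun u : Hn Γ (C.basis j) => u x γ) (hu j)

theorem isUnit_blocks {α β : Type} [Fintype α] [Fintype β] (A : Matrix α α (MonoidAlgebra ℤ Γ))
    (B : Matrix β β (MonoidAlgebra ℤ Γ)) (hA : Function.Bijective (RA A))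
    (hB : Function.Bijective (RA B)) : IsUnit (RA (Matrix.fromBlocks A 0 0 B)) := by
  have e1 : ∀ (v : Hn Γ (α ⊕ β)) x, RA (Matrix.fromBlocks A 0 0 B) v (Sum.inl x) =
      RA A (WithLp.toLp 2 fun y => v (Sum.inl y)) x := by
    intro v x
    simp [RA_apply, Rop_zero]
  have e2 : ∀ (v : Hn Γ (α ⊕ β)) x, RA (Matrix.fromBlocks A 0 0 B) v (Sum.inr x) =
      RA B (WithLp.toLp 2 fun y => v (Sum.inr y)) x := by
    intro v x
    simp [RA_apply, Rop_zero]
  rw [ContinuousLinearMap.isUnit_iff_bijective]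
  constructor
  · intro v v' hv
    have h1 : (WithLp.toLp 2 fun y => v (Sum.inl y) : Hn Γ α) = WithLp.toLp 2 fun y => v' (Sum.inl y) := by
      apply hA.1
      ext x γ
      rw [← e1, ← e1, hv]
    have h2 : (WithLp.toLp 2 fun y => v (Sum.inr y) : Hn Γ β) = WithLp.toLp 2 fun y => v' (Sum.inr y) := by
      apply hB.1
      ext x γ
      rw [← e2, ← e2, hv]
    ext s γ
    rcases s with x | x
    · exact congrArg (fun u : Hn Γ α => u x γ) h1
    · exact congrArg (fun u : Hn Γ β => u x γ) h2
  · intro w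
    obtain ⟨u, hu⟩ := hA.2 (WithLp.toLp 2 fun y => w (Sum.inl y))
    obtain ⟨u', hu'⟩ := hB.2 (WithLp.toLp 2 fun y => w (Sum.inr y))
    refine ⟨WithLp.toLp 2 (Sum.elim (fun x => u x) (fun x => u' x)), ?_⟩
    ext s γ
    rcases s with x | x
    · rw [e1]; exact congrArg (fun u : Hn Γ α => u x γ) hu
    · rw [e2]; exact congrArg (fun u : Hn Γ β => u x γ) hu'

theorem isUnit_vn {ι : Type} [Fintype ι] (T : VN Γ ι) (h : IsUnit (T : Hn Γ ι →L[ℂ] Hn Γ ι)) :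
    IsUnit T := by
  haveI : IsClosed ((VN Γ ι : StarSubalgebra ℂ _) : Set (Hn Γ ι →L[ℂ] Hn Γ ι)) := by
    rw [VN, StarSubalgebra.coe_centralizer]
    exact Set.isClosed_centralizer _
  exact (StarSubalgebra.coe_isUnit _).1 h
end Cplx

section LapTrace

def lapV (C : BasedFreeComplex Γ) (j : ℕ) : VN Γ (C.basis j) := RV _ (lapM C j)

theorem lapV_coe (C : BasedFreeComplex Γ) (j : ℕ) :
    (lapV C j : Hn Γ (C.basis j) →L[ℂ] Hn Γ (C.basis j)) = C.lap j := (lap_eq C j).symm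

theorem lapV_posInv {C : BasedFreeComplex Γ} (hC : C.AcyclicWithGap) (j : ℕ) :
    PosInv (star (lapV C j) * lapV C j) :=
  ⟨_, isUnit_vn _ (by rw [lapV_coe]; exact hC j), rfl⟩

def tlap (C : BasedFreeComplex Γ) (j : ℕ) : ℝ :=
  (1 / 2) * trV Γ _ (cfc Real.log (star (lapV C j) * lapV C j))

theorem FK_lap {C : BasedFreeComplex Γ} (hC : C.AcyclicWithGap) (j : ℕ) :
    FKdet (C.lap j) = Real.exp (tlap C j) := by
  rw [FKdet, tlap, trV_apply, vn_cfc (lapV_posInv hC j)]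
  have : ((star (lapV C j) * lapV C j : VN Γ _) : Hn Γ (C.basis j) →L[ℂ] Hn Γ (C.basis j)) =
    star (C.lap j) * C.lap j := by rw [← lapV_coe]; rfl
  rw [this]

theorem torsion_eq {C : BasedFreeComplex Γ} (hC : C.AcyclicWithGap) {M : ℕ} (hM : C.N < M) :
    C.torsion = Real.exp (∑ j : Fin M, (((-1) ^ (j:ℕ) * (j:ℤ) : ℤ) : ℝ) * tlap C j) := by
  rw [Fin.sum_univ_eq_sum_range (fun j => (((-1) ^ j * (j:ℤ) : ℤ) : ℝ) *
      tlap C j), BasedFreeComplex.torsion, Real.exp_sum]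
  have h1 : ∀ j, FKdet (C.lap j) ^ ((-1 : ℤ) ^ j * (j : ℤ)) =
      Real.exp ((((-1) ^ j * (j:ℤ) : ℤ) : ℝ) * tlap C j) := by
    intro j
    rw [FK_lap hC, ← Real.rpow_intCast, ← Real.exp_mul, mul_comm]
  simp only [h1]
  refine Finset.prod_subset (Finset.range_mono (by omega)) ?_
  intro j _ hj
  have := C.bounded j (by simpa using hj)
  rw [tlap, trV_apply, vnTrace]
  simp

variable {E : Type} [Fintype E] [DecidableEq E]

def LamT (T : VN Γ E) : (E → ℤ) →+ ℝ where
  toFun u := trV Γ E (RV E (dg u) * T)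
  map_zero' := by rw [dg_zero, RV_zero, zero_mul, map_zero]
  map_add' u v := by rw [← dg_add, RV_add, add_mul, map_add]

theorem LamT_RV (A : Matrix E E (MonoidAlgebra ℤ Γ)) (u : E → ℤ) :
    LamT (RV E A) u = ∑ e, (u e : ℝ) * ((A e e).coeff 1 : ℝ) := by
  show trV Γ E (RV E (dg u) * RV E A) = _
  rw [← RV_mul, trV_apply]
  show (vnTrace (RA (dg u * A))).re = _
  rw [vnTrace_RA, Complex.re_sum]
  refine Finset.sum_congr rfl fun e _ => ?_
  have h : (dg u * A : Matrix E E (MonoidAlgebra ℤ Γ)) e e = u e • A e e := by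
    rw [dg, Matrix.diagonal_mul, zsmul_eq_mul]
  rw [h, MonoidAlgebra.coeff_smul]
  simp

theorem RV_pow {ι : Type} [Fintype ι] [DecidableEq ι] (A : Matrix ι ι (MonoidAlgebra ℤ Γ)) (k : ℕ) :
    RV ι A ^ k = RV ι (A ^ k) := by
  induction k with
  | zero => simp [RV_one]
  | succ k ih => rw [pow_succ, pow_succ, ih, RV_mul]

theorem LamT_transfer {ι : Type} [Fintype ι] [DecidableEq ι] (A : Matrix E E (MonoidAlgebra ℤ Γ))
    (B : Matrix ι ι (MonoidAlgebra ℤ Γ)) (hA : PosInv (RV E A)) (hB : PosInv (RV ι B)) (u : E → ℤ)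
    (h : ∀ k, ∑ e, (u e : ℝ) * (((A ^ k) e e).coeff 1 : ℝ) = ∑ i, (((B ^ k) i i).coeff 1 : ℝ)) :
    LamT (cfc Real.log (RV E A)) u = trV Γ ι (cfc Real.log (RV ι B)) := by
  refine log_transfer hA hB ((trV Γ E).comp (ContinuousLinearMap.mul ℝ (VN Γ E) (RV E (dg u))))
    (trV Γ ι) fun k => ?_
  have h2 : trV Γ ι (RV ι B ^ k) = ∑ i, (((B ^ k) i i).coeff 1 : ℝ) := by
    rw [RV_pow, trV_apply]
    show (vnTrace (RA (B ^ k))).re = _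
    rw [vnTrace_RA, Complex.re_sum]; simp
  rw [h2, ← h, ← LamT_RV, ← RV_pow]
  rfl

theorem lapM_adj (C : BasedFreeComplex Γ) (j : ℕ) : adjM (lapM C j) = lapM C j := by
  apply RA_inj
  rw [← adjoint_RA, ← lap_eq]
  rcases j with _ | j
  · simp [BasedFreeComplex.lap, ContinuousLinearMap.adjoint_comp]
  · simp [BasedFreeComplex.lap, ContinuousLinearMap.adjoint_comp]

theorem LamT_lap {C : BasedFreeComplex Γ} (hC : C.AcyclicWithGap) (j : ℕ)
    [DecidableEq (C.basis j)] (A : Matrix E E (MonoidAlgebra ℤ Γ)) (hA : PosInv (RV E A))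
    (u : E → ℤ)
    (h : ∀ k, ∑ e, (u e : ℝ) * (((A ^ k) e e).coeff 1 : ℝ) =
      ∑ i, (((lapM C j ^ k) i i).coeff 1 : ℝ)) :
    LamT (cfc Real.log (RV E A)) u = tlap C j := by
  have hp := lapV_posInv hC j
  have e : star (lapV C j) * lapV C j = RV _ (lapM C j * lapM C j) := by
    rw [RV_mul, lapV, ← RV_star, lapM_adj]
  rw [e] at hp
  have hAA : PosInv (RV E (A * A)) :=
    ⟨RV E A, hA.isUnit, by rw [RV_mul, hA.sa.star_eq]⟩
  have := LamT_transfer (A * A) (lapM C j * lapM C j) hAA hp u (fun k => by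
    rw [← sq, ← sq, ← pow_mul, ← pow_mul]; exact h _)
  rw [tlap, e, ← this, RV_mul, log_sq' hA]
  show _ = 1 / 2 * trV Γ E (RV E (dg u) * _)
  rw [mul_smul_comm, map_smul, smul_eq_mul]
  show trV Γ E (RV E (dg u) * _) = _
  ring
end LapTrace

section Final
variable (C C' : BasedFreeComplex Γ) (M : ℕ)

abbrev EI : Type := BI C M ⊕ BI C' M

def dgE : EI C C' M → ℕ := Sum.elim (fun s => s.1) (fun s => s.1)
def sdE : EI C C' M → ℤ := Sum.elim (fun _ => 0) (fun _ => 1)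
def epE : EI C C' M → ℤ := fun e => (1 - 2 * sdE C C' M e) * (-1) ^ dgE C C' M e
def wE : EI C C' M → ℤ := fun e => (1 - 2 * sdE C C' M e) * ((-1) ^ dgE C C' M e * dgE C C' M e)

def dE : Matrix (EI C C' M) (EI C C' M) (MonoidAlgebra ℤ Γ) :=
  Matrix.fromBlocks (dT C M) 0 0 (dT C' M)

variable {C C' M}

theorem dE_supp {s t : EI C C' M} (h : dE C C' M s t ≠ 0) :
    sdE C C' M s = sdE C C' M t ∧ dgE C C' M s = dgE C C' M t + 1 := by
  rcases s with s | s <;> rcases t with t | t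
  · refine ⟨rfl, ?_⟩
    by_contra hne
    have hne' : ¬ (s.1 : ℕ) = t.1 + 1 := hne
    exact h (by
      show up C.d _ _ _ _ = 0
      rw [up_ne _ hne']; rfl)
  · exact absurd rfl h
  · exact absurd rfl h
  · refine ⟨rfl, ?_⟩
    by_contra hne
    have hne' : ¬ (s.1 : ℕ) = t.1 + 1 := hne
    exact h (by
      show up C'.d _ _ _ _ = 0
      rw [up_ne _ hne']; rfl)

theorem epE_sq (s : EI C C' M) : epE C C' M s = 1 ∨ epE C C' M s = -1 := by
  rcases s with s | s <;> rcases neg_one_pow_eq_or ℤ (s.1 : ℕ) with h | h <;>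
    simp [epE, sdE, dgE, h]

theorem epE_dE {s t : EI C C' M} (h : dE C C' M s t ≠ 0) : epE C C' M t = - epE C C' M s := by
  obtain ⟨h1, h2⟩ := dE_supp h
  simp only [epE, h1, h2, pow_succ]; ring

def FE (φ : CochainMap C C') (M : ℕ) : Matrix (EI C C' M) (EI C C' M) (MonoidAlgebra ℤ Γ) :=
  Matrix.fromBlocks 0 0 (fT φ M) 0

theorem FE_supp {φ : CochainMap C C'} {s t : EI C C' M} (h : FE φ M s t ≠ 0) :
    sdE C C' M s = 1 ∧ sdE C C' M t = 0 ∧ dgE C C' M s = dgE C C' M t := by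
  rcases s with s | s <;> rcases t with t | t
  · exact absurd rfl h
  · exact absurd rfl h
  · refine ⟨rfl, rfl, ?_⟩
    by_contra hne
    have hne' : ¬ (s.1 : ℕ) = t.1 := hne
    exact h (by
      show mid φ.f _ _ _ _ = 0
      rw [mid_ne _ hne']; rfl)
  · exact absurd rfl h

theorem epE_FE {φ : CochainMap C C'} {s t : EI C C' M} (h : FE φ M s t ≠ 0) :
    epE C C' M t = - epE C C' M s := by
  obtain ⟨h1, h2, h3⟩ := FE_supp h
  simp only [epE, h1, h2, h3]; ring

def sE (ψ : CochainMap C' C) (h : (j : ℕ) → Matrix (C.basis j) (C.basis (j + 1)) (MonoidAlgebra ℤ Γ))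
    (h' : (j : ℕ) → Matrix (C'.basis j) (C'.basis (j + 1)) (MonoidAlgebra ℤ Γ)) (M : ℕ) :
    Matrix (EI C C' M) (EI C C' M) (MonoidAlgebra ℤ Γ) :=
  Matrix.fromBlocks (-tot M (dn h)) (fT ψ M) 0 (tot M (dn h'))

theorem epE_sE {ψ : CochainMap C' C} {h h'} {s t : EI C C' M} (hs : sE ψ h h' M s t ≠ 0) :
    epE C C' M t = - epE C C' M s := by
  rcases s with s | s <;> rcases t with t | t
  · have : (t.1 : ℕ) = s.1 + 1 := by
      by_contra hne
      exact hs (by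
        show -(dn h _ _ _ _) = 0
        rw [dn_ne _ hne]; simp)
    simp [epE, sdE, dgE, this, pow_succ]
  · have : (s.1 : ℕ) = t.1 := by
      by_contra hne
      exact hs (by
        show mid ψ.f _ _ _ _ = 0
        rw [mid_ne _ hne]; rfl)
    simp [epE, sdE, dgE, this]
  · exact absurd rfl hs
  · have : (t.1 : ℕ) = s.1 + 1 := by
      by_contra hne
      exact hs (by
        show (dn h' _ _ _ _) = 0
        rw [dn_ne _ hne]; rfl)
    simp [epE, sdE, dgE, this, pow_succ]

variable [∀ (C : BasedFreeComplex Γ) j, DecidableEq (C.basis j)]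

theorem LE_eq (hM : C.N < M) (hM' : C'.N < M) :
    adjM (dE C C' M) * dE C C' M + dE C C' M * adjM (dE C C' M) =
      Matrix.fromBlocks (tot M (mid (lapM C))) 0 0 (tot M (mid (lapM C'))) := by
  have h : adjM (dE C C' M) = Matrix.fromBlocks (adjM (dT C M)) 0 0 (adjM (dT C' M)) := by
    ext1 s t
    rcases s with s | s <;> rcases t with t | t
    · rfl
    · exact gstar_zero
    · exact gstar_zero
    · rfl
  rw [h, dE, Matrix.fromBlocks_multiply, Matrix.fromBlocks_multiply, Matrix.fromBlocks_add,
    ← LT_eq hM, ← LT_eq hM']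
  simp

def lE (C C' : BasedFreeComplex Γ) (M : ℕ) : Matrix (EI C C' M) (EI C C' M) (MonoidAlgebra ℤ Γ) :=
  Matrix.fromBlocks (tot M (mid (lapM C))) 0 0 (tot M (mid (lapM C')))

theorem lE_pow (hM : C.N < M) (hM' : C'.N < M) (k : ℕ) : lE C C' M ^ k =
    Matrix.fromBlocks (tot M (mid fun j => lapM C j ^ k)) 0 0 (tot M (mid fun j => lapM C' j ^ k)) := by
  rw [← LT_pow hM, ← LT_pow hM']
  induction k with
  | zero => simp [Matrix.fromBlocks_one]
  | succ k ih => rw [pow_succ, ih, lE, Matrix.fromBlocks_multiply]; simp [pow_succ]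

theorem lE_isUnit (hC : C.AcyclicWithGap) (hC' : C'.AcyclicWithGap) :
    IsUnit (RV (EI C C' M) (lE C C' M)) := by
  apply isUnit_vn
  refine isUnit_blocks _ _ (bij_tot_mid C M _ fun j => ?_) (bij_tot_mid C' M _ fun j => ?_)
  · rw [← lap_eq]; exact hC j
  · rw [← lap_eq]; exact hC' j

def qL (C C' : BasedFreeComplex Γ) (M : ℕ) (j : Fin M) : EI C C' M → ℤ :=
  Sum.elim (fun s => if s.1 = j then 1 else 0) (fun _ => 0)
def qR (C C' : BasedFreeComplex Γ) (M : ℕ) (j : Fin M) : EI C C' M → ℤ :=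
  Sum.elim (fun _ => 0) (fun s => if s.1 = j then 1 else 0)

theorem wE_eq : wE C C' M = ∑ j : Fin M, ((-1) ^ (j:ℕ) * (j:ℤ) : ℤ) • qL C C' M j -
    ∑ j : Fin M, ((-1) ^ (j:ℕ) * (j:ℤ) : ℤ) • qR C C' M j := by
  funext e
  rcases e with s | s
  · simp [wE, qL, qR, sdE, dgE]
  · simp [wE, qL, qR, sdE, dgE]

theorem sumL (F : BI C M → ℝ) (j : Fin M) :
    ∑ s : BI C M, (((if s.1 = j then 1 else 0 : ℤ)) : ℝ) * F s = ∑ x, F ⟨j, x⟩ := by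
  rw [Fintype.sum_sigma, Finset.sum_eq_single j]
  · simp
  · intro b _ hb; simp [hb]
  · simp

theorem LamT_w (hM : C.N < M) (hM' : C'.N < M) (hC : C.AcyclicWithGap) (hC' : C'.AcyclicWithGap)
    (hp : PosInv (RV (EI C C' M) (lE C C' M))) :
    LamT (cfc Real.log (RV (EI C C' M) (lE C C' M))) (wE C C' M) =
      ∑ j : Fin M, (((-1) ^ (j:ℕ) * (j:ℤ) : ℤ) : ℝ) * tlap C j -
      ∑ j : Fin M, (((-1) ^ (j:ℕ) * (j:ℤ) : ℤ) : ℝ) * tlap C' j := by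
  rw [wE_eq, map_sub, map_sum, map_sum]
  congr 1
  · refine Finset.sum_congr rfl fun j _ => ?_
    rw [map_zsmul, zsmul_eq_mul, LamT_lap hC j _ hp]
    intro k
    rw [lE_pow hM hM', Fintype.sum_sum_type]
    simp only [qL, Sum.elim_inl, Sum.elim_inr, Int.cast_zero, zero_mul, Finset.sum_const_zero,
      add_zero, Matrix.fromBlocks_apply₁₁]
    rw [sumL]
    simp [tot]
  · refine Finset.sum_congr rfl fun j _ => ?_
    rw [map_zsmul, zsmul_eq_mul, LamT_lap hC' j _ hp]
    intro k
    rw [lE_pow hM hM', Fintype.sum_sum_type]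
    simp only [qR, Sum.elim_inl, Sum.elim_inr, Int.cast_zero, zero_mul, Finset.sum_const_zero,
      zero_add, Matrix.fromBlocks_apply₂₂]
    rw [sumL]
    simp [tot]

theorem DE_eq (φ : CochainMap C C') :
    dg (2 * sdE C C' M - 1) * dE C C' M + FE φ M =
      Matrix.fromBlocks (-dT C M) 0 (fT φ M) (dT C' M) := by
  have h : (dg (2 * sdE C C' M - 1) : Matrix _ _ (MonoidAlgebra ℤ Γ)) = Matrix.fromBlocks (-1) 0 0 1 := by
    ext1 s t
    rcases s with s | s <;> rcases t with t | t
    · by_cases h : s = t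
      · subst h; simp [dg, sdE]
      · simp [dg, h]
    · simp [dg]
    · simp [dg]
    · by_cases h : s = t
      · subst h; simp [dg, sdE]; norm_num
      · simp [dg, h]
  rw [h, dE, FE, Matrix.fromBlocks_multiply, Matrix.fromBlocks_add]
  simp

end Final

section Final2
variable {C C' : BasedFreeComplex Γ} {M : ℕ}
variable [∀ (C : BasedFreeComplex Γ) j, DecidableEq (C.basis j)]

theorem sq_one_of {R : Type*} [Ring R] {D σ : R} (h1 : D * D = 0) (h2 : σ * σ = 0)
    (h3 : D * σ + σ * D = 1) : (D + σ) * (D + σ) = 1 := by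
  rw [add_mul, mul_add, mul_add, h1, h2, ← h3]; abel

theorem odd_add_of {R : Type*} [Ring R] {D σ a b : R} (h1 : D * a = b * D) (h2 : σ * a = b * σ) :
    (D + σ) * a = b * (D + σ) := by
  rw [add_mul, mul_add, h1, h2]

theorem odd_sub_of {R : Type*} [Ring R] {σ a b e : R} (h1 : σ * a = b * σ) (h2 : σ * b = a * σ)
    (h : a - b = e) : σ * e = -(e * σ) := by
  rw [← h, mul_sub, sub_mul, h1, h2]; abel

def aE (C C' : BasedFreeComplex Γ) (M : ℕ) : EI C C' M → ℤ := fun e => if epE C C' M e = 1 then 1 else 0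
def bE (C C' : BasedFreeComplex Γ) (M : ℕ) : EI C C' M → ℤ := fun e => if epE C C' M e = 1 then 0 else 1

theorem odd_E (X : Matrix (EI C C' M) (EI C C' M) (MonoidAlgebra ℤ Γ))
    (hX : ∀ s t, X s t ≠ 0 → epE C C' M t = - epE C C' M s) :
    X * dg (aE C C' M) = dg (bE C C' M) * X ∧ X * dg (bE C C' M) = dg (aE C C' M) * X := by
  constructor
  · refine dg_comm _ _ _ fun s t hst => ?_
    have := hX s t hst
    rcases epE_sq s with h1 | h1 <;> simp [aE, bE, this, h1]
  · refine dg_comm _ _ _ fun s t hst => ?_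
    have := hX s t hst
    rcases epE_sq s with h1 | h1 <;> simp [aE, bE, this, h1]

theorem hab_E : (dg (aE C C' M) + dg (bE C C' M) :
    Matrix (EI C C' M) (EI C C' M) (MonoidAlgebra ℤ Γ)) = 1 := by
  rw [dg_add, ← dg_one]; congr 1; funext e
  simp only [aE, bE, Pi.add_apply, Pi.one_apply]; split_ifs <;> simp

theorem hamb_E : (dg (aE C C' M) - dg (bE C C' M) :
    Matrix (EI C C' M) (EI C C' M) (MonoidAlgebra ℤ Γ)) = dg (epE C C' M) := by
  rw [dg_sub]; congr 1; funext e
  rcases epE_sq e with h1 | h1 <;> simp [aE, bE, h1]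

theorem aa_E : (dg (aE C C' M) * dg (aE C C' M) :
    Matrix (EI C C' M) (EI C C' M) (MonoidAlgebra ℤ Γ)) = dg (aE C C' M) := by
  rw [dg_mul]; congr 1; funext e; simp [aE]

theorem bb_E : (dg (bE C C' M) * dg (bE C C' M) :
    Matrix (EI C C' M) (EI C C' M) (MonoidAlgebra ℤ Γ)) = dg (bE C C' M) := by
  rw [dg_mul]; congr 1; funext e; simp [bE]

theorem ab_E : (dg (aE C C' M) * dg (bE C C' M) :
    Matrix (EI C C' M) (EI C C' M) (MonoidAlgebra ℤ Γ)) = 0 := by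
  rw [dg_mul, ← dg_zero]; congr 1; funext e; simp [aE, bE]

theorem ba_E : (dg (bE C C' M) * dg (aE C C' M) :
    Matrix (EI C C' M) (EI C C' M) (MonoidAlgebra ℤ Γ)) = 0 := by
  rw [dg_mul, ← dg_zero]; congr 1; funext e; simp [aE, bE]

def DM (φ : CochainMap C C') (M : ℕ) : Matrix (EI C C' M) (EI C C' M) (MonoidAlgebra ℤ Γ) :=
  dg (2 * sdE C C' M - 1) * dE C C' M + FE φ M

theorem DM_block (φ : CochainMap C C') : DM φ M =
    Matrix.fromBlocks (-dT C M) 0 (fT φ M) (dT C' M) := DE_eq φ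

theorem DM_sq (φ : CochainMap C C') (hM : C.N < M) (hM' : C'.N < M) : DM φ M * DM φ M = 0 := by
  have comm := fT_comm φ hM hM'
  rw [DM_block, Matrix.fromBlocks_multiply]
  simp [dT_sq hM, dT_sq hM', comm, Matrix.fromBlocks_zero]

theorem DM_odd (φ : CochainMap C C') (s t : EI C C' M) (hst : DM φ M s t ≠ 0) :
    epE C C' M t = - epE C C' M s := by
  by_cases h1 : dE C C' M s t = 0
  · apply epE_FE (φ := φ)
    intro h2
    apply hst
    rw [DM, Matrix.add_apply, dg, Matrix.diagonal_mul, h1, h2, mul_zero, add_zero]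
  · exact epE_dE h1

def nE (φ : CochainMap C C') (h : (j : ℕ) → Matrix (C.basis j) (C.basis (j + 1)) (MonoidAlgebra ℤ Γ))
    (h' : (j : ℕ) → Matrix (C'.basis j) (C'.basis (j + 1)) (MonoidAlgebra ℤ Γ)) (M : ℕ) :
    Matrix (EI C C' M) (EI C C' M) (MonoidAlgebra ℤ Γ) :=
  Matrix.fromBlocks 0 0 (tot M (dn h') * fT φ M - fT φ M * tot M (dn h)) 0

theorem nE_sq (φ : CochainMap C C') (h h') : nE φ h h' M * nE φ h h' M = 0 := by
  rw [nE, Matrix.fromBlocks_multiply]; simp [Matrix.fromBlocks_zero]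

theorem pre_contr (φ : CochainMap C C') (hφ : φ.IsHomotopyEquivalence) (hM : C.N < M)
    (hM' : C'.N < M) : ∃ (ψ : CochainMap C' C) (h : _) (h' : _),
      DM φ M * sE ψ h h' M + sE ψ h h' M * DM φ M = 1 + nE φ h h' M := by
  obtain ⟨ψ, hh, hh'⟩ := hφ
  obtain ⟨h, hh⟩ := homot_tot hh hM hM'
  obtain ⟨h', hh'⟩ := homot_tot hh' hM' hM
  have comm' := fT_comm ψ hM' hM
  refine ⟨ψ, h, h', ?_⟩
  rw [DM_block, sE, nE, ← Matrix.fromBlocks_one, Matrix.fromBlocks_multiply,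
    Matrix.fromBlocks_multiply, Matrix.fromBlocks_add, Matrix.fromBlocks_add]
  congr 1
  · rw [← hh]; simp; abel
  · simp [comm']
  · simp; abel
  · rw [← hh']; simp; abel

theorem contr_E (hG : IsAmenable Γ ∨ IsResiduallyFinite Γ) (φ : CochainMap C C')
    (hφ : φ.IsHomotopyEquivalence) (hM : C.N < M) (hM' : C'.N < M) :
    ∃ σ : Matrix (EI C C' M) (EI C C' M) (MonoidAlgebra ℤ Γ),
      DM φ M * σ + σ * DM φ M = 1 ∧ σ * σ = 0 ∧
      σ * dg (epE C C' M) = -(dg (epE C C' M) * σ) ∧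
      sL (trV Γ (EI C C' M)) (RV (EI C C' M) (dg (epE C C' M))) (RV (EI C C' M) (DM φ M + σ)) = 0 := by
  obtain ⟨ψ, h, h', hs0⟩ := pre_contr φ hφ hM hM'
  have o1 := odd_E (DM φ M) (DM_odd φ)
  have o2 := odd_E (sE ψ h h' M) (fun s t => epE_sE)
  have hDD := DM_sq φ hM hM'
  obtain ⟨σ, hσ, hσσ, hσa, hσb⟩ := odd_contraction hDD hs0 (nE_sq φ h h') o1.1 o1.2 o2.1 o2.2
  refine ⟨σ, hσ, hσσ, odd_sub_of hσa hσb hamb_E, ?_⟩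
  have hsL := sL_int_zero hG hab_E aa_E bb_E ab_E ba_E (adjM_dg _) (adjM_dg _)
    (sq_one_of hDD hσσ hσ) (odd_add_of o1.1 hσa) (odd_add_of o1.2 hσb)
  rwa [hamb_E] at hsL

theorem dE_sq (hM : C.N < M) (hM' : C'.N < M) : dE C C' M * dE C C' M = 0 := by
  rw [dE, Matrix.fromBlocks_multiply]; simp [dT_sq hM, dT_sq hM', Matrix.fromBlocks_zero]

theorem lap_E (hM : C.N < M) (hM' : C'.N < M) :
    star (RV _ (dE C C' M)) * RV _ (dE C C' M) + RV _ (dE C C' M) * star (RV _ (dE C C' M))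
      = RV (EI C C' M) (lE C C' M) := by
  rw [← RV_star, ← RV_mul, ← RV_mul, ← RV_add, LE_eq hM hM']; rfl

theorem pos_E (hM : C.N < M) (hM' : C'.N < M)
    (hC : C.AcyclicWithGap) (hC' : C'.AcyclicWithGap) : PosInv (RV (EI C C' M) (lE C C' M)) := by
  have hu := lE_isUnit (M := M) hC hC'
  rw [← lap_E hM hM'] at hu ⊢
  have hdd' : RV (EI C C' M) (dE C C' M) * RV (EI C C' M) (dE C C' M) = 0 := by
    rw [← RV_mul, dE_sq hM hM', RV_zero]
  generalize RV (EI C C' M) (dE C C' M) = d at hu hdd' ⊢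
  have hee : star d * star d = 0 := by
    rw [← star_mul, hdd', star_zero]
  have hS : star d * d + d * star d = (d + star d) * (d + star d) := by
    rw [add_mul, mul_add, mul_add, hdd', hee]; abel
  refine ⟨d + star d, ?_, ?_⟩
  · rw [hS] at hu
    exact ((Commute.refl _).isUnit_mul_iff.1 hu).1
  · rw [star_add, star_star, add_comm (star _) d, hS]

theorem sd_cases (s : EI C C' M) : sdE C C' M s = 0 ∨ sdE C C' M s = 1 := by
  rcases s with s | s <;> simp [sdE]

theorem dgc (u v : EI C C' M → ℤ) :
    (dg u * dg v : Matrix (EI C C' M) (EI C C' M) (MonoidAlgebra ℤ Γ)) = dg v * dg u := by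
  rw [dg_mul, dg_mul, mul_comm]

theorem RV_congr2 {ι : Type} [Fintype ι] [DecidableEq ι] {a b c e : Matrix ι ι (MonoidAlgebra ℤ Γ)}
    (h : a * b = c * e) : RV ι a * RV ι b = RV ι c * RV ι e := by
  rw [← RV_mul, ← RV_mul, h]

theorem RV_congr1 {ι : Type} [Fintype ι] [DecidableEq ι] {a b c : Matrix ι ι (MonoidAlgebra ℤ Γ)}
    (h : a * b = c) : RV ι a * RV ι b = RV ι c := by
  rw [← RV_mul, h]

theorem RV_congrn {ι : Type} [Fintype ι] [DecidableEq ι] {a b c e : Matrix ι ι (MonoidAlgebra ℤ Γ)}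
    (h : a * b = -(c * e)) : RV ι a * RV ι b = -(RV ι c * RV ι e) := by
  rw [← RV_mul, ← RV_mul, ← RV_neg, h]

theorem e1 : (dg (sdE C C' M) * dg (sdE C C' M) :
    Matrix (EI C C' M) (EI C C' M) (MonoidAlgebra ℤ Γ)) = dg (sdE C C' M) := by
  rw [dg_mul]; congr 1; funext s; rcases sd_cases s with h | h <;> simp [h]

theorem e2 : (dg (2 * sdE C C' M - 1) * dg (2 * sdE C C' M - 1) :
    Matrix (EI C C' M) (EI C C' M) (MonoidAlgebra ℤ Γ)) = 1 := by
  rw [dg_mul, ← dg_one]; congr 1; funext s; rcases sd_cases s with h | h <;> simp [h]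

theorem e3 : dg (2 * sdE C C' M - 1) * dE C C' M = dE C C' M * dg (2 * sdE C C' M - 1) := by
  symm
  exact dg_comm _ _ _ fun s t hst => by simp [(dE_supp hst).1]

theorem e4 : dg (sdE C C' M) * dE C C' M = dE C C' M * dg (sdE C C' M) := by
  symm
  exact dg_comm _ _ _ fun s t hst => by simp [(dE_supp hst).1]

theorem e5 : dE C C' M * dg (epE C C' M) = -(dg (epE C C' M) * dE C C' M) := by
  rw [← neg_mul, dg_neg]
  exact dg_comm _ _ _ fun s t hst => by simp [epE_dE hst]

theorem e6 : dg (wE C C' M) * dE C C' M = -(dE C C' M * (dg (wE C C' M) + dg (epE C C' M))) := by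
  rw [dg_add, ← mul_neg, dg_neg]; symm
  exact dg_comm _ _ _ fun s t hst => by
    obtain ⟨h1, h2⟩ := dE_supp hst
    simp only [Pi.neg_apply, Pi.add_apply, wE, epE, h1, h2, pow_succ]; push_cast; ring

theorem e7 (φ : CochainMap C C') : dg (sdE C C' M) * FE φ M = FE φ M := by
  rw [dg_mul_left (sdE C C' M) 1 _ fun s t hst => by simp [(FE_supp hst).1], dg_one, one_mul]

theorem e8 (φ : CochainMap C C') : FE φ M * dg (sdE C C' M) = 0 := by
  rw [dg_comm (sdE C C' M) 0 _ fun s t hst => by simp [(FE_supp hst).2.1], dg_zero, zero_mul]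

theorem e9 (φ : CochainMap C C') : dg (2 * sdE C C' M - 1) * FE φ M = FE φ M := by
  rw [dg_mul_left _ 1 _ fun s t hst => by simp [(FE_supp hst).1], dg_one, one_mul]

theorem e10 (φ : CochainMap C C') : FE φ M * dg (2 * sdE C C' M - 1) = -FE φ M := by
  rw [dg_comm _ (-1) _ fun s t hst => by simp [(FE_supp hst).2.1], ← dg_neg, dg_one,
          neg_mul, one_mul]

theorem e11 (φ : CochainMap C C') : FE φ M * dg (epE C C' M) = -(dg (epE C C' M) * FE φ M) := by
  rw [← neg_mul, dg_neg]
  exact dg_comm _ _ _ fun s t hst => by simp [epE_FE hst]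

theorem e12 (φ : CochainMap C C') (hM : C.N < M) (hM' : C'.N < M) :
    dE C C' M * FE φ M = FE φ M * dE C C' M := by
  have comm := fT_comm φ hM hM'
  rw [dE, FE, Matrix.fromBlocks_multiply, Matrix.fromBlocks_multiply]
  simp [comm]

theorem RV_DM (φ : CochainMap C C') : RV (EI C C' M) (dg (2 * sdE C C' M - 1)) * RV _ (dE C C' M) +
    RV _ (FE φ M) = RV _ (DM φ M) := by
  rw [← RV_mul, ← RV_add]; rfl

theorem main_trace (hG : IsAmenable Γ ∨ IsResiduallyFinite Γ) (φ : CochainMap C C')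
    (hφ : φ.IsHomotopyEquivalence) (hM : C.N < M) (hM' : C'.N < M)
    (hC : C.AcyclicWithGap) (hC' : C'.AcyclicWithGap) :
    LamT (cfc Real.log (RV (EI C C' M) (lE C C' M))) (wE C C' M) = 0 := by
  obtain ⟨σ, h1, h2, h3, h4⟩ := contr_E hG φ hφ hM hM'
  have hpos := pos_E hM hM' hC hC'
  have hΔ := lap_E hM hM'
  have g1 : RV (Γ := Γ) (EI C C' M) (dg (2 * sdE C C' M - 1)) * RV _ (dg (2 * sdE C C' M - 1)) = 1 := by
    rw [← RV_mul, e2, RV_one]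
  have g2 : RV (EI C C' M) (dE C C' M) * RV _ (dE C C' M) = 0 := by
    rw [← RV_mul, dE_sq hM hM', RV_zero]
  have g3 : RV (EI C C' M) (dg (wE C C' M)) * RV _ (dE C C' M) =
      -(RV _ (dE C C' M) * (RV _ (dg (wE C C' M)) + RV _ (dg (epE C C' M)))) := by
    rw [← RV_add]; exact RV_congrn e6
  have g4 : RV (EI C C' M) (FE φ M) * RV _ (dg (sdE C C' M)) = 0 := by
    rw [← RV_mul, e8, RV_zero]
  have g5 : RV (EI C C' M) (FE φ M) * RV _ (dg (2 * sdE C C' M - 1)) = -RV _ (FE φ M) := by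
    rw [← RV_mul, e10, RV_neg]
  have g6 : (RV (EI C C' M) (dg (2 * sdE C C' M - 1)) * RV _ (dE C C' M) + RV _ (FE φ M)) * RV _ σ +
      RV _ σ * (RV (EI C C' M) (dg (2 * sdE C C' M - 1)) * RV _ (dE C C' M) + RV _ (FE φ M)) = 1 := by
    rw [RV_DM, ← RV_mul, ← RV_mul, ← RV_add, h1, RV_one]
  have g7 : RV (EI C C' M) σ * RV _ σ = 0 := by rw [← RV_mul, h2, RV_zero]
  have g8 : sL (trV Γ (EI C C' M)) (RV (EI C C' M) (dg (epE C C' M)))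
      (RV (EI C C' M) (dg (2 * sdE C C' M - 1)) * RV _ (dE C C' M) + RV _ (FE φ M) + RV _ σ) = 0 := by
    rw [RV_DM, ← RV_add]; exact h4
  have gs : ∀ u : EI C C' M → ℤ, star (RV (Γ := Γ) (EI C C' M) (dg u)) = RV _ (dg u) := fun u => by
    rw [← RV_star, adjM_dg]
  have gu : IsUnit (star (RV _ (dE C C' M)) * RV _ (dE C C' M) +
      RV (EI C C' M) (dE C C' M) * star (RV _ (dE C C' M))) := by
    rw [hΔ]; exact hpos.isUnit
  have main := abstract_main (trV Γ (EI C C' M)) trV_comm (gs _) (RV_congr1 e1) (gs _) g1 (gs _)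
    (RV_congr2 e3) (RV_congr2 (dgc _ _)) (RV_congr2 (dgc _ _)) (RV_congr2 e4)
    (RV_congr2 (dgc _ _)) g2 (RV_congrn e5) g3 gu (RV_congr1 (e7 φ)) g4 (RV_congr1 (e9 φ)) g5
    (RV_congrn (e11 φ)) (RV_congr2 (e12 φ hM hM')) g6 g7 (RV_congrn h3) g8
  rw [hΔ] at main
  exact main
end Final2

theorem torsion_main
    (Γ : Type) [Group Γ] [Countable Γ]
    (hfp : IsFinitelyPresented Γ)
    (hG : IsAmenable Γ ∨ IsResiduallyFinite Γ)
    (C C' : BasedFreeComplex Γ)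
    (φ : CochainMap C C') (hφ : φ.IsHomotopyEquivalence)
    (hC : C.AcyclicWithGap) (hC' : C'.AcyclicWithGap) :
    C.torsion = C'.torsion := by
  classical
  have hM : C.N < C.N + C'.N + 1 := by omega
  have hM' : C'.N < C.N + C'.N + 1 := by omega
  have h1 := main_trace hG φ hφ hM hM' hC hC'
  have h2 := pos_E hM hM' hC hC'
  rw [LamT_w hM hM' hC hC' h2] at h1
  rw [torsion_eq hC hM, torsion_eq hC' hM', sub_eq_zero.1 h1]

/-- **Homotopy invariance of `L²` torsion** (combinatorial form, `ℓ²`-acyclic case).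
Let `Γ` be a countable, finitely presented group which is either amenable or residually
finite.  If `C` and `C'` are based free `ℤΓ`-cochain complexes which are chain homotopy
equivalent over `ℤΓ`, and both are `ℓ²`-acyclic with spectral gap (all Laplacians of
their `ℓ²`-completions are invertible), then their `L²` torsions agree:
`∏_j Det_τ(Δ_j)^{(-1)^j j} = ∏_j Det_τ(Δ'_j)^{(-1)^j j}`. -/
theorem L2_torsion_homotopy_invariance
    (Γ : Type) [Group Γ] [Countable Γ]
    (hfp : IsFinitelyPresented Γ)
    (hG : IsAmenable Γ ∨ IsResiduallyFinite Γ)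
    (C C' : BasedFreeComplex Γ)
    (φ : CochainMap C C') (hφ : φ.IsHomotopyEquivalence)
    (hC : C.AcyclicWithGap) (hC' : C'.AcyclicWithGap) :
    C.torsion = C'.torsion := by
  exact torsion_main Γ hfp hG C C' φ hφ hC hC'
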